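/- Let n ≥ 2, let S ⊆ ℝ^n be a Borel measurable set symmetric about the origin with Lebesgue measure V, and let h be a positive integer with h ≤ √(n/2). Then 0 ≤ ∫_{X_n} ρ_{S',h}(L) dμ_n(L) − (1/h!)·(V/2)^h ≤ (23/h!)·(0.999)^n·(V/2+1)^{√(n/2)}. -/

import Mathlib

open MeasureTheory Matrix
open scoped Nat Classical

noncomputable section

abbrev SLR (n : ℕ) := Matrix.SpecialLinearGroup (Fin n) ℝ

instance (n : ℕ) : MeasurableSpace (SLR n) :=
  MeasurableSpace.comap (fun g : SLR n => (g : Matrix (Fin n) (Fin n) ℝ))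
    (inferInstanceAs (MeasurableSpace (Fin n → Fin n → ℝ)))

/-- The image of SL_n(ℤ) in SL_n(ℝ), as a subgroup. -/
def SLZ (n : ℕ) : Subgroup (SLR n) :=
  (Matrix.SpecialLinearGroup.map (Int.castRingHom ℝ)).range

/-- The space of lattices `X_n = SL_n(ℤ) \ SL_n(ℝ)` (space of right cosets). -/
def LatSpace (n : ℕ) := Quotient (QuotientGroup.rightRel (SLZ n))

instance (n : ℕ) : MeasurableSpace (LatSpace n) :=
  inferInstanceAs (MeasurableSpace (Quotient _))

/-- The coset of `g`. -/
def latMk (n : ℕ) (g : SLR n) : LatSpace n :=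
  Quotient.mk (QuotientGroup.rightRel (SLZ n)) g

/-- Right translation action of `SL_n(ℝ)` on `X_n`. -/
def rTranslate (n : ℕ) (a : SLR n) (x : LatSpace n) : LatSpace n :=
  Quotient.lift (fun g => latMk n (g * a))
    (fun g g' hgg' => Quotient.sound (QuotientGroup.rightRel_apply.mpr (by
      have h : g' * g⁻¹ ∈ SLZ n := QuotientGroup.rightRel_apply.mp hgg'
      simpa [_root_.mul_inv_rev, mul_assoc] using h))) x

/-- The lattice `ℤ^n g` associated to `g ∈ SL_n(ℝ)`. -/
def latticeOf (n : ℕ) (g : SLR n) : Set (Fin n → ℝ) :=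
  Set.range (fun m : Fin n → ℤ =>
    Matrix.vecMul (fun i => (m i : ℝ)) (g : Matrix (Fin n) (Fin n) ℝ))

/-- `S'`: the set of points of `S` whose first nonzero coordinate is positive. -/
def posHalf (n : ℕ) (S : Set (Fin n → ℝ)) : Set (Fin n → ℝ) :=
  {x ∈ S | ∃ i : Fin n, 0 < x i ∧ ∀ j < i, x j = 0}

/-- `A` has at least `k` elements. -/
def hasAtLeast {α : Type*} (A : Set α) (k : ℕ) : Prop :=
  ∃ t : Finset α, ↑t ⊆ A ∧ t.card = k

/-- `ρ_{S',h}(L)`: the number of `h`-element subsets of `L ∩ S'`. -/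
def rhoSub (n : ℕ) (S : Set (Fin n → ℝ)) (h : ℕ) (g : SLR n) : ℕ :=
  Nat.card {t : Finset (Fin n → ℝ) // ↑t ⊆ latticeOf n g ∩ posHalf n S ∧ t.card = h}

end

open scoped ENNReal

lemma measurable_toSLR {n : ℕ} {α : Type*} [MeasurableSpace α] {f : α → SLR n}
    (h : ∀ i j, Measurable fun x => (f x : Matrix (Fin n) (Fin n) ℝ) i j) : Measurable f := by
  have h' : Measurable fun x => (show Fin n → Fin n → ℝ from (f x).1) :=
    measurable_pi_iff.mpr fun i => measurable_pi_iff.mpr fun j => h i j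
  rintro _ ⟨s, hs, rfl⟩
  exact h' hs

lemma measurable_SLR_entry {n : ℕ} (i j : Fin n) :
    Measurable fun g : SLR n => (g : Matrix (Fin n) (Fin n) ℝ) i j := by
  have h : Measurable fun g : SLR n => (show Fin n → Fin n → ℝ from g.1) :=
    fun s hs => ⟨s, hs, rfl⟩
  exact (measurable_pi_apply j).comp ((measurable_pi_apply i).comp h)

instance (n : ℕ) : MeasurableMul₂ (SLR n) where
  measurable_mul := by
    refine measurable_toSLR fun i j => ?_
    simp only [Matrix.SpecialLinearGroup.coe_mul, Matrix.mul_apply]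
    exact Finset.measurable_sum _ fun k _ =>
      ((measurable_SLR_entry i k).comp measurable_fst).mul
        ((measurable_SLR_entry k j).comp measurable_snd)

instance (n : ℕ) : MeasurableInv (SLR n) where
  measurable_inv := by
    refine measurable_toSLR fun i j => ?_
    simp only [Matrix.SpecialLinearGroup.coe_inv, Matrix.adjugate_apply, Matrix.det_apply]
    refine Finset.measurable_sum _ fun σ _ => Measurable.const_smul ?_ _
    refine Finset.measurable_prod _ fun k _ => ?_
    by_cases hk : σ k = j
    · subst hk; simp
    · simp only [Matrix.updateRow_ne hk]
      exact measurable_SLR_entry _ _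

/-- The inclusion `SL_n(ℤ) → SL_n(ℝ)`. -/
noncomputable abbrev intSL (n : ℕ) : Matrix.SpecialLinearGroup (Fin n) ℤ →* SLR n :=
  Matrix.SpecialLinearGroup.map (Int.castRingHom ℝ)

lemma latMk_intSL_mul {n : ℕ} (γ : Matrix.SpecialLinearGroup (Fin n) ℤ) (g : SLR n) :
    latMk n (intSL n γ * g) = latMk n g := by
  refine Quotient.sound (QuotientGroup.rightRel_apply.mpr ?_)
  refine ⟨γ⁻¹, ?_⟩
  simp [_root_.mul_inv_rev]

lemma exists_intSL_of_latMk_eq {n : ℕ} {g g' : SLR n} (h : latMk n g = latMk n g') :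
    ∃ γ, g' = intSL n γ * g := by
  obtain ⟨γ, hγ⟩ := QuotientGroup.rightRel_apply.mp (Quotient.exact h)
  exact ⟨γ, by rw [hγ]; simp⟩

lemma latMk_surjective (n : ℕ) : Function.Surjective (latMk n) := Quotient.exists_rep

lemma measurable_latMk (n : ℕ) : Measurable (latMk n) := measurable_quotient_mk''

lemma measurable_of_comp_latMk {n : ℕ} {β : Type*} [MeasurableSpace β] {F : LatSpace n → β}
    (h : Measurable fun g => F (latMk n g)) : Measurable F :=
  measurable_from_quotient.mpr h

/-- Descent of an `SL_n(ℤ)`-invariant function to the space of lattices. -/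
noncomputable def latDescend {n : ℕ} {β : Type*} (K : SLR n → β) (x : LatSpace n) : β :=
  K (latMk_surjective n x).choose

lemma latDescend_latMk {n : ℕ} {β : Type*} {K : SLR n → β}
    (hK : ∀ γ g, K (intSL n γ * g) = K g) (g : SLR n) : latDescend K (latMk n g) = K g := by
  obtain ⟨γ, hγ⟩ := exists_intSL_of_latMk_eq (latMk_surjective n (latMk n g)).choose_spec
  rw [latDescend]
  conv_rhs => rw [hγ, hK]

lemma measurable_latDescend {n : ℕ} {β : Type*} [MeasurableSpace β] {K : SLR n → β}
    (hK : ∀ γ g, K (intSL n γ * g) = K g) (hm : Measurable K) : Measurable (latDescend K) :=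
  measurable_of_comp_latMk (by simpa only [latDescend_latMk hK] using hm)

lemma rTranslate_latMk {n : ℕ} (a g : SLR n) :
    rTranslate n a (latMk n g) = latMk n (g * a) := rfl

lemma measurable_rTranslate {n : ℕ} (a : SLR n) : Measurable (rTranslate n a) :=
  measurable_of_comp_latMk ((measurable_latMk n).comp (measurable_mul_const a))

/-- The integral against `μ` of an invariant family of measures. -/
noncomputable def latBind {n : ℕ} {Y : Type*} [MeasurableSpace Y] (μ : Measure (LatSpace n))
    (K : SLR n → Measure Y) : Measure Y := μ.bind (latDescend K)

lemma lintegral_latBind {n : ℕ} {Y : Type*} [MeasurableSpace Y] (μ : Measure (LatSpace n))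
    {K : SLR n → Measure Y} (hK : ∀ γ g, K (intSL n γ * g) = K g) (hm : Measurable K)
    {u : Y → ℝ≥0∞} (hu : Measurable u) {U : LatSpace n → ℝ≥0∞}
    (hU : ∀ g, U (latMk n g) = ∫⁻ y, u y ∂(K g)) :
    ∫⁻ y, u y ∂(latBind μ K) = ∫⁻ x, U x ∂μ := by
  rw [latBind, Measure.lintegral_bind (measurable_latDescend hK hm).aemeasurable
    hu.aemeasurable]
  refine lintegral_congr fun x => ?_
  obtain ⟨g, rfl⟩ := latMk_surjective n x
  rw [hU, latDescend_latMk hK]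

instance (n : ℕ) : Countable (Matrix.SpecialLinearGroup (Fin n) ℤ) := by
  have : Countable (Matrix (Fin n) (Fin n) ℤ) :=
    inferInstanceAs (Countable (Fin n → Fin n → ℤ))
  exact Subtype.countable

lemma measurable_sum_dirac {X Y ι : Type*} [MeasurableSpace X] [MeasurableSpace Y] [Countable ι]
    {T : ι → X → Y} (hT : ∀ i, Measurable (T i)) :
    Measurable fun x => Measure.sum fun i => Measure.dirac (T i x) := by
  refine Measure.measurable_of_measurable_coe _ fun s hs => ?_
  simp only [Measure.sum_apply _ hs]
  exact Measurable.tsum fun i =>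
    (Measure.measurable_coe hs).comp (Measure.measurable_dirac.comp (hT i))

/-- The right-invariant lift of a measure on the space of lattices to `SL_n(ℝ)`. -/
noncomputable def latLift {n : ℕ} (μ : Measure (LatSpace n)) : Measure (SLR n) :=
  latBind μ fun g => Measure.sum fun γ => Measure.dirac (intSL n γ * g)

lemma lintegral_latLift {n : ℕ} (μ : Measure (LatSpace n))
    {u : SLR n → ℝ≥0∞} (hu : Measurable u) {U : LatSpace n → ℝ≥0∞}
    (hU : ∀ g, U (latMk n g) = ∑' γ, u (intSL n γ * g)) :
    ∫⁻ y, u y ∂(latLift μ) = ∫⁻ x, U x ∂μ := by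
  refine lintegral_latBind μ (fun δ g => ?_)
    (measurable_sum_dirac fun γ => measurable_const_mul _) hu fun g => ?_
  · ext s hs
    simp only [Measure.sum_apply _ hs, ← mul_assoc, ← map_mul]
    exact (Equiv.mulRight δ).tsum_eq fun γ => Measure.dirac (intSL n γ * g) s
  · rw [hU, lintegral_sum_measure]
    simp only [lintegral_dirac' _ hu]

lemma latLift_map_mul_right {n : ℕ} {μ : Measure (LatSpace n)}
    (hinv : ∀ a : SLR n, μ.map (rTranslate n a) = μ) (a : SLR n) :
    (latLift μ).map (· * a) = latLift μ := by
  refine Measure.ext_of_lintegral _ fun u hu => ?_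
  rw [lintegral_map hu (measurable_mul_const a)]
  have hinvu : ∀ γ g, (fun g => ∑' γ, u (intSL n γ * g)) (intSL n γ * g) =
      (fun g => ∑' γ, u (intSL n γ * g)) g := fun δ g => by
    simp only [← mul_assoc, ← map_mul]
    exact (Equiv.mulRight δ).tsum_eq fun γ => u (intSL n γ * g)
  have hm : Measurable fun g => ∑' γ, u (intSL n γ * g) :=
    Measurable.tsum fun i => hu.comp (measurable_const_mul _)
  rw [lintegral_latLift μ hu (latDescend_latMk hinvu),
    lintegral_latLift μ (u := fun g => u (g * a)) (hu.comp (measurable_mul_const a))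
      (U := fun x => latDescend (fun g => ∑' γ, u (intSL n γ * g)) (rTranslate n a x))]
  · conv_rhs => rw [← hinv a]
    rw [lintegral_map (measurable_latDescend hinvu hm) (measurable_rTranslate a)]
  · intro g
    rw [rTranslate_latMk, latDescend_latMk hinvu]
    simp only [mul_assoc]

/-- The elements of `SL_n(ℝ)` with entries bounded by `k`. -/
def slBox (n k : ℕ) : Set (SLR n) :=
  {g | ∀ i j, |(g : Matrix (Fin n) (Fin n) ℝ) i j| ≤ k}

lemma measurableSet_slBox (n k : ℕ) : MeasurableSet (slBox n k) := by
  have : slBox n k = ⋂ i, ⋂ j, {g : SLR n | |(g : Matrix (Fin n) (Fin n) ℝ) i j| ≤ k} := by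
    ext g; simp [slBox]
  rw [this]
  exact MeasurableSet.iInter fun i => MeasurableSet.iInter fun j =>
    measurableSet_le (measurable_SLR_entry i j).abs measurable_const

lemma finite_intSL_mul_mem_slBox {n : ℕ} (k : ℕ) (g : SLR n) :
    {γ : Matrix.SpecialLinearGroup (Fin n) ℤ | intSL n γ * g ∈ slBox n k}.Finite := by
  let C : ℝ := ∑ l, ∑ j, k * |((g⁻¹ : SLR n) : Matrix (Fin n) (Fin n) ℝ) l j|
  have hfin : {A : Fin n → Fin n → ℤ | ∀ i j, A i j ∈ Set.Icc (-⌈C⌉) ⌈C⌉}.Finite := by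
    have : {A : Fin n → Fin n → ℤ | ∀ i j, A i j ∈ Set.Icc (-⌈C⌉) ⌈C⌉} =
        Set.univ.pi fun _ => Set.univ.pi fun _ => Set.Icc (-⌈C⌉) ⌈C⌉ := by
      ext A
      simp only [Set.mem_ofPred_eq, Set.mem_pi, Set.mem_univ, forall_const]
    rw [this]
    exact Set.Finite.pi fun _ => Set.Finite.pi fun _ => Set.finite_Icc _ _
  refine Set.Finite.of_finite_image (f := fun γ => (γ : Fin n → Fin n → ℤ))
    (hfin.subset ?_) fun a _ b _ h => Subtype.ext h
  rintro _ ⟨γ, hγ, rfl⟩ i j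
  have h1 : ((γ : Matrix (Fin n) (Fin n) ℤ) i j : ℝ) =
      ∑ l, ((intSL n γ * g : SLR n) : Matrix (Fin n) (Fin n) ℝ) i l *
        ((g⁻¹ : SLR n) : Matrix (Fin n) (Fin n) ℝ) l j := by
    rw [← Matrix.mul_apply, ← Matrix.SpecialLinearGroup.coe_mul, mul_inv_cancel_right]
    rfl
  have h2 : |((γ : Matrix (Fin n) (Fin n) ℤ) i j : ℝ)| ≤ C := by
    rw [h1]
    refine (Finset.abs_sum_le_sum_abs _ _).trans (Finset.sum_le_sum fun l _ => ?_)
    rw [abs_mul]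
    refine (mul_le_mul_of_nonneg_right (hγ i l) (abs_nonneg _)).trans ?_
    exact Finset.single_le_sum
      (f := fun j => (k : ℝ) * |((g⁻¹ : SLR n) : Matrix (Fin n) (Fin n) ℝ) l j|)
      (fun _ _ => by positivity) (Finset.mem_univ j)
  have h3 : |(γ : Matrix (Fin n) (Fin n) ℤ) i j| ≤ ⌈C⌉ := by
    exact_mod_cast h2.trans (Int.le_ceil C)
  exact abs_le.mp h3

/-- A strictly positive weight on `SL_n(ℝ)` whose sum over every `SL_n(ℤ)`-orbit is `1`. -/
lemma exists_orbit_weight (n : ℕ) : ∃ w : SLR n → ℝ≥0∞, Measurable w ∧ (∀ g, w g ≠ 0) ∧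
    (∀ g, w g ≠ ∞) ∧ ∀ g, ∑' γ, w (intSL n γ * g) = 1 := by
  let N : ℕ → SLR n → ℝ≥0∞ := fun k g => ∑' γ, (slBox n k).indicator 1 (intSL n γ * g)
  have hNm : ∀ k, Measurable (N k) := fun k => Measurable.tsum fun γ =>
    ((measurable_one.indicator (measurableSet_slBox n k))).comp (measurable_const_mul _)
  have hNinv : ∀ k γ g, N k (intSL n γ * g) = N k g := fun k δ g => by
    simp only [N, ← mul_assoc, ← map_mul]
    exact (Equiv.mulRight δ).tsum_eq fun γ => (slBox n k).indicator 1 (intSL n γ * g)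
  have hNtop : ∀ k g, N k g ≠ ∞ := fun k g => by
    have hf := finite_intSL_mul_mem_slBox k g
    simp only [N]
    rw [tsum_eq_sum (s := hf.toFinset)]
    · refine (ENNReal.sum_lt_top.mpr fun γ _ => ?_).ne
      by_cases h : intSL n γ * g ∈ slBox n k <;> simp [h]
    · intro γ hγ
      simp only [Set.Finite.mem_toFinset, Set.mem_ofPred_eq] at hγ
      simp [hγ]
  let w0 : SLR n → ℝ≥0∞ := fun g =>
    ∑' k : ℕ, (2⁻¹ : ℝ≥0∞) ^ k * (1 + N k g)⁻¹ * (slBox n k).indicator 1 g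
  have hw0m : Measurable w0 := Measurable.tsum fun k =>
    (((hNm k).const_add 1).inv.const_mul _).mul
      (measurable_one.indicator (measurableSet_slBox n k))
  let P : SLR n → ℝ≥0∞ := fun g => ∑' γ, w0 (intSL n γ * g)
  have hPm : Measurable P := Measurable.tsum fun γ => hw0m.comp (measurable_const_mul _)
  have hPinv : ∀ γ g, P (intSL n γ * g) = P g := fun δ g => by
    simp only [P, ← mul_assoc, ← map_mul]
    exact (Equiv.mulRight δ).tsum_eq fun γ => w0 (intSL n γ * g)
  have hP : ∀ g, P g ≤ 2 := fun g => by
    simp only [P, w0, hNinv]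
    rw [ENNReal.tsum_comm]
    simp only [ENNReal.tsum_mul_left]
    calc ∑' k, (2⁻¹ : ℝ≥0∞) ^ k * (1 + N k g)⁻¹ * ∑' γ, (slBox n k).indicator 1 (intSL n γ * g)
        ≤ ∑' k, (2⁻¹ : ℝ≥0∞) ^ k := ENNReal.tsum_le_tsum fun k => by
          rw [mul_assoc]
          refine mul_le_of_le_one_right' ?_
          change (1 + N k g)⁻¹ * N k g ≤ 1
          rw [mul_comm, ← div_eq_mul_inv]
          exact ENNReal.div_le_of_le_mul (by rw [one_mul]; exact le_add_self)
      _ = 2 := ENNReal.tsum_geometric_two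
  have hw0 : ∀ g, w0 g ≠ 0 := fun g => by
    obtain ⟨k, hk⟩ := exists_nat_ge (∑ i, ∑ j, |(g : Matrix (Fin n) (Fin n) ℝ) i j|)
    have hg : g ∈ slBox n k := fun i j => by
      refine le_trans ?_ hk
      refine le_trans ?_ (Finset.single_le_sum
        (f := fun i => ∑ j, |(g : Matrix (Fin n) (Fin n) ℝ) i j|)
        (fun _ _ => by positivity) (Finset.mem_univ i))
      exact Finset.single_le_sum (f := fun j => |(g : Matrix (Fin n) (Fin n) ℝ) i j|)
        (fun _ _ => by positivity) (Finset.mem_univ j)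
    have hle : (2⁻¹ : ℝ≥0∞) ^ k * (1 + N k g)⁻¹ * (slBox n k).indicator 1 g ≤ w0 g :=
      ENNReal.le_tsum k
    intro h0
    rw [h0, nonpos_iff_eq_zero] at hle
    have := hNtop k g
    simp [hg, this] at hle
  have hw0P : ∀ g, w0 g ≤ P g := fun g => by
    have := ENNReal.le_tsum (f := fun γ => w0 (intSL n γ * g)) 1
    simpa [P] using this
  have hP0 : ∀ g, P g ≠ 0 := fun g h => hw0 g (by simpa [h] using hw0P g)
  have hPtop : ∀ g, P g ≠ ∞ := fun g => ne_top_of_le_ne_top (by simp) (hP g)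
  refine ⟨fun g => w0 g / P g, hw0m.div hPm, fun g => ?_, fun g => ?_, fun g => ?_⟩
  · exact ENNReal.div_ne_zero.mpr ⟨hw0 g, hPtop g⟩
  · exact ENNReal.div_ne_top (ne_top_of_le_ne_top (hPtop g) (hw0P g)) (hP0 g)
  · simp only [hPinv, div_eq_mul_inv, ENNReal.tsum_mul_right]
    exact ENNReal.mul_inv_cancel (hP0 g) (hPtop g)

lemma lintegral_latLift_weight {n : ℕ} {w : SLR n → ℝ≥0∞} (hwm : Measurable w)
    (hw : ∀ g, ∑' γ, w (intSL n γ * g) = 1) (μ : Measure (LatSpace n))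
    {F : LatSpace n → ℝ≥0∞} (hF : Measurable F) :
    ∫⁻ g, w g * F (latMk n g) ∂(latLift μ) = ∫⁻ x, F x ∂μ := by
  refine lintegral_latLift μ (hwm.mul (hF.comp (measurable_latMk n))) fun g => ?_
  change F (latMk n g) = ∑' γ, w (intSL n γ * g) * F (latMk n (intSL n γ * g))
  simp only [latMk_intSL_mul, ENNReal.tsum_mul_right, hw, one_mul]

lemma sigmaFinite_latLift {n : ℕ} (μ : Measure (LatSpace n)) [IsProbabilityMeasure μ] :
    SigmaFinite (latLift μ) := by
  obtain ⟨w, hwm, hw0, hwt, hw⟩ := exists_orbit_weight n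
  have h1 : ∫⁻ g, w g ∂(latLift μ) = 1 := by
    simpa using lintegral_latLift_weight hwm hw μ (F := fun _ => 1) measurable_const
  have : IsFiniteMeasure ((latLift μ).withDensity w) :=
    isFiniteMeasure_withDensity (by simp [h1])
  rw [← withDensity_inv_same hwm (ae_of_all _ hw0) (ae_of_all _ hwt) (μ := latLift μ)]
  exact SigmaFinite.withDensity_of_ne_top (ae_of_all _ fun g => by simp [hw0])

/-- Uniqueness of the invariant probability measure on the space of lattices. -/
lemma latSpace_measure_unique {n : ℕ} {μ ν : Measure (LatSpace n)} [IsProbabilityMeasure μ]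
    [IsProbabilityMeasure ν] (hμ : ∀ a : SLR n, μ.map (rTranslate n a) = μ)
    (hν : ∀ a : SLR n, ν.map (rTranslate n a) = ν) : μ = ν := by
  obtain ⟨w, hwm, hw0, hwt, hw⟩ := exists_orbit_weight n
  have := sigmaFinite_latLift μ
  have := sigmaFinite_latLift ν
  have : (latLift μ).IsMulRightInvariant := ⟨latLift_map_mul_right hμ⟩
  have : (latLift ν).IsMulRightInvariant := ⟨latLift_map_mul_right hν⟩
  have : SigmaFinite (latLift μ).inv := (MeasurableEquiv.inv (SLR n)).sigmaFinite_map
  have : SigmaFinite (latLift ν).inv := (MeasurableEquiv.inv (SLR n)).sigmaFinite_map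
  have hne : (latLift ν).inv ≠ 0 := by
    intro h
    have h0 : latLift ν = 0 := by
      rw [← Measure.inv_inv (latLift ν), h]; simp [Measure.inv]
    have := lintegral_latLift_weight hwm hw ν (F := fun _ => 1) measurable_const
    simp [h0] at this
  obtain ⟨s, hs0, hst⟩ : ∃ s, (latLift ν).inv s ≠ 0 ∧ (latLift ν).inv s ≠ ∞ := by
    obtain ⟨k, hk⟩ := exists_measure_pos_of_not_measure_iUnion_null
      (μ := (latLift ν).inv) (s := spanningSets (latLift ν).inv)
      (by rw [iUnion_spanningSets]; exact fun h => hne (Measure.measure_univ_eq_zero.mp h))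
    exact ⟨_, hk.ne', (measure_spanningSets_lt_top _ k).ne⟩
  have heq := measure_eq_div_smul (latLift μ).inv (latLift ν).inv hs0 hst
  set c := (latLift μ).inv s / (latLift ν).inv s
  have heq' : latLift μ = c • latLift ν := by
    rw [← Measure.inv_inv (latLift μ), heq, Measure.inv, Measure.map_smul]
    congr 1
    exact Measure.inv_inv _
  have key : ∀ F : LatSpace n → ℝ≥0∞, Measurable F → ∫⁻ x, F x ∂μ = c * ∫⁻ x, F x ∂ν := by
    intro F hF
    rw [← lintegral_latLift_weight hwm hw μ hF, ← lintegral_latLift_weight hwm hw ν hF, heq',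
      lintegral_smul_measure, smul_eq_mul]
  have hc : c = 1 := by simpa using (key (fun _ => 1) measurable_const).symm
  refine Measure.ext_of_lintegral _ fun F hF => ?_
  rw [key F hF, hc, one_mul]

/-- `M` is an integer matrix of determinant `p` whose row lattice is `{v | v ⬝ a ≡ 0 mod p}`. -/
structure IsHecke {n : ℕ} (p : ℕ) (a : Fin n → ZMod p) (M : Matrix (Fin n) (Fin n) ℤ) :
    Prop where
  det_eq : M.det = p
  row_dot : ∀ i, ∑ j, (M i j : ZMod p) * a j = 0
  exists_row : ∀ v : Fin n → ℤ, ∑ j, (v j : ZMod p) * a j = 0 → ∃ w, w ᵥ* M = v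

lemma exists_isHecke {n : ℕ} (p : ℕ) [Fact p.Prime] {a : Fin n → ZMod p} (ha : a ≠ 0) :
    ∃ M, IsHecke p a M := by
  obtain ⟨i, hi⟩ := Function.ne_iff.mp ha
  simp only [Pi.zero_apply] at hi
  let c : Fin n → ℤ := fun j => if j = i then p else -((a j * (a i)⁻¹).val : ℤ)
  have hc : ∀ j, (c j : ZMod p) = if j = i then 0 else -(a j * (a i)⁻¹) := fun j => by
    simp only [c]; split_ifs <;> simp
  have hM : ∀ j k, ((1 : Matrix (Fin n) (Fin n) ℤ).updateCol i c) j k =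
      if k = i then c j else if j = k then 1 else 0 := fun j k => by
    rw [Matrix.updateCol_apply, Matrix.one_apply]
  refine ⟨(1 : Matrix (Fin n) (Fin n) ℤ).updateCol i c, ?_, fun j => ?_, fun v hv => ?_⟩
  · rw [← Matrix.cramer_apply, Matrix.cramer_one]
    simp [c]
  · rw [← Finset.add_sum_erase _ _ (Finset.mem_univ i)]
    have : ∀ k ∈ Finset.univ.erase i,
        ((((1 : Matrix (Fin n) (Fin n) ℤ).updateCol i c) j k : ℤ) : ZMod p) * a k =
          if j = k then a j else 0 := fun k hk => by
      rw [hM, if_neg (Finset.ne_of_mem_erase hk)]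
      split_ifs with h <;> simp [h]
    rw [Finset.sum_congr rfl this, hM, if_pos rfl, hc, Finset.sum_ite_eq]
    by_cases h : j = i
    · simp [h]
    · simp [h, mul_assoc, inv_mul_cancel₀ hi]
  · have hdvd : (p : ℤ) ∣ v i - ∑ j ∈ Finset.univ.erase i, v j * c j := by
      rw [← ZMod.intCast_zmod_eq_zero_iff_dvd]
      push_cast
      have h1 : ∀ j ∈ Finset.univ.erase i, (v j : ZMod p) * (c j : ZMod p) =
          -((v j : ZMod p) * a j) * (a i)⁻¹ := fun j hj => by
        rw [hc, if_neg (Finset.ne_of_mem_erase hj)]; ring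
      rw [Finset.sum_congr rfl h1, ← Finset.sum_mul, Finset.sum_neg_distrib]
      rw [← Finset.add_sum_erase _ _ (Finset.mem_univ i)] at hv
      rw [← eq_neg_of_add_eq_zero_left hv, mul_assoc, mul_inv_cancel₀ hi]
      simp
    obtain ⟨q, hq⟩ := hdvd
    refine ⟨Function.update v i q, funext fun k => ?_⟩
    rw [Matrix.vecMul, dotProduct]
    by_cases hk : k = i
    · subst hk
      rw [← Finset.add_sum_erase _ _ (Finset.mem_univ k)]
      have h1 : ∀ j ∈ Finset.univ.erase k, Function.update v k q j *
          ((1 : Matrix (Fin n) (Fin n) ℤ).updateCol k c) j k = v j * c j := fun j hj => by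
        rw [hM, if_pos rfl, Function.update_of_ne (Finset.ne_of_mem_erase hj)]
      rw [Finset.sum_congr rfl h1, hM, if_pos rfl, Function.update_self]
      simp only [c, if_true] at hq ⊢
      linarith
    · simp only [hM, if_neg hk]
      rw [Finset.sum_eq_single k] <;> simp +contextual [hk]

lemma IsHecke.exists_intSL {n : ℕ} {p : ℕ} [Fact p.Prime] {a : Fin n → ZMod p}
    {M M' : Matrix (Fin n) (Fin n) ℤ} (h : IsHecke p a M) (h' : IsHecke p a M') :
    ∃ γ : Matrix.SpecialLinearGroup (Fin n) ℤ, M' = γ * M := by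
  choose W hW using fun i => h.exists_row (M' i) (h'.row_dot i)
  have hWM : Matrix.of W * M = M' := by
    ext i j
    rw [Matrix.mul_apply_eq_vecMul]
    exact congrFun (hW i) j
  have hp : (p : ℤ) ≠ 0 := by exact_mod_cast (Fact.out : p.Prime).ne_zero
  refine ⟨⟨Matrix.of W, ?_⟩, hWM.symm⟩
  have := congrArg Matrix.det hWM
  rw [Matrix.det_mul, h.det_eq, h'.det_eq] at this
  exact mul_right_cancel₀ hp (by rw [this, one_mul])

lemma IsHecke.mul_intSL {n : ℕ} {p : ℕ} {a : Fin n → ZMod p}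
    {M : Matrix (Fin n) (Fin n) ℤ} (h : IsHecke p a M)
    (γ : Matrix.SpecialLinearGroup (Fin n) ℤ) :
    IsHecke p (((γ⁻¹).1.map (Int.castRingHom (ZMod p))) *ᵥ a) (M * γ) := by
  have key : ∀ v : Fin n → ℤ,
      ∑ j, (v j : ZMod p) * (((γ⁻¹).1.map (Int.castRingHom (ZMod p))) *ᵥ a) j =
      ∑ j, ((v ᵥ* (γ⁻¹).1) j : ZMod p) * a j := fun v => by
    simp only [Matrix.mulVec, Matrix.vecMul, dotProduct, Finset.mul_sum, Int.cast_sum,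
      Finset.sum_mul, Matrix.map_apply]
    rw [Finset.sum_comm]
    simp [mul_assoc]
  have hγ : γ.1 * (γ⁻¹).1 = 1 := by
    rw [← Matrix.SpecialLinearGroup.coe_mul]; simp
  have hγ' : (γ⁻¹).1 * γ.1 = 1 := by
    rw [← Matrix.SpecialLinearGroup.coe_mul]; simp
  refine ⟨by rw [Matrix.det_mul, h.det_eq, γ.2, mul_one], fun i => ?_, fun v hv => ?_⟩
  · have hi : ((M * γ.1) i) ᵥ* (γ⁻¹).1 = M i := by
      change (M i ᵥ* γ.1) ᵥ* (γ⁻¹).1 = M i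
      rw [Matrix.vecMul_vecMul, hγ, Matrix.vecMul_one]
    rw [key, hi]
    exact h.row_dot i
  · rw [key] at hv
    obtain ⟨w, hw⟩ := h.exists_row _ hv
    refine ⟨w, ?_⟩
    rw [← Matrix.vecMul_vecMul, hw, Matrix.vecMul_vecMul, hγ', Matrix.vecMul_one]

lemma det_smul_isHecke {n : ℕ} (hn : n ≠ 0) {p : ℕ} [Fact p.Prime] {a : Fin n → ZMod p}
    {M : Matrix (Fin n) (Fin n) ℤ} (h : IsHecke p a M) :
    (((p : ℝ) ^ (-(1 / n : ℝ))) • M.map (Int.castRingHom ℝ)).det = 1 := by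
  have hp : (0 : ℝ) < p := by exact_mod_cast (Fact.out : p.Prime).pos
  rw [Matrix.det_smul, ← RingHom.mapMatrix_apply, ← RingHom.map_det, h.det_eq, Fintype.card_fin,
    ← Real.rpow_natCast, ← Real.rpow_mul hp.le]
  have : -(1 / n : ℝ) * n = -1 := by field_simp
  rw [this, Real.rpow_neg_one]
  simp [hp.ne']

/-- A chosen integer matrix with row lattice `{v | v ⬝ a ≡ 0 mod p}`. -/
noncomputable def heckeInt {n : ℕ} (p : ℕ) [Fact p.Prime]
    (a : {a : Fin n → ZMod p // a ≠ 0}) : Matrix (Fin n) (Fin n) ℤ :=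
  (exists_isHecke p a.2).choose

lemma isHecke_heckeInt {n : ℕ} (p : ℕ) [Fact p.Prime] (a : {a : Fin n → ZMod p // a ≠ 0}) :
    IsHecke p a.1 (heckeInt p a) := (exists_isHecke p a.2).choose_spec

/-- The normalized Hecke matrix in `SL_n(ℝ)`. -/
noncomputable def heckeMat {n : ℕ} [NeZero n] (p : ℕ) [Fact p.Prime]
    (a : {a : Fin n → ZMod p // a ≠ 0}) : SLR n :=
  ⟨((p : ℝ) ^ (-(1 / n : ℝ))) • (heckeInt p a).map (Int.castRingHom ℝ),
    det_smul_isHecke (NeZero.ne n) (isHecke_heckeInt p a)⟩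

/-- The action of `SL_n(ℤ)` on nonzero vectors mod `p`. -/
noncomputable def nonzeroEquiv {n : ℕ} (p : ℕ) (γ : Matrix.SpecialLinearGroup (Fin n) ℤ) :
    {a : Fin n → ZMod p // a ≠ 0} ≃ {a : Fin n → ZMod p // a ≠ 0} :=
  have key : ∀ (γ : Matrix.SpecialLinearGroup (Fin n) ℤ) (a : Fin n → ZMod p),
      (γ.1.map (Int.castRingHom (ZMod p))) *ᵥ ((γ⁻¹).1.map (Int.castRingHom (ZMod p)) *ᵥ a) = a :=
    fun γ a => by
      rw [Matrix.mulVec_mulVec, ← Matrix.map_mul, ← Matrix.SpecialLinearGroup.coe_mul]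
      simp
  have key' : ∀ (γ : Matrix.SpecialLinearGroup (Fin n) ℤ) (a : Fin n → ZMod p), a ≠ 0 →
      (γ.1.map (Int.castRingHom (ZMod p))) *ᵥ a ≠ 0 := fun γ a ha h0 => by
    have := key γ⁻¹ a
    rw [inv_inv, h0, Matrix.mulVec_zero] at this
    exact ha this.symm
  { toFun := fun a => ⟨(γ⁻¹).1.map (Int.castRingHom (ZMod p)) *ᵥ a.1, key' γ⁻¹ _ a.2⟩
    invFun := fun a => ⟨γ.1.map (Int.castRingHom (ZMod p)) *ᵥ a.1, key' γ _ a.2⟩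
    left_inv := fun a => Subtype.ext (key γ a.1)
    right_inv := fun a => Subtype.ext (by simpa using key γ⁻¹ a.1) }

lemma latMk_heckeMat_mul {n : ℕ} [NeZero n] (p : ℕ) [Fact p.Prime]
    (γ : Matrix.SpecialLinearGroup (Fin n) ℤ) (a : {a : Fin n → ZMod p // a ≠ 0}) (g : SLR n) :
    latMk n (heckeMat p a * (intSL n γ * g)) = latMk n (heckeMat p (nonzeroEquiv p γ a) * g) := by
  obtain ⟨δ, hδ⟩ := (isHecke_heckeInt p (nonzeroEquiv p γ a)).exists_intSL
    ((isHecke_heckeInt p a).mul_intSL γ)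
  have : heckeMat p a * intSL n γ = intSL n δ * heckeMat p (nonzeroEquiv p γ a) := by
    apply Subtype.ext
    change (_ • (heckeInt p a).map (Int.castRingHom ℝ)) * γ.1.map (Int.castRingHom ℝ) =
      δ.1.map (Int.castRingHom ℝ) *
        (_ • (heckeInt p (nonzeroEquiv p γ a)).map (Int.castRingHom ℝ))
    rw [Matrix.smul_mul, Matrix.mul_smul, ← Matrix.map_mul, ← Matrix.map_mul, hδ]
  rw [← mul_assoc, this, mul_assoc, latMk_intSL_mul]

/-- The invariant measure on the space of lattices is invariant under Hecke averaging. -/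
lemma lintegral_hecke {n : ℕ} [NeZero n] (p : ℕ) [Fact p.Prime] {μ : Measure (LatSpace n)}
    [IsProbabilityMeasure μ] (hμ : ∀ a : SLR n, μ.map (rTranslate n a) = μ)
    {F : LatSpace n → ℝ≥0∞} (hF : Measurable F) :
    ∃ T : LatSpace n → ℝ≥0∞, Measurable T ∧
      (∀ g, T (latMk n g) = ((p : ℝ≥0∞) ^ n - 1)⁻¹ *
        ∑ a : {a : Fin n → ZMod p // a ≠ 0}, F (latMk n (heckeMat p a * g))) ∧
      ∫⁻ x, T x ∂μ = ∫⁻ x, F x ∂μ := by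
  let c : ℝ≥0∞ := ((p : ℝ≥0∞) ^ n - 1)⁻¹
  let K : SLR n → Measure (LatSpace n) := fun g =>
    c • Measure.sum fun a : {a : Fin n → ZMod p // a ≠ 0} =>
      Measure.dirac (latMk n (heckeMat p a * g))
  have hTm : ∀ a : {a : Fin n → ZMod p // a ≠ 0},
      Measurable fun g => latMk n (heckeMat p a * g) :=
    fun a => (measurable_latMk n).comp (measurable_const_mul _)
  have hKm : Measurable K := by
    refine Measure.measurable_of_measurable_coe _ fun s hs => ?_
    simp only [K, Measure.smul_apply, smul_eq_mul]
    exact ((Measure.measurable_coe hs).comp (measurable_sum_dirac hTm)).const_mul c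
  have hK : ∀ γ g, K (intSL n γ * g) = K g := fun γ g => by
    simp only [K, latMk_heckeMat_mul]
    congr 1
    ext s hs
    simp only [Measure.sum_apply _ hs]
    exact (nonzeroEquiv p γ).tsum_eq fun a => Measure.dirac (latMk n (heckeMat p a * g)) s
  have hKl : ∀ u : LatSpace n → ℝ≥0∞, Measurable u → ∀ g, ∫⁻ y, u y ∂(K g) =
      c * ∑ a : {a : Fin n → ZMod p // a ≠ 0}, u (latMk n (heckeMat p a * g)) := fun u hu g => by
    simp only [K, lintegral_smul_measure, lintegral_sum_measure, lintegral_dirac' _ hu,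
      smul_eq_mul, tsum_fintype]
  let T : (LatSpace n → ℝ≥0∞) → LatSpace n → ℝ≥0∞ := fun u =>
    latDescend fun g => ∫⁻ y, u y ∂(K g)
  have hT : ∀ u : LatSpace n → ℝ≥0∞, ∀ g, T u (latMk n g) = ∫⁻ y, u y ∂(K g) :=
    fun u => latDescend_latMk fun γ g => by rw [hK]
  have hTmeas : ∀ u : LatSpace n → ℝ≥0∞, Measurable u → Measurable (T u) := fun u hu =>
    measurable_latDescend (fun γ g => by rw [hK]) ((Measure.measurable_lintegral hu).comp hKm)
  have hbind : ∀ u : LatSpace n → ℝ≥0∞, Measurable u →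
      ∫⁻ y, u y ∂(latBind μ K) = ∫⁻ x, T u x ∂μ := fun u hu =>
    lintegral_latBind μ hK hKm hu (hT u)
  have hcard : Fintype.card {a : Fin n → ZMod p // a ≠ 0} = p ^ n - 1 := by
    rw [Fintype.card_subtype_compl, Fintype.card_subtype_eq]; simp [ZMod.card]
  have hone : c * ∑ a : {a : Fin n → ZMod p // a ≠ 0}, (1 : ℝ≥0∞) = 1 := by
    rw [Finset.sum_const, Finset.card_univ, hcard, nsmul_eq_mul, mul_one]
    have h1 : 1 < p ^ n := Nat.one_lt_pow (NeZero.ne n) (Fact.out : p.Prime).one_lt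
    have h2 : ((p ^ n - 1 : ℕ) : ℝ≥0∞) = (p : ℝ≥0∞) ^ n - 1 := by push_cast; rfl
    rw [show c = ((p ^ n - 1 : ℕ) : ℝ≥0∞)⁻¹ by rw [h2]]
    refine ENNReal.inv_mul_cancel ?_ (ENNReal.natCast_ne_top _)
    exact_mod_cast (Nat.sub_pos_of_lt h1).ne'
  have hprob : IsProbabilityMeasure (latBind μ K) := ⟨by
    rw [← lintegral_one]
    refine (hbind 1 measurable_one).trans ?_
    have : T 1 = 1 := funext fun x => by
      obtain ⟨g, rfl⟩ := latMk_surjective n x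
      rw [hT, hKl _ measurable_one]
      exact hone
    simp [this]⟩
  have hinv : ∀ b : SLR n, (latBind μ K).map (rTranslate n b) = latBind μ K := fun b => by
    refine Measure.ext_of_lintegral _ fun u hu => ?_
    rw [lintegral_map hu (measurable_rTranslate b), hbind _ hu]
    refine (hbind _ (hu.comp (measurable_rTranslate b))).trans ?_
    conv_rhs => rw [← hμ b]
    rw [lintegral_map (hTmeas u hu) (measurable_rTranslate b)]
    refine lintegral_congr fun x => ?_
    obtain ⟨g, rfl⟩ := latMk_surjective n x
    rw [rTranslate_latMk, hT, hT, hKl _ hu, hKl _ (hu.comp (measurable_rTranslate b))]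
    simp only [Function.comp, rTranslate_latMk, mul_assoc]
  refine ⟨T F, hTmeas F hF, fun g => by rw [hT, hKl F hF], ?_⟩
  rw [← hbind F hF, latSpace_measure_unique hinv hμ]

lemma exists_submatrix_det_ne_zero {K : Type*} [Field K] {m n : ℕ}
    {X : Matrix (Fin m) (Fin n) K} (hX : LinearIndependent K X.row) :
    ∃ e : Fin m → Fin n, (X.submatrix id e).det ≠ 0 := by
  have hr : Module.finrank K (Submodule.span K (Set.range X.col)) = m := by
    rw [← X.rank_eq_finrank_span_cols, hX.rank_matrix, Fintype.card_fin]
  have hex := Submodule.exists_fun_fin_finrank_span_eq K (Set.range X.col)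
  rw [hr] at hex
  obtain ⟨f, hf, -, hli⟩ := hex
  choose e he using hf
  refine ⟨e, ?_⟩
  have hcol : LinearIndependent K (X.submatrix id e).col := by
    have h : (X.submatrix id e).col = f := funext fun i => he i
    rw [h]; exact hli
  have := (Matrix.linearIndependent_cols_iff_isUnit).mp hcol
  exact ((Matrix.isUnit_iff_isUnit_det _).mp this).ne_zero

lemma linearIndependent_of_submatrix_det_ne_zero {K : Type*} [Field K] {m n : ℕ}
    {X : Matrix (Fin m) (Fin n) K} {e : Fin m → Fin n} (h : (X.submatrix id e).det ≠ 0) :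
    LinearIndependent K X.row := by
  have h1 : LinearIndependent K (X.submatrix id e).row :=
    Matrix.linearIndependent_rows_iff_isUnit.mpr
      ((Matrix.isUnit_iff_isUnit_det _).mpr (isUnit_iff_ne_zero.mpr h))
  exact LinearIndependent.of_comp (LinearMap.funLeft K K e) h1

lemma ae_linearIndependent {m n : ℕ} (hmn : m ≤ n) :
    ∀ᵐ x : Fin m → Fin n → ℝ, LinearIndependent ℝ x := by
  let e : Fin m → Fin n := Fin.castLE hmn
  let D : (Fin m → Fin n → ℝ) → Matrix (Fin m) (Fin m) ℝ := fun x => Matrix.of fun i j => x i (e j)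
  let s : Set (Fin m → Fin n → ℝ) := {x | (D x).det ≠ 0}
  have hcont : Continuous fun x => (D x).det := by
    refine Continuous.matrix_det ?_
    refine continuous_matrix fun i j => ?_
    exact (continuous_apply (e j)).comp (continuous_apply i)
  have hs : MeasurableSet s := (hcont.measurable (measurableSet_singleton 0)).compl
  let E : Fin m → Fin n → ℝ := fun i j => if j = e i then -1 else 0
  let L : ℝ →ₗ[ℝ] (Fin m → Fin n → ℝ) := LinearMap.toSpanSingleton ℝ _ E
  have key : ∀ᵐ x : Fin m → Fin n → ℝ, x ∈ s := by
    refine ae_mem_of_ae_add_linearMap_mem L volume volume hs fun y => ?_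
    have hpoly : {t : ℝ | y + L t ∉ s} ⊆ ((D y).charpoly.roots.toFinset : Set ℝ) := by
      intro t ht
      simp only [s, Set.mem_ofPred_eq, not_not] at ht
      have hD : D (y + L t) = -(Matrix.scalar (Fin m) t - D y) := by
        ext i j
        have : (e j = e i) = (i = j) := by
          rw [(Fin.castLE_injective hmn).eq_iff]; exact propext eq_comm
        by_cases hij : i = j <;> simp [D, L, E, this, hij]
        ring
      rw [hD, Matrix.det_neg, mul_eq_zero] at ht
      have ht' := ht.resolve_left (by simp)
      rw [← Matrix.eval_charpoly] at ht'
      simp [(Matrix.charpoly_monic (D y)).ne_zero, ht']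
    exact measure_mono_null hpoly ((Finset.finite_toSet _).measure_zero _)
  filter_upwards [key] with x hx
  exact linearIndependent_of_submatrix_det_ne_zero (X := Matrix.of x) (e := e) hx

lemma volume_preserving_curry (ι κ : Type*) [Fintype ι] [Fintype κ] :
    MeasurePreserving (MeasurableEquiv.curry ι κ ℝ) volume volume := by
  have h : MeasurePreserving (MeasurableEquiv.curry ι κ ℝ).symm volume volume := by
    refine ⟨(MeasurableEquiv.curry ι κ ℝ).symm.measurable, (Measure.pi_eq fun s hs => ?_).symm⟩
    rw [MeasurableEquiv.map_apply]
    have : (MeasurableEquiv.curry ι κ ℝ).symm ⁻¹' (Set.univ.pi s) =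
        Set.univ.pi fun i => Set.univ.pi fun k => s (i, k) := by
      ext x
      simp only [Set.mem_preimage, Set.mem_pi, Set.mem_univ, forall_const, Prod.forall]
      rfl
    rw [this, volume_pi_pi]
    simp only [volume_pi_pi, Fintype.prod_prod_type]
  exact h.symm

/-- Right multiplication of a tuple of row vectors by a matrix. -/
def rowMul {m n : ℕ} {R : Type*} [CommRing R] (x : Fin m → Fin n → R)
    (g : Matrix (Fin n) (Fin n) R) : Fin m → Fin n → R := fun i => x i ᵥ* g

lemma rowMul_mul {m n : ℕ} {R : Type*} [CommRing R] (x : Fin m → Fin n → R)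
    (g h : Matrix (Fin n) (Fin n) R) : rowMul x (g * h) = rowMul (rowMul x g) h :=
  funext fun i => (Matrix.vecMul_vecMul (x i) g h).symm

lemma rowMul_one {m n : ℕ} {R : Type*} [CommRing R] (x : Fin m → Fin n → R) :
    rowMul x 1 = x := funext fun _ => Matrix.vecMul_one _

lemma linearIndependent_rowMul {m n : ℕ} {R : Type*} [CommRing R] {x : Fin m → Fin n → R}
    {g : Matrix (Fin n) (Fin n) R} (hg : IsUnit g.det) :
    LinearIndependent R (rowMul x g) ↔ LinearIndependent R x := by
  have h : ∀ {x : Fin m → Fin n → R} {g : Matrix (Fin n) (Fin n) R},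
      LinearIndependent R (rowMul x g) → LinearIndependent R x := by
    intro x g h
    have h' : LinearIndependent R (Matrix.vecMulLinear g ∘ x) := h
    exact LinearIndependent.of_comp _ h'
  refine ⟨h, fun hx => h (g := g⁻¹) ?_⟩
  rwa [← rowMul_mul, Matrix.mul_nonsing_inv _ hg, rowMul_one]

lemma continuous_rowMul {m n : ℕ} (g : Matrix (Fin n) (Fin n) ℝ) :
    Continuous fun x : Fin m → Fin n → ℝ => rowMul x g :=
  continuous_pi fun i => Continuous.matrix_vecMul (continuous_apply i) continuous_const

lemma volume_preserving_rowMul {m n : ℕ} (g : SLR n) :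
    MeasurePreserving (fun x : Fin m → Fin n → ℝ => rowMul x g.1) volume volume := by
  refine volume_preserving_pi (f := fun _ (v : Fin n → ℝ) => v ᵥ* g.1) fun _ => ?_
  have hdet : (g.1ᵀ).det ≠ 0 := by rw [Matrix.det_transpose, g.2]; exact one_ne_zero
  have h := Real.map_matrix_volume_pi_eq_smul_volume_pi hdet
  rw [Matrix.det_transpose, g.2] at h
  have he : (fun v : Fin n → ℝ => v ᵥ* g.1) = toLin' g.1ᵀ := by
    funext v; simp [Matrix.mulVec_transpose]
  rw [he]
  exact ⟨(LinearMap.continuous_of_finiteDimensional _).measurable, by simpa using h⟩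

/-- The inclusion of integral tuples in real tuples. -/
def intTuple {m n : ℕ} (X : Fin m → Fin n → ℤ) : Fin m → Fin n → ℝ := fun i j => X i j

lemma intTuple_injective {m n : ℕ} : Function.Injective (intTuple (m := m) (n := n)) :=
  fun X Y h => funext fun i => funext fun j => by
    have := congrFun (congrFun h i) j
    simp only [intTuple] at this
    exact_mod_cast this

lemma intTuple_rowMul {m n : ℕ} (X : Fin m → Fin n → ℤ) (M : Matrix (Fin n) (Fin n) ℤ) :
    intTuple (rowMul X M) = rowMul (intTuple X) (M.map (Int.castRingHom ℝ)) := by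
  funext i j
  simp [intTuple, rowMul, Matrix.vecMul, dotProduct]

/-- Integral linearly independent tuples. -/
abbrev IndepTuple (m n : ℕ) := {X : Fin m → Fin n → ℤ // LinearIndependent ℝ (intTuple X)}

/-- An open box in tuple space. -/
def tupleBox {m n : ℕ} (a b : Fin m → Fin n → ℝ) : Set (Fin m → Fin n → ℝ) :=
  Set.univ.pi fun i => Set.univ.pi fun j => Set.Ioo (-a i j) (b i j)

lemma measurableSet_tupleBox {m n : ℕ} (a b : Fin m → Fin n → ℝ) :
    MeasurableSet (tupleBox a b) :=
  MeasurableSet.univ_pi fun _ => MeasurableSet.univ_pi fun _ => measurableSet_Ioo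

lemma convex_tupleBox {m n : ℕ} (a b : Fin m → Fin n → ℝ) : Convex ℝ (tupleBox a b) :=
  convex_pi fun _ _ => convex_pi fun _ _ => convex_Ioo _ _

lemma tupleBox_subset_Icc {m n : ℕ} (a b : Fin m → Fin n → ℝ) :
    tupleBox a b ⊆ Set.Icc (-a) b := fun _ hy =>
  ⟨fun i j => (hy i trivial j trivial).1.le, fun i j => (hy i trivial j trivial).2.le⟩

lemma volume_tupleBox {m n : ℕ} (a b : Fin m → Fin n → ℝ) :
    volume (tupleBox a b) = ∏ i, ∏ j, ENNReal.ofReal (b i j + a i j) := by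
  simp [tupleBox, volume_pi_pi, Real.volume_Ioo]

lemma rowMul_smul {m n : ℕ} {R : Type*} [CommRing R] (c : R) (x : Fin m → Fin n → R)
    (g : Matrix (Fin n) (Fin n) R) : rowMul (c • x) g = c • rowMul x g := by
  funext i j
  simp [rowMul, Matrix.vecMul, dotProduct, Finset.mul_sum, mul_assoc]

lemma exists_entry_bound {m n : ℕ} (a b : Fin m → Fin n → ℝ) (g : SLR n) :
    ∃ C : ℝ, 0 ≤ C ∧ ∀ (c : ℝ) (x : Fin m → Fin n → ℝ), 0 < c →
      c⁻¹ • rowMul x g.1 ∈ tupleBox a b → ∀ i j, |x i j| ≤ C * c := by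
  obtain ⟨C, hC⟩ := ((isCompact_Icc (a := -a) (b := b)).image
    (continuous_rowMul (g⁻¹).1)).isBounded.exists_norm_le
  refine ⟨max C 0, le_max_right _ _, fun c x hc hx i j => ?_⟩
  have h1 := hC _ ⟨_, tupleBox_subset_Icc a b hx, rfl⟩
  have h2 : rowMul (c⁻¹ • rowMul x g.1) (g⁻¹).1 = c⁻¹ • x := by
    rw [rowMul_smul, ← rowMul_mul, ← Matrix.SpecialLinearGroup.coe_mul, mul_inv_cancel,
      Matrix.SpecialLinearGroup.coe_one, rowMul_one]
  simp only [h2] at h1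
  have h3 : |c⁻¹ * x i j| ≤ C :=
    ((norm_le_pi_norm ((c⁻¹ • x) i) j).trans (norm_le_pi_norm (c⁻¹ • x) i)).trans h1
  rw [abs_mul, abs_inv, abs_of_pos hc, inv_mul_le_iff₀ hc, mul_comm] at h3
  exact h3.trans (mul_le_mul_of_nonneg_right (le_max_left _ _) hc.le)

lemma finite_tuples_mem_box {m n : ℕ} (a b : Fin m → Fin n → ℝ) (g : SLR n) {c : ℝ}
    (hc : 0 < c) :
    {X : IndepTuple m n | c⁻¹ • rowMul (intTuple X.1) g.1 ∈ tupleBox a b}.Finite := by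
  obtain ⟨C, -, hC⟩ := exists_entry_bound a b g
  have hfin : (Set.univ.pi fun _ : Fin m => Set.univ.pi fun _ : Fin n =>
      Set.Icc (-⌈C * c⌉) ⌈C * c⌉).Finite :=
    Set.Finite.pi fun _ => Set.Finite.pi fun _ => Set.finite_Icc _ _
  refine Set.Finite.of_finite_image (f := Subtype.val) (hfin.subset ?_)
    Subtype.val_injective.injOn
  rintro _ ⟨X, hX, rfl⟩ i - j -
  have h := hC c _ hc hX i j
  have h3 : |X.1 i j| ≤ ⌈C * c⌉ := by
    simp only [intTuple] at h
    exact_mod_cast h.trans (Int.le_ceil _)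
  exact abs_le.mp h3

open Filter Topology in
lemma tendsto_card_tuples {m n : ℕ} (hmn : m ≤ n) {a b : Fin m → Fin n → ℝ}
    (ha : ∀ i j, 0 < a i j) (hb : ∀ i j, 0 < b i j) (g : SLR n) :
    Tendsto (fun c : ℝ => (Nat.card {X : IndepTuple m n |
        c⁻¹ • rowMul (intTuple X.1) g.1 ∈ tupleBox a b} : ℝ) / c ^ (m * n)) atTop
      (𝓝 (volume (tupleBox a b)).toReal) := by
  let e := MeasurableEquiv.curry (Fin m) (Fin n) ℝ
  have hec : Continuous e :=
    continuous_pi fun i => continuous_pi fun j => continuous_apply (i, j)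
  let W : Set (Fin m × Fin n → ℝ) := {x | rowMul (e x) g.1 ∈ tupleBox a b}
  let U : Set (Fin m × Fin n → ℝ) := {x | LinearIndependent ℝ (e x)}
  have hUo : IsOpen U := isOpen_setOfPred_linearIndependent.preimage hec
  have hUc : volume Uᶜ = 0 :=
    (volume_preserving_curry (Fin m) (Fin n)).quasiMeasurePreserving.ae
      (ae_linearIndependent hmn)
  have hWm : MeasurableSet W :=
    (measurableSet_tupleBox a b).preimage
      ((continuous_rowMul g.1).measurable.comp e.measurable)
  let ℓ : (Fin m × Fin n → ℝ) →ₗ[ℝ] (Fin m → Fin n → ℝ) :=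
    { toFun := fun x => rowMul (e x) g.1
      map_add' := fun x y => funext fun i => Matrix.add_vecMul _ _ _
      map_smul' := fun c x => rowMul_smul _ _ _ }
  have hWconv : Convex ℝ W := (convex_tupleBox a b).linear_preimage ℓ
  have hWbdd : Bornology.IsBounded W := by
    obtain ⟨C, hC0, hC⟩ := exists_entry_bound a b g
    refine (Metric.isBounded_closedBall (x := (0 : Fin m × Fin n → ℝ)) (r := C)).subset ?_
    intro x hx
    rw [mem_closedBall_zero_iff, pi_norm_le_iff_of_nonneg hC0]
    rintro ⟨i, j⟩
    have := hC 1 (e x) one_pos (by rw [inv_one, one_smul]; exact hx) i j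
    rwa [mul_one] at this
  have hvolW : volume W = volume (tupleBox a b) :=
    ((volume_preserving_rowMul g).comp (volume_preserving_curry (Fin m) (Fin n))).measure_preimage
      (measurableSet_tupleBox a b).nullMeasurableSet
  have hvol : volume (U ∩ W) = volume (tupleBox a b) := by
    rw [← hvolW]
    exact measure_congr ((inter_ae_eq_right_of_ae_eq_univ (ae_eq_univ.mpr hUc)))
  have hfront : volume (frontier (U ∩ W)) = 0 := by
    have hU : frontier U ⊆ Uᶜ := by
      rw [frontier, hUo.interior_eq]; exact fun x hx => hx.2
    refine measure_mono_null (frontier_inter_subset _ _) ?_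
    refine measure_union_null (measure_mono_null Set.inter_subset_left
      (measure_mono_null hU hUc)) (measure_mono_null Set.inter_subset_right ?_)
    exact hWconv.addHaar_frontier volume
  have h0W : (0 : Fin m × Fin n → ℝ) ∈ W := by
    change ℓ 0 ∈ tupleBox a b
    rw [map_zero]
    exact fun i _ j _ => ⟨by simpa using ha i j, hb i j⟩
  have hstar : ∀ ⦃x y : ℝ⦄, 0 < x → x ≤ y →
      (fun z => x • z) '' (U ∩ W) ⊆ (fun z => y • z) '' (U ∩ W) := by
    rintro x y hx hxy _ ⟨z, ⟨hzU, hzW⟩, rfl⟩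
    have hy : 0 < y := hx.trans_le hxy
    refine ⟨(x / y) • z, ⟨?_, ?_⟩, ?_⟩
    · have h1 : e ((x / y) • z) = fun i => (Units.mk0 (x / y) (by positivity)) • e z i := rfl
      change LinearIndependent ℝ (e ((x / y) • z))
      rw [h1]
      exact LinearIndependent.units_smul hzU _
    · exact hWconv.smul_mem_of_zero_mem h0W hzW ⟨by positivity, (div_le_one hy).mpr hxy⟩
    · change y • (x / y) • z = x • z
      rw [smul_smul, mul_div_cancel₀ _ hy.ne']
  have hmain := tendsto_card_div_pow_atTop_volume' (U ∩ W)
    (hWbdd.subset Set.inter_subset_right) (hUo.measurableSet.inter hWm) hfront hstar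
  rw [measureReal_def, hvol] at hmain
  simp only [Fintype.card_prod, Fintype.card_fin] at hmain
  refine hmain.congr' ?_
  filter_upwards [eventually_gt_atTop 0] with c hc
  congr 2
  have hspan : ∀ x : Fin m × Fin n → ℝ,
      x ∈ Submodule.span ℤ (Set.range (Pi.basisFun ℝ (Fin m × Fin n))) ↔
        ∃ X : Fin m → Fin n → ℤ, e x = intTuple X := fun x => by
    rw [Module.Basis.mem_span_iff_repr_mem]
    constructor
    · intro h
      choose X hX using h
      exact ⟨fun i j => X (i, j), funext fun i => funext fun j => (hX (i, j)).symm⟩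
    · rintro ⟨X, hX⟩ ⟨i, j⟩
      exact ⟨X i j, (congrFun (congrFun hX i) j).symm⟩
  have hLI : ∀ {c : ℝ} (hc : c ≠ 0) {x : Fin m → Fin n → ℝ}, LinearIndependent ℝ x →
      LinearIndependent ℝ (c • x) := fun {c} hc x hx =>
    LinearIndependent.units_smul hx fun _ => Units.mk0 c hc
  symm
  refine Nat.card_congr (Equiv.ofBijective
    (fun X => ⟨c⁻¹ • e.symm (intTuple X.1.1), ⟨?_, ?_⟩, ?_⟩) ⟨?_, ?_⟩)
  · exact hLI (inv_ne_zero hc.ne') X.1.2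
  · change ℓ (c⁻¹ • e.symm (intTuple X.1.1)) ∈ tupleBox a b
    rw [map_smul]
    exact X.2
  · refine ⟨e.symm (intTuple X.1.1), (hspan _).mpr ⟨X.1.1, e.apply_symm_apply _⟩, rfl⟩
  · intro X Y h
    have h1 := smul_right_injective _ (inv_ne_zero hc.ne') (congrArg Subtype.val h)
    exact Subtype.ext (Subtype.ext (intTuple_injective (e.symm.injective h1)))
  · rintro ⟨x, ⟨hxU, hxW⟩, y, hy, hyx⟩
    obtain ⟨X, hX⟩ := (hspan y).mp hy
    change c⁻¹ • y = x at hyx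
    have hy' : e.symm (intTuple X) = y := by rw [← hX]; exact e.symm_apply_apply y
    have hyc : e y = c • e x := by
      rw [← hyx]
      change e y = e (c • c⁻¹ • y)
      rw [smul_inv_smul₀ hc.ne']
    refine ⟨⟨⟨X, ?_⟩, ?_⟩, Subtype.ext ?_⟩
    · rw [← hX, hyc]
      exact hLI hc.ne' hxU
    · change c⁻¹ • rowMul (intTuple X) g.1 ∈ tupleBox a b
      rw [← hX, hyc, rowMul_smul, inv_smul_smul₀ hc.ne']
      exact hxW
    · change c⁻¹ • e.symm (intTuple X) = x
      rw [hy', hyx]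

lemma tsum_rowMul_heckeMat {m n : ℕ} [NeZero n] (p : ℕ) [Fact p.Prime]
    (a : {a : Fin n → ZMod p // a ≠ 0}) (g : SLR n) (u : (Fin m → Fin n → ℝ) → ℝ≥0∞) :
    ∑' X : IndepTuple m n, u (rowMul (intTuple X.1) (heckeMat p a * g).1) =
      ∑' X : IndepTuple m n, if ∀ i, ∑ j, (X.1 i j : ZMod p) * a.1 j = 0 then
        u (((p : ℝ) ^ (1 / n : ℝ))⁻¹ • rowMul (intTuple X.1) g.1) else 0 := by
  have hp : (0 : ℝ) < p := by exact_mod_cast (Fact.out : p.Prime).pos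
  have hM := isHecke_heckeInt p a
  set M := heckeInt p a
  have hdet : IsUnit (M.map (Int.castRingHom ℝ)).det := by
    rw [← RingHom.mapMatrix_apply, ← RingHom.map_det, hM.det_eq]
    simp [hp.ne']
  let T : IndepTuple m n → IndepTuple m n := fun X => ⟨rowMul X.1 M, by
    rw [intTuple_rowMul]; exact (linearIndependent_rowMul hdet).mpr X.2⟩
  have hT : Function.Injective T := fun X Y h => by
    have h1 : rowMul X.1 M = rowMul Y.1 M := congrArg Subtype.val h
    have h2 := congrArg (fun Z => rowMul (intTuple Z) (M.map (Int.castRingHom ℝ))⁻¹) h1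
    simp only [intTuple_rowMul, ← rowMul_mul, Matrix.mul_nonsing_inv _ hdet, rowMul_one] at h2
    exact Subtype.ext (intTuple_injective h2)
  let f : IndepTuple m n → ℝ≥0∞ := fun X =>
    if ∀ i, ∑ j, (X.1 i j : ZMod p) * a.1 j = 0 then
        u (((p : ℝ) ^ (1 / n : ℝ))⁻¹ • rowMul (intTuple X.1) g.1) else 0
  have hsupp : Function.support f ⊆ Set.range T := by
    intro X hX
    have hX' : ∀ i, ∑ j, (X.1 i j : ZMod p) * a.1 j = 0 := by
      by_contra h
      exact hX (if_neg h)
    choose W hW using fun i => hM.exists_row (X.1 i) (hX' i)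
    have hWX : rowMul W M = X.1 := funext hW
    refine ⟨⟨W, ?_⟩, Subtype.ext hWX⟩
    have := X.2
    rwa [← hWX, intTuple_rowMul, linearIndependent_rowMul hdet] at this
  refine Eq.trans ?_ (hT.tsum_eq hsupp)
  refine tsum_congr fun X => ?_
  have h0 : ∀ i, ∑ j, ((T X).1 i j : ZMod p) * a.1 j = 0 := fun i => by
    simp only [T, rowMul, Matrix.vecMul, dotProduct, Int.cast_sum, Int.cast_mul, Finset.sum_mul]
    rw [Finset.sum_comm]
    refine Finset.sum_eq_zero fun k _ => ?_
    simp only [mul_assoc, ← Finset.mul_sum, hM.row_dot, mul_zero]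
  simp only [if_pos h0]
  congr 1
  simp only [T, intTuple_rowMul]
  have hh : (heckeMat p a * g).1 =
      ((p : ℝ) ^ (1 / n : ℝ))⁻¹ • (M.map (Int.castRingHom ℝ) * g.1) := by
    change ((p : ℝ) ^ (-(1 / n : ℝ)) • M.map (Int.castRingHom ℝ)) * g.1 = _
    rw [Matrix.smul_mul, Real.rpow_neg hp.le]
  rw [hh, ← rowMul_mul]
  funext i
  exact Matrix.vecMul_smul _ _ _

lemma card_orthogonal {m n p : ℕ} [Fact p.Prime]
    {X : Matrix (Fin m) (Fin n) (ZMod p)} (hX : LinearIndependent (ZMod p) X.row) :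
    Nat.card {a : {a : Fin n → ZMod p // a ≠ 0} // ∀ i, ∑ j, X i j * a.1 j = 0} + 1 =
      p ^ (n - m) := by
  have hker : Nat.card (LinearMap.ker X.mulVecLin) = p ^ (n - m) := by
    have h1 := LinearMap.finrank_range_add_finrank_ker X.mulVecLin
    rw [Module.finrank_fintype_fun_eq_card, Fintype.card_fin] at h1
    have h2 : Module.finrank (ZMod p) (LinearMap.range X.mulVecLin) = m := by
      have := hX.rank_matrix
      rwa [Fintype.card_fin] at this
    rw [Module.natCard_eq_pow_finrank (K := ZMod p), Nat.card_eq_fintype_card, ZMod.card]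
    congr 1
    omega
  rw [← hker, ← Finite.card_option]
  refine Nat.card_congr (Equiv.ofBijective (fun o => match o with
    | none => 0
    | some a => ⟨a.1.1, LinearMap.mem_ker.mpr (funext a.2)⟩) ⟨?_, ?_⟩)
  · rintro (_ | a) (_ | b) h
    · rfl
    · exact absurd (congrArg Subtype.val h).symm b.1.2
    · exact absurd (congrArg Subtype.val h) a.1.2
    · exact congrArg some (Subtype.ext (Subtype.ext (by simpa using h)))
  · rintro ⟨a, ha⟩
    by_cases h : a = 0
    · exact ⟨none, Subtype.ext h.symm⟩
    · exact ⟨some ⟨⟨a, h⟩, fun i => congrFun (LinearMap.mem_ker.mp ha) i⟩, rfl⟩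

lemma linearIndependent_mod_prime {m n p : ℕ} [Fact p.Prime] {X : Fin m → Fin n → ℤ}
    (hX : LinearIndependent ℝ (intTuple X)) {B : ℝ} (hB : ∀ i j, |(X i j : ℝ)| ≤ B)
    (hp : m ! * B ^ m < p) :
    LinearIndependent (ZMod p)
      (Matrix.of fun i j => (X i j : ZMod p) : Matrix (Fin m) (Fin n) (ZMod p)).row := by
  obtain ⟨e, he⟩ := exists_submatrix_det_ne_zero (X := Matrix.of (intTuple X)) hX
  let D : Matrix (Fin m) (Fin m) ℤ := Matrix.of fun i j => X i (e j)
  have hD : ((D.det : ℤ) : ℝ) = ((Matrix.of (intTuple X)).submatrix id e).det := by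
    rw [← eq_intCast (Int.castRingHom ℝ), RingHom.map_det]; rfl
  have hDp : ((D.det : ℤ) : ZMod p) =
      ((Matrix.of fun i j => (X i j : ZMod p) : Matrix (Fin m) (Fin n) (ZMod p)).submatrix
        id e).det := by
    rw [← eq_intCast (Int.castRingHom (ZMod p)), RingHom.map_det]; rfl
  refine linearIndependent_of_submatrix_det_ne_zero (e := e) ?_
  rw [← hDp, Ne, ZMod.intCast_zmod_eq_zero_iff_dvd]
  intro hdvd
  have hle := Matrix.det_le (A := (Matrix.of (intTuple X)).submatrix id e)
    (abv := AbsoluteValue.abs) (x := B) fun i j => hB i (e j)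
  rw [← hD] at hle he
  simp only [Fintype.card_fin, nsmul_eq_mul, AbsoluteValue.abs_apply] at hle
  have h1 : |(D.det : ℝ)| < p := hle.trans_lt hp
  have h2 : |D.det| < p := by exact_mod_cast h1
  have h3 := Int.eq_zero_of_abs_lt_dvd hdvd h2
  exact he (by rw [h3]; simp)

/-- The number of independent integral tuples in the lattice landing in a box. -/
noncomputable def boxCount {m n : ℕ} (a b : Fin m → Fin n → ℝ) (g : SLR n) : ℝ≥0∞ :=
  ∑' X : IndepTuple m n, (tupleBox a b).indicator 1 (rowMul (intTuple X.1) g.1)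

lemma sum_boxCount_heckeMat {m n : ℕ} [NeZero n] (a b : Fin m → Fin n → ℝ)
    (g : SLR n) {C : ℝ}
    (hC : ∀ (c : ℝ) (x : Fin m → Fin n → ℝ), 0 < c →
      c⁻¹ • rowMul x g.1 ∈ tupleBox a b → ∀ i j, |x i j| ≤ C * c)
    (p : ℕ) [Fact p.Prime] (hp : m ! * (C * (p : ℝ) ^ (1 / n : ℝ)) ^ m < p) :
    ∑ v : {v : Fin n → ZMod p // v ≠ 0}, boxCount a b (heckeMat p v * g) =
      ((p ^ (n - m) - 1 : ℕ) : ℝ≥0∞) * (Nat.card {X : IndepTuple m n |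
        ((p : ℝ) ^ (1 / n : ℝ))⁻¹ • rowMul (intTuple X.1) g.1 ∈ tupleBox a b} : ℝ≥0∞) := by
  have hp0 : (0 : ℝ) < p := by exact_mod_cast (Fact.out : p.Prime).pos
  set c := (p : ℝ) ^ (1 / n : ℝ) with hc
  have hc0 : 0 < c := Real.rpow_pos_of_pos hp0 _
  have hfin := finite_tuples_mem_box a b g hc0
  set A := {X : IndepTuple m n | c⁻¹ • rowMul (intTuple X.1) g.1 ∈ tupleBox a b}
  have h1 : ∑ v : {v : Fin n → ZMod p // v ≠ 0}, boxCount a b (heckeMat p v * g) =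
      ∑' X : IndepTuple m n, A.indicator (fun _ => ((p ^ (n - m) - 1 : ℕ) : ℝ≥0∞)) X := by
    simp only [boxCount, tsum_rowMul_heckeMat, ← hc]
    rw [← tsum_fintype (L := .unconditional _), ENNReal.tsum_comm]
    refine tsum_congr fun X => ?_
    rw [tsum_fintype]
    by_cases hX : X ∈ A
    · have hX' : c⁻¹ • rowMul (intTuple X.1) g.1 ∈ tupleBox a b := hX
      have hli := linearIndependent_mod_prime X.2 (fun i j => hC c _ hc0 hX' i j) hp
      have hcard := card_orthogonal hli
      simp only [Set.indicator_of_mem hX', Set.indicator_of_mem hX, Pi.one_apply]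
      rw [Finset.sum_boole, ← hcard, Nat.add_sub_cancel, Nat.card_eq_fintype_card,
        Fintype.card_subtype]
      rfl
    · have hX' : c⁻¹ • rowMul (intTuple X.1) g.1 ∉ tupleBox a b := hX
      simp [Set.indicator_of_notMem hX', Set.indicator_of_notMem hX]
  rw [h1, ← tsum_subtype A fun _ => ((p ^ (n - m) - 1 : ℕ) : ℝ≥0∞)]
  have : Fintype A := hfin.fintype
  rw [tsum_fintype, Finset.sum_const, Finset.card_univ, Nat.card_eq_fintype_card, nsmul_eq_mul,
    mul_comm]

instance (k : ℕ) : Fact (Nat.nth Nat.Prime k).Prime := ⟨Nat.prime_nth_prime k⟩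

open Filter Topology in
lemma tendsto_hecke_boxCount {m n : ℕ} [NeZero n] (hmn : m < n) {a b : Fin m → Fin n → ℝ}
    (ha : ∀ i j, 0 < a i j) (hb : ∀ i j, 0 < b i j) (g : SLR n) :
    Tendsto (fun k : ℕ => ((Nat.nth Nat.Prime k : ℝ≥0∞) ^ n - 1)⁻¹ *
      ∑ v : {v : Fin n → ZMod (Nat.nth Nat.Prime k) // v ≠ 0},
        boxCount a b (heckeMat (Nat.nth Nat.Prime k) v * g)) atTop
      (𝓝 (volume (tupleBox a b))) := by
  have hq : Tendsto (Nat.nth Nat.Prime) atTop atTop :=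
    (Nat.nth_strictMono Nat.infinite_setOfPred_prime).tendsto_atTop
  have hqr : Tendsto (fun k => (Nat.nth Nat.Prime k : ℝ)) atTop atTop :=
    tendsto_natCast_atTop_atTop.comp hq
  have hn0 : (0 : ℝ) < n := by exact_mod_cast (NeZero.pos n)
  obtain ⟨C, hC0, hC⟩ := exists_entry_bound a b g
  let N : ℝ → ℕ := fun c => Nat.card {X : IndepTuple m n |
        c⁻¹ • rowMul (intTuple X.1) g.1 ∈ tupleBox a b}
  have hcount : Tendsto (fun x : ℝ => (N (x ^ (1 / n : ℝ)) : ℝ) / x ^ m) atTop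
      (𝓝 (volume (tupleBox a b)).toReal) := by
    refine ((tendsto_card_tuples hmn.le ha hb g).comp
      (tendsto_rpow_atTop (y := (1 / n : ℝ)) (by positivity))).congr' ?_
    filter_upwards [eventually_gt_atTop 0] with x hx
    simp only [Function.comp, N]
    congr 1
    rw [← Real.rpow_natCast, ← Real.rpow_mul hx.le, ← Real.rpow_natCast]
    congr 1
    push_cast
    field_simp
  have hratio : Tendsto (fun x : ℝ => (1 - x ^ m / x ^ n) / (1 - x ^ 0 / x ^ n)) atTop
      (𝓝 1) := by
    have h1 := tendsto_pow_div_pow_atTop_zero (𝕜 := ℝ) hmn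
    have h2 := tendsto_pow_div_pow_atTop_zero (𝕜 := ℝ) (NeZero.pos n)
    have h3 := (h1.const_sub 1).div (h2.const_sub 1) (by simp)
    rw [sub_zero, div_one] at h3
    exact h3
  have hlim := (ENNReal.tendsto_ofReal (hratio.mul hcount)).comp hqr
  have hvol : volume (tupleBox a b) ≠ ∞ := by
    rw [volume_tupleBox]
    exact ENNReal.prod_ne_top fun i _ => ENNReal.prod_ne_top fun j _ => ENNReal.ofReal_ne_top
  rw [one_mul, ENNReal.ofReal_toReal hvol] at hlim
  have hm : (0 : ℝ) < 1 - m / n := by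
    rw [sub_pos, div_lt_one hn0]; exact_mod_cast hmn
  suffices key : ∀ (p : ℕ) [Fact p.Prime], m ! * C ^ m < (p : ℝ) ^ (1 - m / n : ℝ) →
      ENNReal.ofReal ((1 - (p : ℝ) ^ m / (p : ℝ) ^ n) / (1 - (p : ℝ) ^ 0 / (p : ℝ) ^ n) *
        ((N ((p : ℝ) ^ (1 / n : ℝ)) : ℝ) / (p : ℝ) ^ m)) = ((p : ℝ≥0∞) ^ n - 1)⁻¹ *
      ∑ v : {v : Fin n → ZMod p // v ≠ 0}, boxCount a b (heckeMat p v * g) by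
    refine hlim.congr' ?_
    filter_upwards [hqr.eventually ((tendsto_rpow_atTop hm).eventually_gt_atTop (m ! * C ^ m))]
      with k hk using key _ hk
  intro p _ hk
  have hp1 : 1 < p := (Fact.out : p.Prime).one_lt
  have hp : (1 : ℝ) < p := by exact_mod_cast hp1
  have hp0 : (0 : ℝ) < p := one_pos.trans hp
  have hbig : m ! * (C * (p : ℝ) ^ (1 / n : ℝ)) ^ m < p := by
    rw [mul_pow, ← Real.rpow_natCast ((p : ℝ) ^ (1 / n : ℝ)), ← Real.rpow_mul hp0.le, ← mul_assoc]
    calc _ < (p : ℝ) ^ (1 - m / n : ℝ) * (p : ℝ) ^ (1 / n * m : ℝ) :=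
          mul_lt_mul_of_pos_right hk (Real.rpow_pos_of_pos hp0 _)
      _ = p := by
          rw [← Real.rpow_add hp0]
          have : (1 - m / n + 1 / n * m : ℝ) = 1 := by ring
          rw [this, Real.rpow_one]
  rw [sum_boxCount_heckeMat a b g hC p hbig]
  have hpn : 1 < p ^ n := Nat.one_lt_pow (NeZero.ne n) hp1
  have h2 : (p : ℝ≥0∞) ^ n - 1 = ENNReal.ofReal ((p : ℝ) ^ n - 1) := by
    rw [ENNReal.ofReal_sub _ zero_le_one, ENNReal.ofReal_pow hp0.le, ENNReal.ofReal_natCast,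
      ENNReal.ofReal_one]
  have hpos : (0 : ℝ) < (p : ℝ) ^ n - 1 := by
    rw [sub_pos]; exact_mod_cast hpn
  have hpnm : 1 ≤ p ^ (n - m) := Nat.one_le_pow _ _ (Fact.out : p.Prime).pos
  have h3 : ((p ^ (n - m) - 1 : ℕ) : ℝ≥0∞) = ENNReal.ofReal ((p : ℝ) ^ (n - m) - 1) := by
    rw [← ENNReal.ofReal_natCast, Nat.cast_sub hpnm]
    push_cast; rfl
  have hpos' : (0 : ℝ) ≤ (p : ℝ) ^ (n - m) - 1 := by
    rw [sub_nonneg]; exact_mod_cast hpnm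
  rw [h2, h3, ← ENNReal.ofReal_inv_of_pos hpos, ← ENNReal.ofReal_natCast,
    ← ENNReal.ofReal_mul hpos', ← ENNReal.ofReal_mul (by positivity)]
  congr 1
  have hpow : (p : ℝ) ^ n = p ^ m * p ^ (n - m) := by rw [← pow_add, Nat.add_sub_cancel' hmn.le]
  have e1 : 1 - (p : ℝ) ^ m / p ^ n = ((p : ℝ) ^ (n - m) - 1) * p ^ m / p ^ n := by
    rw [hpow]; field_simp
  have e2 : 1 - (p : ℝ) ^ 0 / p ^ n = ((p : ℝ) ^ n - 1) / p ^ n := by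
    field_simp
  rw [e1, e2]
  have := hpos.ne'
  change _ = _ * (_ * (N ((p : ℝ) ^ (1 / n : ℝ)) : ℝ))
  generalize (N ((p : ℝ) ^ (1 / n : ℝ)) : ℝ) = M
  field_simp

lemma measurable_rowMul_SLR {m n : ℕ} (x : Fin m → Fin n → ℝ) :
    Measurable fun g : SLR n => rowMul x g.1 := by
  refine measurable_pi_lambda _ fun i => measurable_pi_lambda _ fun j => ?_
  simp only [rowMul, Matrix.vecMul, dotProduct]
  exact Finset.measurable_sum _ fun k _ => (measurable_SLR_entry k j).const_mul _

/-- Integral unimodular matrices act on independent integral tuples. -/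
noncomputable def indepTupleEquiv {m n : ℕ} (γ : Matrix.SpecialLinearGroup (Fin n) ℤ) :
    IndepTuple m n ≃ IndepTuple m n := by
  have hdet : ∀ γ : Matrix.SpecialLinearGroup (Fin n) ℤ,
      IsUnit ((γ.1.map (Int.castRingHom ℝ)).det) := fun γ => by
    rw [← RingHom.mapMatrix_apply, ← RingHom.map_det, γ.2, map_one]
    exact isUnit_one
  refine
    { toFun := fun X => ⟨rowMul X.1 γ.1, ?_⟩
      invFun := fun X => ⟨rowMul X.1 γ⁻¹.1, ?_⟩
      left_inv := fun X => Subtype.ext ?_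
      right_inv := fun X => Subtype.ext ?_ }
  · rw [intTuple_rowMul, linearIndependent_rowMul (hdet _)]; exact X.2
  · rw [intTuple_rowMul, linearIndependent_rowMul (hdet _)]; exact X.2
  · have : γ.1 * γ⁻¹.1 = 1 := congrArg Subtype.val (mul_inv_cancel γ)
    exact (rowMul_mul X.1 γ.1 γ⁻¹.1).symm.trans (by rw [this, rowMul_one])
  · have : γ⁻¹.1 * γ.1 = 1 := congrArg Subtype.val (inv_mul_cancel γ)
    exact (rowMul_mul X.1 γ⁻¹.1 γ.1).symm.trans (by rw [this, rowMul_one])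

lemma tsum_indepTuple_intSL_mul {m n : ℕ} {Y : Type*} [AddCommMonoid Y] [TopologicalSpace Y]
    (u : (Fin m → Fin n → ℝ) → Y)
    (γ : Matrix.SpecialLinearGroup (Fin n) ℤ) (g : SLR n) :
    ∑' X : IndepTuple m n, u (rowMul (intTuple X.1) (intSL n γ * g).1) =
      ∑' X : IndepTuple m n, u (rowMul (intTuple X.1) g.1) := by
  refine Eq.trans (tsum_congr fun X => ?_)
    ((indepTupleEquiv γ).tsum_eq fun X : IndepTuple m n => u (rowMul (intTuple X.1) g.1))
  change u (rowMul _ (γ.1.map (Int.castRingHom ℝ) * g.1)) =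
    u (rowMul (intTuple (rowMul X.1 γ.1)) g.1)
  rw [intTuple_rowMul, rowMul_mul]

lemma measurable_boxCount {m n : ℕ} (a b : Fin m → Fin n → ℝ) :
    Measurable (boxCount a b : SLR n → ℝ≥0∞) :=
  Measurable.tsum fun _ =>
    (measurable_one.indicator (measurableSet_tupleBox a b)).comp (measurable_rowMul_SLR _)

open Filter Topology in
lemma lintegral_boxCount {m n : ℕ} [NeZero n] (hmn : m < n) {μ : Measure (LatSpace n)}
    [IsProbabilityMeasure μ] (hμ : ∀ a : SLR n, μ.map (rTranslate n a) = μ)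
    {a b : Fin m → Fin n → ℝ} (ha : ∀ i j, 0 < a i j) (hb : ∀ i j, 0 < b i j) :
    ∫⁻ x, latDescend (boxCount a b) x ∂μ = volume (tupleBox a b) := by
  have hinv : ∀ γ g, (boxCount a b : SLR n → ℝ≥0∞) (intSL n γ * g) = boxCount a b g :=
    tsum_indepTuple_intSL_mul _
  set F : LatSpace n → ℝ≥0∞ := latDescend (boxCount a b) with hFdef
  have hF : ∀ g, F (latMk n g) = boxCount a b g := latDescend_latMk hinv
  have hFm : Measurable F := measurable_latDescend hinv (measurable_boxCount a b)
  set v := volume (tupleBox a b)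
  choose T hTm hT hTi using fun k : ℕ => lintegral_hecke (Nat.nth Nat.Prime k) hμ hFm
  have hlim : ∀ x, Tendsto (fun k => T k x) atTop (𝓝 v) := fun x => by
    obtain ⟨g, rfl⟩ := latMk_surjective n x
    simp only [hT, hF]
    exact tendsto_hecke_boxCount hmn ha hb g
  apply le_antisymm
  · have hN : ∀ N : ℕ, ∫⁻ x, min (F x) N ∂μ ≤ v := fun N => by
      choose S hSm hS hSi using fun k : ℕ =>
        lintegral_hecke (Nat.nth Nat.Prime k) hμ (hFm.min (measurable_const (a := (N : ℝ≥0∞))))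
      choose R hRm hR hRi using fun k : ℕ =>
        lintegral_hecke (Nat.nth Nat.Prime k) hμ (measurable_const (a := (N : ℝ≥0∞)))
      have hRN : ∀ k x, R k x = N := fun k x => by
        have : ∀ y, R k y = R k x := fun y => by
          obtain ⟨g, rfl⟩ := latMk_surjective n x
          obtain ⟨g', rfl⟩ := latMk_surjective n y
          rw [hR, hR]
        simpa [this] using hRi k
      have hSle : ∀ k x, S k x ≤ min (T k x) N := fun k x => by
        refine le_min ?_ ?_
        · obtain ⟨g, rfl⟩ := latMk_surjective n x
          rw [hS, hT]
          gcongr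
          exact min_le_left _ _
        · rw [← hRN k x]
          obtain ⟨g, rfl⟩ := latMk_surjective n x
          rw [hS, hR]
          gcongr
          exact min_le_right _ _
      have hdom : Tendsto (fun k => ∫⁻ x, min (T k x) N ∂μ) atTop (𝓝 (∫⁻ _, min v N ∂μ)) := by
        refine tendsto_lintegral_of_dominated_convergence (fun _ => (N : ℝ≥0∞))
          (fun k => (hTm k).min measurable_const) (fun k => ae_of_all _ fun x => min_le_right _ _)
          (by simp) (ae_of_all _ fun x => (hlim x).min tendsto_const_nhds)
      rw [lintegral_const, measure_univ, mul_one] at hdom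
      refine (ge_of_tendsto' hdom fun k => ?_).trans (min_le_left _ _)
      rw [← hSi k]
      exact lintegral_mono (hSle k)
    have hsup : ∀ x, F x = ⨆ N : ℕ, min (F x) N := fun x => by
      rw [← inf_iSup_eq, ENNReal.iSup_natCast, inf_top_eq]
    rw [lintegral_congr hsup, lintegral_iSup (fun N => hFm.min measurable_const)
      fun N M h x => min_le_min le_rfl (by exact_mod_cast h)]
    exact iSup_le hN
  · calc v = ∫⁻ x, liminf (fun k => T k x) atTop ∂μ := by
          simp [fun x => (hlim x).liminf_eq]
      _ ≤ liminf (fun k => ∫⁻ x, T k x ∂μ) atTop := lintegral_liminf_le hTm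
      _ = ∫⁻ x, F x ∂μ := by simp [hTi]

/-- The open intervals around `0`. -/
def zeroIntervals : Set (Set ℝ) := {s | ∃ a b : ℝ, 0 < a ∧ 0 < b ∧ s = Set.Ioo (-a) b}

lemma isPiSystem_zeroIntervals : IsPiSystem zeroIntervals := by
  rintro _ ⟨a, b, ha, hb, rfl⟩ _ ⟨c, d, hc, hd, rfl⟩ -
  refine ⟨min a c, min b d, lt_min ha hc, lt_min hb hd, ?_⟩
  rw [Set.Ioo_inter_Ioo, ← max_neg_neg]

lemma isCountablySpanning_zeroIntervals : IsCountablySpanning zeroIntervals := by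
  refine ⟨fun k => Set.Ioo (-(k + 1 : ℝ)) (k + 1), fun k => ⟨k + 1, k + 1, by positivity,
    by positivity, rfl⟩, Set.eq_univ_of_forall fun x => Set.mem_iUnion.mpr ?_⟩
  obtain ⟨k, hk⟩ := exists_nat_gt |x|
  rw [abs_lt] at hk
  exact ⟨k, by constructor <;> linarith⟩

lemma generateFrom_zeroIntervals :
    MeasurableSpace.generateFrom zeroIntervals = (inferInstance : MeasurableSpace ℝ) := by
  apply le_antisymm
  · refine MeasurableSpace.generateFrom_le ?_
    rintro _ ⟨a, b, -, -, rfl⟩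
    exact measurableSet_Ioo
  · refine ((BorelSpace.measurable_eq (α := ℝ)).trans (borel_eq_generateFrom_Iio ℝ)).le.trans ?_
    refine MeasurableSpace.generateFrom_le ?_
    have hIoo : ∀ a b : ℝ, 0 < a → 0 < b →
        MeasurableSet[MeasurableSpace.generateFrom zeroIntervals] (Set.Ioo (-a) b) :=
      fun a b ha hb => MeasurableSpace.measurableSet_generateFrom ⟨a, b, ha, hb, rfl⟩
    rintro _ ⟨c, rfl⟩
    by_cases hc : 0 < c
    · have : Set.Iio c = ⋃ k : ℕ, Set.Ioo (-(k + 1 : ℝ)) c := by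
        ext x
        simp only [Set.mem_Iio, Set.mem_iUnion, Set.mem_Ioo]
        refine ⟨fun h => ?_, fun ⟨_, h⟩ => h.2⟩
        obtain ⟨k, hk⟩ := exists_nat_gt (-x)
        exact ⟨k, by linarith, h⟩
      rw [this]
      exact MeasurableSet.iUnion fun k => hIoo _ _ (by positivity) hc
    · have : Set.Iio c = (⋂ j : ℕ, ⋃ k : ℕ,
          Set.Ioo (-(-c + 1 / (j + 1) : ℝ)) (k + 1))ᶜ := by
        ext x
        simp only [Set.mem_Iio, Set.mem_compl_iff, Set.mem_iInter, Set.mem_iUnion, Set.mem_Ioo]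
        rw [← not_le, not_iff_not]
        constructor
        · intro h j
          obtain ⟨k, hk⟩ := exists_nat_gt x
          have : (0 : ℝ) < 1 / (j + 1) := by positivity
          exact ⟨k, by linarith, by linarith⟩
        · intro h
          by_contra! hx
          obtain ⟨j, hj⟩ := exists_nat_one_div_lt (sub_pos.mpr hx)
          obtain ⟨k, hk, -⟩ := h j
          linarith
      rw [this]
      refine (MeasurableSet.iInter fun j => MeasurableSet.iUnion fun k =>
        hIoo _ _ ?_ (by positivity)).compl
      have : (0 : ℝ) < 1 / (j + 1) := by positivity
      linarith

lemma ext_of_tupleBox {m n : ℕ} {ν : Measure (Fin m → Fin n → ℝ)}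
    (h : ∀ a b : Fin m → Fin n → ℝ, (∀ i j, 0 < a i j) → (∀ i j, 0 < b i j) →
      ν (tupleBox a b) = volume (tupleBox a b)) : ν = volume := by
  let C₁ : Set (Set (Fin n → ℝ)) := Set.pi Set.univ '' Set.pi Set.univ fun _ => zeroIntervals
  have hC₁s : IsCountablySpanning C₁ :=
    IsCountablySpanning.pi fun _ => isCountablySpanning_zeroIntervals
  have hC₁p : IsPiSystem C₁ := IsPiSystem.pi fun _ => isPiSystem_zeroIntervals
  have hC₁g : MeasurableSpace.generateFrom C₁ = (inferInstance : MeasurableSpace (Fin n → ℝ)) := by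
    have := generateFrom_pi_eq (ι := Fin n) (α := fun _ => ℝ) (C := fun _ => zeroIntervals)
      fun _ => isCountablySpanning_zeroIntervals
    rw [← this, generateFrom_zeroIntervals]
  let C₂ : Set (Set (Fin m → Fin n → ℝ)) := Set.pi Set.univ '' Set.pi Set.univ fun _ => C₁
  have hC₂p : IsPiSystem C₂ := IsPiSystem.pi fun _ => hC₁p
  have hC₂g : (inferInstance : MeasurableSpace (Fin m → Fin n → ℝ)) =
      MeasurableSpace.generateFrom C₂ := by
    have := generateFrom_pi_eq (ι := Fin m) (α := fun _ => Fin n → ℝ) (C := fun _ => C₁)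
      fun _ => hC₁s
    rw [← this, hC₁g]
  have hbox : ∀ s ∈ C₂, ∃ a b : Fin m → Fin n → ℝ, (∀ i j, 0 < a i j) ∧ (∀ i j, 0 < b i j) ∧
      s = tupleBox a b := by
    rintro _ ⟨t, ht, rfl⟩
    choose w hw hwt using fun i => ht i trivial
    choose a b ha hb hab using fun i j => hw i j trivial
    refine ⟨a, b, ha, hb, ?_⟩
    simp only [tupleBox, ← hab]
    exact congrArg _ (funext fun i => (hwt i).symm)
  have hmem : ∀ k : ℕ, tupleBox (fun (_ : Fin m) (_ : Fin n) => (k + 1 : ℝ)) (fun _ _ => k + 1) ∈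
      C₂ := fun k => ⟨_, fun i _ => ⟨_, fun j _ => ⟨k + 1, k + 1, by positivity, by positivity,
        rfl⟩, rfl⟩, rfl⟩
  have hU : ⋃ k : ℕ, tupleBox (fun (_ : Fin m) (_ : Fin n) => (k + 1 : ℝ)) (fun _ _ => k + 1) =
      Set.univ := by
    refine Set.eq_univ_of_forall fun x => Set.mem_iUnion.mpr ?_
    obtain ⟨k, hk⟩ := exists_nat_gt (∑ i, ∑ j, |x i j|)
    refine ⟨k, fun i _ j _ => ?_⟩
    have h1 : |x i j| ≤ ∑ i, ∑ j, |x i j| :=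
      (Finset.single_le_sum (f := fun j => |x i j|) (fun _ _ => abs_nonneg _)
        (Finset.mem_univ j)).trans (Finset.single_le_sum (f := fun i => ∑ j, |x i j|)
          (fun _ _ => Finset.sum_nonneg fun _ _ => abs_nonneg _) (Finset.mem_univ i))
    have h2 := abs_lt.mp (h1.trans_lt hk)
    constructor <;> linarith [h2.1, h2.2]
  refine Measure.ext_of_generateFrom_of_iUnion C₂ _ hC₂g hC₂p hU hmem (fun k => ?_) ?_
  · obtain ⟨a, b, ha, hb, hs⟩ := hbox _ (hmem k)
    rw [hs, h a b ha hb, volume_tupleBox]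
    exact ENNReal.prod_ne_top fun i _ => ENNReal.prod_ne_top fun j _ => ENNReal.ofReal_ne_top
  · intro s hs
    obtain ⟨a, b, ha, hb, rfl⟩ := hbox _ hs
    exact h a b ha hb

/-- **Rogers' mean value theorem** for linearly independent integral tuples. -/
theorem lintegral_tsum_indepTuple {m n : ℕ} (hmn : m < n) {μ : Measure (LatSpace n)}
    [IsProbabilityMeasure μ] (hμ : ∀ a : SLR n, μ.map (rTranslate n a) = μ)
    {u : (Fin m → Fin n → ℝ) → ℝ≥0∞} (hu : Measurable u) {U : LatSpace n → ℝ≥0∞}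
    (hU : ∀ g, U (latMk n g) = ∑' X : IndepTuple m n, u (rowMul (intTuple X.1) g.1)) :
    ∫⁻ x, U x ∂μ = ∫⁻ y, u y := by
  have : NeZero n := ⟨by omega⟩
  let K : SLR n → Measure (Fin m → Fin n → ℝ) := fun g =>
    Measure.sum fun X : IndepTuple m n => Measure.dirac (rowMul (intTuple X.1) g.1)
  have hK : ∀ γ g, K (intSL n γ * g) = K g := fun γ g => by
    ext s hs
    simp only [K, Measure.sum_apply _ hs]
    exact tsum_indepTuple_intSL_mul (fun y => Measure.dirac y s) γ g
  have hKm : Measurable K := measurable_sum_dirac fun X => measurable_rowMul_SLR _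
  have hν : latBind μ K = volume := by
    refine ext_of_tupleBox fun a b ha hb => ?_
    rw [← lintegral_boxCount hmn hμ ha hb, ← lintegral_indicator_one (measurableSet_tupleBox a b)]
    refine lintegral_latBind μ hK hKm
      (measurable_one.indicator (measurableSet_tupleBox a b)) fun g => ?_
    rw [latDescend_latMk (tsum_indepTuple_intSL_mul _), lintegral_sum_measure]
    exact tsum_congr fun X =>
      (lintegral_dirac' _ (measurable_one.indicator (measurableSet_tupleBox a b))).symm
  rw [← hν, lintegral_latBind μ hK hKm hu]
  intro g
  rw [hU, lintegral_sum_measure]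
  exact tsum_congr fun X => (lintegral_dirac' _ hu).symm

open Filter Topology in
lemma Monotone.lt_of_hasDerivAt_pos {F : ℝ → ℝ} (hF : Monotone F) {x d : ℝ}
    (h : HasDerivAt F d x) (hd : 0 < d) {y z : ℝ} (hy : y < x) (hz : x < z) :
    F y < F x ∧ F x < F z := by
  have h1 := (hasDerivAt_iff_tendsto_slope.mp h).eventually (eventually_gt_nhds hd)
  constructor
  · have h2 : ∀ᶠ t in 𝓝[<] x, 0 < slope F x t := nhdsWithin_mono x (fun _ h => ne_of_lt h) h1
    obtain ⟨t, ht, hyt, htx⟩ := (h2.and (Ioo_mem_nhdsLT hy)).exists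
    rw [slope_def_field, div_pos_iff] at ht
    exact (hF hyt.le).trans_lt (by rcases ht with h | h <;> linarith)
  · have h2 : ∀ᶠ t in 𝓝[>] x, 0 < slope F x t := nhdsWithin_mono x (fun _ h => ne_of_gt h) h1
    obtain ⟨t, ht, hxt, htz⟩ := (h2.and (Ioo_mem_nhdsGT hz)).exists
    rw [slope_def_field, div_pos_iff] at ht
    exact lt_of_lt_of_le (by rcases ht with h | h <;> linarith) (hF htz.le)

open Filter Topology in
lemma exists_gaussian_primitive : ∃ e : OpenPartialHomeomorph ℝ ℝ, StrictMono e ∧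
    (∀ s, HasDerivAt e (Real.exp (-Real.pi * s ^ 2)) s) ∧ Set.Ioo (-(1 / 2)) (1 / 2) ⊆ e.target := by
  have hc : Continuous fun s : ℝ => Real.exp (-Real.pi * s ^ 2) := by fun_prop
  set Φ : ℝ → ℝ := fun t => ∫ s in (0 : ℝ)..t, Real.exp (-Real.pi * s ^ 2)
  have hΦ : ∀ s, HasStrictDerivAt Φ (Real.exp (-Real.pi * s ^ 2)) s :=
    fun s => hc.integral_hasStrictDerivAt 0 s
  have hmono : StrictMono Φ := strictMono_of_deriv_pos fun s => by
    rw [(hΦ s).hasDerivAt.deriv]; positivity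
  have hcont : Continuous Φ :=
    continuous_iff_continuousAt.mpr fun s => (hΦ s).hasDerivAt.continuousAt
  have hopen := Topology.IsOpenEmbedding.of_continuous_injective_isOpenMap hcont
    hmono.injective (isOpenMap_of_hasStrictDerivAt hΦ fun s => (Real.exp_pos _).ne')
  refine ⟨hopen.toOpenPartialHomeomorph Φ, hmono, fun s => (hΦ s).hasDerivAt, ?_⟩
  have hlim : Tendsto Φ atTop (𝓝 (1 / 2)) := by
    have := intervalIntegral_tendsto_integral_Ioi (μ := volume) 0
      ((integrable_exp_neg_mul_sq Real.pi_pos).integrableOn) tendsto_id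
    rw [integral_gaussian_Ioi, div_self Real.pi_ne_zero, Real.sqrt_one] at this
    exact this
  have hodd : ∀ t, Φ (-t) = -Φ t := fun t => by
    have := intervalIntegral.integral_comp_neg (a := 0) (b := t)
      fun s : ℝ => Real.exp (-Real.pi * s ^ 2)
    simp only [neg_sq, neg_zero] at this
    simp only [Φ]
    rw [this, intervalIntegral.integral_symm (-t) 0]
  have hex : ∀ c < 1 / 2, ∃ t, c ≤ Φ t := fun c hc =>
    ((hlim.eventually (eventually_gt_nhds hc)).exists).imp fun _ h => h.le
  intro c hc
  rw [Topology.IsOpenEmbedding.toOpenPartialHomeomorph_target]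
  refine mem_range_of_exists_le_of_exists_ge hcont ?_ (hex c hc.2)
  obtain ⟨t, ht⟩ := hex (-c) (by linarith [hc.1])
  exact ⟨-t, by rw [hodd]; linarith⟩

open Filter Topology in
/-- Monotone transport of a probability density on `ℝ` to the Gaussian density. -/
lemma exists_gaussian_transport {f : ℝ → ℝ} (hfm : Measurable f) (hf0 : ∀ x, 0 ≤ f x)
    (hfi : Integrable f) (hf1 : ∫ x, f x = 1) :
    ∃ (S s' : ℝ → ℝ) (D : Set ℝ), MeasurableSet D ∧ (∀ᵐ x, x ∈ D ∨ f x = 0) ∧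
      StrictMonoOn S D ∧ ∀ x ∈ D, 0 < s' x ∧ HasDerivAt S (s' x) x ∧
        f x = Real.exp (-Real.pi * S x ^ 2) * s' x := by
  obtain ⟨e, he, hde, htgt⟩ := exists_gaussian_primitive
  set F : ℝ → ℝ := fun x => (∫ t in Set.Iic x, f t) - 1 / 2 with hFdef
  have hFx : F = fun x => (∫ t in (0 : ℝ)..x, f t) + F 0 := by
    funext x
    rw [← intervalIntegral.integral_Iic_sub_Iic hfi.integrableOn hfi.integrableOn]
    simp only [hFdef]; ring
  have hFm : Monotone F := fun x y hxy => by
    simp only [hFdef]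
    refine sub_le_sub_right ?_ _
    exact setIntegral_mono_set hfi.integrableOn (ae_of_all _ hf0)
      (Set.Iic_subset_Iic.mpr hxy).eventuallyLE
  have hF0 : ∀ x, -(1 / 2) ≤ F x := fun x => by
    have : 0 ≤ ∫ t in Set.Iic x, f t := integral_nonneg hf0
    simp only [hFdef]; linarith
  have hF1 : ∀ x, F x ≤ 1 / 2 := fun x => by
    have : ∫ t in Set.Iic x, f t ≤ 1 := hf1 ▸ setIntegral_le_integral hfi (ae_of_all _ hf0)
    simp only [hFdef]; linarith
  have hder := LocallyIntegrable.ae_hasDerivAt_integral hfi.locallyIntegrable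
  obtain ⟨N, hN, hNm, hN0⟩ := exists_measurable_superset_of_null (ae_iff.mp hder)
  have hD : ∀ x ∈ Nᶜ, HasDerivAt F (f x) x := fun x hx => by
    have hx' : ∀ c, HasDerivAt (fun x => ∫ (t : ℝ) in c..x, f t) (f x) x := by
      by_contra h
      exact hx (hN h)
    rw [hFx]
    exact (hx' 0).add_const _
  have hFin : ∀ x ∈ Nᶜ, 0 < f x → F x ∈ e.target := fun x hx hfx => by
    obtain ⟨h1, h2⟩ := hFm.lt_of_hasDerivAt_pos (hD x hx) hfx (sub_one_lt x) (lt_add_one x)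
    exact htgt ⟨(hF0 _).trans_lt h1, h2.trans_le (hF1 _)⟩
  refine ⟨e.symm ∘ F, fun x => (Real.exp (-Real.pi * e.symm (F x) ^ 2))⁻¹ * f x,
    Nᶜ ∩ {x | 0 < f x}, hNm.compl.inter (measurableSet_lt measurable_const hfm), ?_, ?_, ?_⟩
  · filter_upwards [measure_eq_zero_iff_ae_notMem.mp hN0] with x hx
    rcases (hf0 x).lt_or_eq with h | h
    · exact Or.inl ⟨hx, h⟩
    · exact Or.inr h.symm
  · rintro x ⟨hx, hfx⟩ y ⟨hy, hfy⟩ hxy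
    rw [← he.lt_iff_lt, Function.comp, Function.comp, e.right_inv (hFin x hx hfx),
      e.right_inv (hFin y hy hfy)]
    exact (hFm.lt_of_hasDerivAt_pos (hD x hx) hfx (sub_one_lt x) hxy).2
  · rintro x ⟨hx, hfx⟩
    have hpos := Real.exp_pos (-Real.pi * e.symm (F x) ^ 2)
    refine ⟨mul_pos (inv_pos.mpr hpos) hfx, ?_, ?_⟩
    · exact (e.hasDerivAt_symm (hFin x hx hfx) hpos.ne' (hde _)).comp x (hD x hx)
    · simp only [Function.comp]
      field_simp

lemma rpow_two_thirds_mul_le {a b c : ℝ} (ha : 0 ≤ a) (hb : 0 ≤ b) (hc : 0 ≤ c) :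
    (a * b * c) ^ (2 / 3 : ℝ) ≤ (a * b + b * c + a * c) / 3 := by
  have h := Real.geom_mean_le_arith_mean3_weighted (w₁ := 1 / 3) (w₂ := 1 / 3) (w₃ := 1 / 3)
    (by norm_num) (by norm_num) (by norm_num) (mul_nonneg ha hb) (mul_nonneg hb hc)
    (mul_nonneg ha hc) (by norm_num)
  rw [← Real.mul_rpow (by positivity) (by positivity),
    ← Real.mul_rpow (by positivity) (by positivity)] at h
  have e : a * b * (b * c) * (a * c) = (a * b * c) ^ (2 : ℝ) := by
    rw [Real.rpow_two]; ring
  rw [e, ← Real.rpow_mul (by positivity)] at h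
  norm_num at h ⊢
  linarith

lemma gaussian_triple_le (r s t : ℝ) :
    (Real.exp (-Real.pi * r ^ 2) * Real.exp (-Real.pi * s ^ 2) *
      Real.exp (-Real.pi * t ^ 2)) ^ (2 / 3 : ℝ) ≤
    Real.exp (-(4 * Real.pi / 9) * ((r + t) ^ 2 - (r + t) * (s + t) + (s + t) ^ 2)) := by
  rw [← Real.exp_add, ← Real.exp_add, ← Real.exp_mul, Real.exp_le_exp]
  nlinarith [mul_nonneg Real.pi_pos.le (sq_nonneg (r + s - t))]

lemma lintegral_exp_neg_mul_sq {b : ℝ} (hb : 0 < b) :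
    ∫⁻ x : ℝ, ENNReal.ofReal (Real.exp (-b * x ^ 2)) = ENNReal.ofReal (√(Real.pi / b)) := by
  rw [← integral_gaussian, ofReal_integral_eq_lintegral_ofReal (integrable_exp_neg_mul_sq hb)
    (ae_of_all _ fun x => (Real.exp_pos _).le)]

lemma lintegral_gaussian_form :
    ∫⁻ p : ℝ × ℝ, ENNReal.ofReal (Real.exp (-(4 * Real.pi / 9) *
      (p.1 ^ 2 - p.1 * p.2 + p.2 ^ 2))) = ENNReal.ofReal (3 / 2 * √3) := by
  have hpi := Real.pi_pos
  rw [Measure.volume_eq_prod, lintegral_prod_symm' _ (by fun_prop)]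
  have h1 : ∀ y : ℝ, ∫⁻ x : ℝ, ENNReal.ofReal (Real.exp (-(4 * Real.pi / 9) *
      (x ^ 2 - x * y + y ^ 2))) =
      ENNReal.ofReal (3 / 2) * ENNReal.ofReal (Real.exp (-(Real.pi / 3) * y ^ 2)) := fun y => by
    have h2 : ∀ x : ℝ, ENNReal.ofReal (Real.exp (-(4 * Real.pi / 9) *
        (x ^ 2 - x * y + y ^ 2))) =
        ENNReal.ofReal (Real.exp (-(4 * Real.pi / 9) * (x - y / 2) ^ 2)) *
          ENNReal.ofReal (Real.exp (-(Real.pi / 3) * y ^ 2)) := fun x => by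
      rw [← ENNReal.ofReal_mul (Real.exp_pos _).le, ← Real.exp_add]
      congr 2; ring
    simp_rw [h2]
    rw [lintegral_mul_const _ (by fun_prop),
      lintegral_sub_right_eq_self
        (fun x : ℝ => ENNReal.ofReal (Real.exp (-(4 * Real.pi / 9) * x ^ 2))) (y / 2),
      lintegral_exp_neg_mul_sq (by positivity)]
    congr 2
    rw [show Real.pi / (4 * Real.pi / 9) = (3 / 2) ^ 2 by field_simp; norm_num,
      Real.sqrt_sq (by norm_num)]
  simp_rw [h1]
  rw [lintegral_const_mul _ (by fun_prop), lintegral_exp_neg_mul_sq (by positivity),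
    ← ENNReal.ofReal_mul (by norm_num)]
  congr 3
  field_simp

lemma ae_and_ae_and_ae_add {P Q R : ℝ → Prop} (hP : ∀ᵐ x, P x) (hQ : ∀ᵐ x, Q x)
    (hR : ∀ᵐ x, R x) : ∀ᵐ p : ℝ × ℝ, P p.1 ∧ Q p.2 ∧ R (p.1 + p.2) := by
  have q1 := (Measure.quasiMeasurePreserving_fst (μ := (volume : Measure ℝ))
    (ν := (volume : Measure ℝ))).ae hP
  have q2 := (Measure.quasiMeasurePreserving_snd (μ := (volume : Measure ℝ))
    (ν := (volume : Measure ℝ))).ae hQ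
  have q3 := ((Measure.quasiMeasurePreserving_snd (μ := (volume : Measure ℝ))
    (ν := (volume : Measure ℝ))).comp
      (measurePreserving_prod_add volume volume).quasiMeasurePreserving).ae hR
  rw [Measure.volume_eq_prod]
  filter_upwards [q1, q2, q3] with p h1 h2 h3 using ⟨h1, h2, h3⟩

lemma young_of_integral_eq_one {f g k : ℝ → ℝ} (hfm : Measurable f) (hgm : Measurable g)
    (hkm : Measurable k) (hf0 : ∀ x, 0 ≤ f x) (hg0 : ∀ x, 0 ≤ g x) (hk0 : ∀ x, 0 ≤ k x)
    (hfi : Integrable f) (hgi : Integrable g) (hki : Integrable k)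
    (hf1 : ∫ x, f x = 1) (hg1 : ∫ x, g x = 1) (hk1 : ∫ x, k x = 1) :
    ∫⁻ p : ℝ × ℝ, ENNReal.ofReal ((f p.1 * g p.2 * k (p.1 + p.2)) ^ (2 / 3 : ℝ)) ≤
      ENNReal.ofReal (√3 / 2) := by
  obtain ⟨R, r', A, hA, hAf, hR, hRA⟩ := exists_gaussian_transport hfm hf0 hfi hf1
  obtain ⟨S, s', B, hB, hBg, hS, hSB⟩ := exists_gaussian_transport hgm hg0 hgi hg1
  obtain ⟨T, t', C, hC, hCk, hT, hTC⟩ := exists_gaussian_transport hkm hk0 hki hk1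
  set D : Set (ℝ × ℝ) := {p | p.1 ∈ A ∧ p.2 ∈ B ∧ p.1 + p.2 ∈ C}
  have hD : MeasurableSet D := (measurable_fst hA).inter
    ((measurable_snd hB).inter ((measurable_fst.add measurable_snd) hC))
  let Θ : ℝ × ℝ → ℝ × ℝ := fun p => (R p.1 + T (p.1 + p.2), S p.2 + T (p.1 + p.2))
  let Θ' : ℝ × ℝ → ℝ × ℝ →L[ℝ] ℝ × ℝ := fun p =>
    (Matrix.toLin (.finTwoProd ℝ) (.finTwoProd ℝ)
      !![r' p.1 + t' (p.1 + p.2), t' (p.1 + p.2);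
        t' (p.1 + p.2), s' p.2 + t' (p.1 + p.2)]).toContinuousLinearMap
  have hdet : ∀ p, (Θ' p).det = r' p.1 * s' p.2 + s' p.2 * t' (p.1 + p.2) +
      r' p.1 * t' (p.1 + p.2) := fun p => by
    simp only [Θ', ContinuousLinearMap.det]
    rw [LinearMap.coe_toContinuousLinearMap, LinearMap.det_toLin, Matrix.det_fin_two_of]
    ring
  have hΘ : ∀ p ∈ D, HasFDerivWithinAt Θ (Θ' p) D p := by
    rintro p ⟨h1, h2, h3⟩
    have q1 : HasFDerivAt (fun p : ℝ × ℝ => p.1) (ContinuousLinearMap.fst ℝ ℝ ℝ) p := hasFDerivAt_fst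
    have q2 : HasFDerivAt (fun p : ℝ × ℝ => p.2) (ContinuousLinearMap.snd ℝ ℝ ℝ) p := hasFDerivAt_snd
    have q3 : HasFDerivAt (fun p : ℝ × ℝ => p.1 + p.2) (.fst ℝ ℝ ℝ + .snd ℝ ℝ ℝ) p := q1.add q2
    have d1 := (hRA _ h1).2.1.comp_hasFDerivAt p q1
    have d2 := (hSB _ h2).2.1.comp_hasFDerivAt p q2
    have d3 := (hTC _ h3).2.1.comp_hasFDerivAt p q3
    have := ((d1.add d3).prodMk (d2.add d3)).hasFDerivWithinAt (s := D)
    refine this.congr_fderiv ?_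
    simp only [Θ']
    rw [Matrix.toLin_finTwoProd_toContinuousLinearMap]
    ext <;> simp
  have hinj : Set.InjOn Θ D := by
    rintro ⟨x, y⟩ ⟨h1, h2, h3⟩ ⟨x', y'⟩ ⟨h1', h2', h3'⟩ h
    simp only [Θ, Prod.mk.injEq] at h h1 h2 h3 h1' h2' h3'
    obtain ⟨e1, e2⟩ := h
    have hT' := hT.lt_iff_lt h3 h3'
    have hT'' := hT.lt_iff_lt h3' h3
    have hR' := hR.lt_iff_lt h1 h1'
    have hR'' := hR.lt_iff_lt h1' h1
    have hS' := hS.lt_iff_lt h2 h2'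
    have hS'' := hS.lt_iff_lt h2' h2
    rcases lt_trichotomy (x + y) (x' + y') with hlt | heq | hgt
    · have := hT'.mpr hlt
      have hx := hR''.mp (by linarith)
      have hy := hS''.mp (by linarith)
      linarith
    · rw [heq] at e1 e2
      have hx := hR.injOn h1 h1' (by linarith)
      have hy := hS.injOn h2 h2' (by linarith)
      rw [hx, hy]
    · have := hT''.mpr hgt
      have hx := hR'.mp (by linarith)
      have hy := hS'.mp (by linarith)
      linarith
  let G : ℝ × ℝ → ℝ≥0∞ := fun p => ENNReal.ofReal (Real.exp (-(4 * Real.pi / 9) *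
      (p.1 ^ 2 - p.1 * p.2 + p.2 ^ 2)))
  have hzero : ∀ᵐ p : ℝ × ℝ, p ∉ D →
      ENNReal.ofReal ((f p.1 * g p.2 * k (p.1 + p.2)) ^ (2 / 3 : ℝ)) = 0 := by
    filter_upwards [ae_and_ae_and_ae_add hAf hBg hCk] with p ⟨h1, h2, h3⟩ hp
    have : f p.1 * g p.2 * k (p.1 + p.2) = 0 := by
      rcases h1 with h1 | h1
      · rcases h2 with h2 | h2
        · rcases h3 with h3 | h3
          · exact absurd ⟨h1, h2, h3⟩ hp
          · rw [h3, mul_zero]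
        · rw [h2, mul_zero, zero_mul]
      · rw [h1, zero_mul, zero_mul]
    rw [this, Real.zero_rpow (by norm_num), ENNReal.ofReal_zero]
  calc ∫⁻ p : ℝ × ℝ, ENNReal.ofReal ((f p.1 * g p.2 * k (p.1 + p.2)) ^ (2 / 3 : ℝ))
      = ∫⁻ p in D, ENNReal.ofReal ((f p.1 * g p.2 * k (p.1 + p.2)) ^ (2 / 3 : ℝ)) := by
        rw [← lintegral_indicator hD]
        refine lintegral_congr_ae (hzero.mono fun p hp => ?_)
        by_cases h : p ∈ D
        · rw [Set.indicator_of_mem h]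
        · rw [Set.indicator_of_notMem h]; exact hp h
    _ ≤ ∫⁻ p in D, ENNReal.ofReal (1 / 3) * (ENNReal.ofReal |(Θ' p).det| * G (Θ p)) := by
        refine setLIntegral_mono' hD fun p hp => ?_
        obtain ⟨h1, h2, h3⟩ := hp
        obtain ⟨ha, -, ea⟩ := hRA _ h1
        obtain ⟨hb, -, eb⟩ := hSB _ h2
        obtain ⟨hc, -, ec⟩ := hTC _ h3
        simp only [G, Θ]
        rw [hdet, ← ENNReal.ofReal_mul (abs_nonneg _), ← ENNReal.ofReal_mul (by norm_num), ea, eb,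
          ec, abs_of_nonneg (by positivity)]
        apply ENNReal.ofReal_le_ofReal
        rw [show ∀ u v w a b c : ℝ, u * a * (v * b) * (w * c) = (a * b * c) * (u * v * w) by
          intros; ring, Real.mul_rpow (by positivity) (by positivity), ← mul_assoc]
        refine mul_le_mul ?_ (gaussian_triple_le _ _ _) (by positivity) (by positivity)
        refine (rpow_two_thirds_mul_le ha.le hb.le hc.le).trans_eq ?_
        ring
    _ = ENNReal.ofReal (1 / 3) * ∫⁻ q in Θ '' D, G q := by
        rw [lintegral_const_mul' _ _ ENNReal.ofReal_ne_top,
          lintegral_image_eq_lintegral_abs_det_fderiv_mul volume hD hΘ hinj]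
    _ ≤ ENNReal.ofReal (1 / 3) * ENNReal.ofReal (3 / 2 * √3) := by
        gcongr
        exact (setLIntegral_le_lintegral _ _).trans_eq lintegral_gaussian_form
    _ = ENNReal.ofReal (√3 / 2) := by
        rw [← ENNReal.ofReal_mul (by norm_num)]
        congr 1; ring

/-- The sharp Young (Brascamp-Lieb) inequality on `ℝ` with all exponents `2 / 3`. -/
lemma young_real {f g k : ℝ → ℝ≥0∞} (hf : Measurable f) (hg : Measurable g) (hk : Measurable k) :
    ∫⁻ x, ∫⁻ y, (f x * g y * k (x + y)) ^ (2 / 3 : ℝ) ≤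
      ENNReal.ofReal (√3 / 2) * ((∫⁻ x, f x) * (∫⁻ x, g x) * ∫⁻ x, k x) ^ (2 / 3 : ℝ) := by
  rw [← lintegral_prod (fun p : ℝ × ℝ => (f p.1 * g p.2 * k (p.1 + p.2)) ^ (2 / 3 : ℝ))
    (by fun_prop), ← Measure.volume_eq_prod]
  by_cases h0 : (∫⁻ x, f x) * (∫⁻ x, g x) * ∫⁻ x, k x = 0
  · have hz : ∀ᵐ p : ℝ × ℝ, (f p.1 * g p.2 * k (p.1 + p.2)) ^ (2 / 3 : ℝ) = 0 := by
      have key : ∀ᵐ p : ℝ × ℝ, f p.1 * g p.2 * k (p.1 + p.2) = 0 := by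
        have ht : ∀ᵐ _ : ℝ, True := ae_of_all _ fun _ => trivial
        rcases mul_eq_zero.mp h0 with h0 | h0
        · rcases mul_eq_zero.mp h0 with h0 | h0
          · filter_upwards [ae_and_ae_and_ae_add ((lintegral_eq_zero_iff hf).mp h0) ht ht]
              with p hp
            rw [hp.1, Pi.zero_apply, zero_mul, zero_mul]
          · filter_upwards [ae_and_ae_and_ae_add ht ((lintegral_eq_zero_iff hg).mp h0) ht]
              with p hp
            rw [hp.2.1, Pi.zero_apply, mul_zero, zero_mul]
        · filter_upwards [ae_and_ae_and_ae_add ht ht ((lintegral_eq_zero_iff hk).mp h0)]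
            with p hp
          rw [hp.2.2, Pi.zero_apply, mul_zero]
      filter_upwards [key] with p hp
      rw [hp, ENNReal.zero_rpow_of_pos (by norm_num)]
    rw [lintegral_congr_ae hz]
    simp
  by_cases ht : (∫⁻ x, f x) * (∫⁻ x, g x) * ∫⁻ x, k x = ∞
  · rw [ht, ENNReal.top_rpow_of_pos (by norm_num), ENNReal.mul_top
      (ENNReal.ofReal_pos.mpr (by positivity)).ne']
    exact le_top
  have hfin : ∀ {f : ℝ → ℝ≥0∞}, Measurable f → ∫⁻ x, f x ≠ 0 → ∫⁻ x, f x ≠ ∞ →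
      ∃ f' : ℝ → ℝ, Measurable f' ∧ (∀ x, 0 ≤ f' x) ∧ Integrable f' ∧ ∫ x, f' x = 1 ∧
        ∀ᵐ x, f x = (∫⁻ x, f x) * ENNReal.ofReal (f' x) := by
    intro f hf h0 ht
    have hae := ae_lt_top hf ht
    have hI : ∫⁻ x, f x / ∫⁻ x, f x = 1 := by
      simp_rw [div_eq_mul_inv]
      rw [lintegral_mul_const _ hf, ENNReal.mul_inv_cancel h0 ht]
    have hm : Measurable fun x => f x / ∫⁻ x, f x := hf.div_const _
    refine ⟨fun x => (f x / ∫⁻ x, f x).toReal, hm.ennreal_toReal,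
      fun x => ENNReal.toReal_nonneg, integrable_toReal_of_lintegral_ne_top hm.aemeasurable
        (by rw [hI]; exact ENNReal.one_ne_top), ?_, ?_⟩
    · rw [integral_toReal hm.aemeasurable (hae.mono fun x hx => ENNReal.div_lt_top hx.ne h0), hI,
        ENNReal.toReal_one]
    · filter_upwards [hae] with x hx
      rw [ENNReal.ofReal_toReal (ENNReal.div_lt_top hx.ne h0).ne, ENNReal.mul_div_cancel h0 ht]
  have hk0 := right_ne_zero_of_mul h0
  have hg0 := right_ne_zero_of_mul (left_ne_zero_of_mul h0)
  have hf0 := left_ne_zero_of_mul (left_ne_zero_of_mul h0)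
  have hkt : ∫⁻ x, k x ≠ ∞ := fun h => ht (by
    rw [h, ENNReal.mul_top (left_ne_zero_of_mul h0)])
  have hgt : ∫⁻ x, g x ≠ ∞ := fun h => ht (by
    rw [h, ENNReal.mul_top hf0, ENNReal.top_mul hk0])
  have hft : ∫⁻ x, f x ≠ ∞ := fun h => ht (by
    rw [h, ENNReal.top_mul hg0, ENNReal.top_mul hk0])
  obtain ⟨f', hf'm, hf'0, hf'i, hf'1, hf'⟩ := hfin hf hf0 hft
  obtain ⟨g', hg'm, hg'0, hg'i, hg'1, hg'⟩ := hfin hg hg0 hgt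
  obtain ⟨k', hk'm, hk'0, hk'i, hk'1, hk'⟩ := hfin hk hk0 hkt
  have hae : ∀ᵐ p : ℝ × ℝ, (f p.1 * g p.2 * k (p.1 + p.2)) ^ (2 / 3 : ℝ) =
      ENNReal.ofReal ((f' p.1 * g' p.2 * k' (p.1 + p.2)) ^ (2 / 3 : ℝ)) *
        ((∫⁻ x, f x) * (∫⁻ x, g x) * ∫⁻ x, k x) ^ (2 / 3 : ℝ) := by
    filter_upwards [ae_and_ae_and_ae_add hf' hg' hk'] with p ⟨h1, h2, h3⟩
    have h1' := hf'0 p.1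
    have h2' := hg'0 p.2
    have h3' := hk'0 (p.1 + p.2)
    rw [h1, h2, h3, ← ENNReal.ofReal_rpow_of_nonneg (by positivity) (by norm_num),
      ← ENNReal.mul_rpow_of_nonneg _ _ (by norm_num), ENNReal.ofReal_mul (by positivity),
      ENNReal.ofReal_mul h1']
    congr 1
    ring
  rw [lintegral_congr_ae hae, lintegral_mul_const' _ _ (ENNReal.rpow_ne_top_of_nonneg
    (by norm_num) ht)]
  gcongr
  exact young_of_integral_eq_one hf'm hg'm hk'm hf'0 hg'0 hk'0 hf'i hg'i hk'i hf'1 hg'1 hk'1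

lemma lintegral_fin_succ {n : ℕ} {F : (Fin (n + 1) → ℝ) → ℝ≥0∞} (hF : Measurable F) :
    ∫⁻ x, F x = ∫⁻ s : ℝ, ∫⁻ x : Fin n → ℝ, F (Fin.cons s x) := by
  have h := (volume_preserving_piFinSuccAbove (fun _ : Fin (n + 1) => ℝ) 0).symm
  rw [← h.lintegral_comp hF, Measure.volume_eq_prod,
    lintegral_prod (fun p : ℝ × (Fin n → ℝ) => F ((MeasurableEquiv.piFinSuccAbove
      (fun _ => ℝ) 0).symm p)) (hF.comp (MeasurableEquiv.measurable _)).aemeasurable]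
  simp [MeasurableEquiv.piFinSuccAbove, Fin.insertNthEquiv]

@[fun_prop]
lemma measurable_finCons {n : ℕ} {α : Type*} [MeasurableSpace α] {s : α → ℝ}
    {x : α → Fin n → ℝ} (hs : Measurable s) (hx : Measurable x) :
    Measurable fun a => (Fin.cons (s a) (x a) : Fin (n + 1) → ℝ) := by
  refine measurable_pi_lambda _ fun i => ?_
  refine Fin.cases ?_ (fun i => ?_) i
  · simpa using hs
  · simpa [Function.comp_def] using (measurable_pi_apply i).comp hx

/-- The sharp Young (Brascamp-Lieb) inequality on `ℝⁿ` with all exponents `2 / 3`. -/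
lemma young_pi : ∀ (n : ℕ) {f g k : (Fin n → ℝ) → ℝ≥0∞}, Measurable f → Measurable g →
    Measurable k → ∫⁻ x, ∫⁻ y, (f x * g y * k (x + y)) ^ (2 / 3 : ℝ) ≤
      ENNReal.ofReal (√3 / 2) ^ n *
        ((∫⁻ x, f x) * (∫⁻ x, g x) * ∫⁻ x, k x) ^ (2 / 3 : ℝ) := by
  intro n
  induction n with
  | zero =>
    intro f g k hf hg hk
    have : (volume : Measure (Fin 0 → ℝ)) = Measure.dirac 0 := Measure.volume_pi_eq_dirac 0
    simp [this]
  | succ n ih =>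
    intro f g k hf hg hk
    have hf' : Measurable fun s : ℝ => ∫⁻ x : Fin n → ℝ, f (Fin.cons s x) :=
      Measurable.lintegral_prod_right' (f := fun p : ℝ × (Fin n → ℝ) => f (Fin.cons p.1 p.2))
        (by fun_prop)
    have hg' : Measurable fun s : ℝ => ∫⁻ x : Fin n → ℝ, g (Fin.cons s x) :=
      Measurable.lintegral_prod_right' (f := fun p : ℝ × (Fin n → ℝ) => g (Fin.cons p.1 p.2))
        (by fun_prop)
    have hk' : Measurable fun s : ℝ => ∫⁻ x : Fin n → ℝ, k (Fin.cons s x) :=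
      Measurable.lintegral_prod_right' (f := fun p : ℝ × (Fin n → ℝ) => k (Fin.cons p.1 p.2))
        (by fun_prop)
    have hcons : ∀ (s t : ℝ) (x y : Fin n → ℝ),
        (Fin.cons s x + Fin.cons t y : Fin (n + 1) → ℝ) = Fin.cons (s + t) (x + y) := by
      intro s t x y
      funext i
      refine Fin.cases ?_ (fun i => ?_) i <;> simp
    calc ∫⁻ x, ∫⁻ y, (f x * g y * k (x + y)) ^ (2 / 3 : ℝ)
        = ∫⁻ s : ℝ, ∫⁻ x : Fin n → ℝ, ∫⁻ t : ℝ, ∫⁻ y : Fin n → ℝ,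
            (f (Fin.cons s x) * g (Fin.cons t y) * k (Fin.cons (s + t) (x + y))) ^
              (2 / 3 : ℝ) := by
          rw [lintegral_fin_succ (Measurable.lintegral_prod_right'
            (f := fun p : (Fin (n + 1) → ℝ) × (Fin (n + 1) → ℝ) =>
              (f p.1 * g p.2 * k (p.1 + p.2)) ^ (2 / 3 : ℝ)) (by fun_prop))]
          refine lintegral_congr fun s => lintegral_congr fun x => ?_
          rw [lintegral_fin_succ (by fun_prop)]
          simp only [hcons]
      _ = ∫⁻ s : ℝ, ∫⁻ t : ℝ, ∫⁻ x : Fin n → ℝ, ∫⁻ y : Fin n → ℝ,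
            (f (Fin.cons s x) * g (Fin.cons t y) * k (Fin.cons (s + t) (x + y))) ^
              (2 / 3 : ℝ) := by
          refine lintegral_congr fun s => lintegral_lintegral_swap ?_
          refine Measurable.aemeasurable (Measurable.lintegral_prod_right'
            (f := fun p : ((Fin n → ℝ) × ℝ) × (Fin n → ℝ) => (f (Fin.cons s p.1.1) *
              g (Fin.cons p.1.2 p.2) * k (Fin.cons (s + p.1.2) (p.1.1 + p.2))) ^ (2 / 3 : ℝ)) ?_)
          fun_prop
      _ ≤ ∫⁻ s : ℝ, ∫⁻ t : ℝ, ENNReal.ofReal (√3 / 2) ^ n *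
            ((∫⁻ x : Fin n → ℝ, f (Fin.cons s x)) * (∫⁻ x : Fin n → ℝ, g (Fin.cons t x)) *
              ∫⁻ x : Fin n → ℝ, k (Fin.cons (s + t) x)) ^ (2 / 3 : ℝ) :=
          lintegral_mono fun s => lintegral_mono fun t =>
            ih (by fun_prop) (by fun_prop) (by fun_prop)
      _ ≤ _ := by
          simp_rw [lintegral_const_mul' _ _ (ENNReal.pow_ne_top ENNReal.ofReal_ne_top)]
          rw [lintegral_fin_succ hf, lintegral_fin_succ hg, lintegral_fin_succ hk, pow_succ,
            mul_assoc]
          gcongr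
          exact young_real hf' hg' hk'

lemma lintegral_smul_sign {n : ℕ} {s : ℝ} (hs : s = 1 ∨ s = -1) (F : (Fin n → ℝ) → ℝ≥0∞) :
    ∫⁻ x, F (s • x) = ∫⁻ x, F x := by
  rcases hs with rfl | rfl
  · simp
  · simpa using lintegral_neg_eq_self (μ := volume) F

lemma lintegral_indicator_signed_le {n : ℕ} {A : Set (Fin n → ℝ)} (hA : MeasurableSet A)
    {s t : ℝ} (hs : s = 1 ∨ s = -1) (ht : t = 1 ∨ t = -1) (z : Fin n → ℝ) :
    ∫⁻ x, ∫⁻ y, A.indicator (1 : (Fin n → ℝ) → ℝ≥0∞) x * A.indicator 1 y *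
      A.indicator 1 (s • x + t • y + z) ≤
        ENNReal.ofReal (√3 / 2) ^ n * (volume A * volume A) := by
  set I : (Fin n → ℝ) → ℝ≥0∞ := A.indicator 1
  have hI : Measurable I := measurable_one.indicator hA
  have hIA : ∫⁻ x, I x = volume A := lintegral_indicator_one hA
  have hsq : ∀ s : ℝ, s = 1 ∨ s = -1 → s * s = 1 := by rintro s (rfl | rfl) <;> norm_num
  have h01 : ∀ x, I x = 0 ∨ I x = 1 := fun x => by
    by_cases h : x ∈ A <;> simp [I, h]
  have hV : (volume A * volume A * volume A) ^ (2 / 3 : ℝ) = volume A * volume A := by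
    rw [show volume A * volume A * volume A = volume A ^ (3 : ℝ) by
      rw [show (3 : ℝ) = (3 : ℕ) by norm_num, ENNReal.rpow_natCast]; ring,
      ← ENNReal.rpow_mul, show (3 * (2 / 3) : ℝ) = (2 : ℕ) by norm_num, ENNReal.rpow_natCast, sq]
  calc _ = ∫⁻ x, ∫⁻ y, I (s • x) * I (t • y) * I (x + y + z) := by
        rw [← lintegral_smul_sign hs]
        refine lintegral_congr fun x => ?_
        rw [← lintegral_smul_sign ht]
        simp only [smul_smul, hsq s hs, hsq t ht, one_smul]
    _ = ∫⁻ x, ∫⁻ y, (I (s • x) * I (t • y) * I (x + y + z)) ^ (2 / 3 : ℝ) := by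
        refine lintegral_congr fun x => lintegral_congr fun y => ?_
        rcases h01 (s • x) with h1 | h1 <;> rcases h01 (t • y) with h2 | h2 <;>
          rcases h01 (x + y + z) with h3 | h3 <;> simp [h1, h2, h3]
    _ ≤ ENNReal.ofReal (√3 / 2) ^ n * ((∫⁻ x, I (s • x)) * (∫⁻ y, I (t • y)) *
          ∫⁻ w, I (w + z)) ^ (2 / 3 : ℝ) :=
        young_pi n (f := fun x => I (s • x)) (g := fun y => I (t • y)) (k := fun w => I (w + z))
          (by fun_prop) (by fun_prop) (by fun_prop)
    _ = _ := by
        rw [lintegral_smul_sign hs, lintegral_smul_sign ht, lintegral_add_right_eq_self I z, hIA,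
          hV]

lemma volume_signed_sum_le {m n : ℕ} {A : Set (Fin n → ℝ)} (hA : MeasurableSet A)
    {ε : Fin m → ℝ} {i j : Fin m} (hij : i ≠ j) (hi : ε i = 1 ∨ ε i = -1)
    (hj : ε j = 1 ∨ ε j = -1) :
    volume {y : Fin m → Fin n → ℝ | (∀ l, y l ∈ A) ∧ ∑ l, ε l • y l ∈ A} ≤
      ENNReal.ofReal (√3 / 2) ^ n * volume A ^ m := by
  set I : (Fin n → ℝ) → ℝ≥0∞ := A.indicator 1 with hIdef
  have hI : Measurable I := measurable_one.indicator hA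
  have hIA : ∫⁻ x, I x = volume A := lintegral_indicator_one hA
  let Q : (Fin m → Fin n → ℝ) → ℝ≥0∞ := fun y => ∏ l, I (y l)
  let W : (Fin m → Fin n → ℝ) → ℝ≥0∞ := fun y => Q y * I (∑ l, ε l • y l)
  have hQm : Measurable Q := by
    refine Finset.measurable_prod _ fun l _ => hI.comp (measurable_pi_apply l)
  have hsm : Measurable fun y : Fin m → Fin n → ℝ => ∑ l, ε l • y l := by fun_prop
  have hWm : Measurable W := hQm.mul (hI.comp hsm)
  have hset : MeasurableSet {y : Fin m → Fin n → ℝ | (∀ l, y l ∈ A) ∧ ∑ l, ε l • y l ∈ A} := by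
    refine MeasurableSet.inter ?_ (hsm hA)
    have : {y : Fin m → Fin n → ℝ | ∀ l, y l ∈ A} = ⋂ l, (fun y => y l) ⁻¹' A := by
      ext; simp
    change MeasurableSet {y : Fin m → Fin n → ℝ | ∀ l, y l ∈ A}
    rw [this]
    exact MeasurableSet.iInter fun l => measurable_pi_apply l hA
  have h1 : volume {y : Fin m → Fin n → ℝ | (∀ l, y l ∈ A) ∧ ∑ l, ε l • y l ∈ A} =
      ∫⁻ y, W y := by
    rw [← lintegral_indicator_one hset]
    refine lintegral_congr fun y => ?_
    by_cases h : ∀ l, y l ∈ A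
    · have hQ : Q y = 1 := Finset.prod_eq_one fun l _ => by simp [I, h l]
      simp only [W, hQ, one_mul]
      by_cases h' : ∑ l, ε l • y l ∈ A
      · simp [I, h, h']
      · simp [I, h']
    · have hQ : Q y = 0 := by
        push Not at h
        obtain ⟨l, hl⟩ := h
        exact Finset.prod_eq_zero (Finset.mem_univ l) (by simp [I, hl])
      simp [W, hQ, h]
  have h2 : ∫⁻ y, Q y = volume A ^ m := by
    have hQi : Q = (Set.univ.pi fun _ => A).indicator 1 := by
      ext y
      by_cases h : ∀ l, y l ∈ A
      · rw [Set.indicator_of_mem (by simpa using h)]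
        exact Finset.prod_eq_one fun l _ => by simp [I, h l]
      · rw [Set.indicator_of_notMem (by simpa using h)]
        push Not at h
        obtain ⟨l, hl⟩ := h
        exact Finset.prod_eq_zero (Finset.mem_univ l) (by simp [I, hl])
    rw [hQi, lintegral_indicator_one (MeasurableSet.univ_pi fun _ => hA), volume_pi_pi]
    simp
  have hμ : (volume : Measure (Fin m → Fin n → ℝ)) = Measure.pi fun _ => volume := volume_pi
  rw [h1, ← h2, hμ]
  have hc : ENNReal.ofReal (√3 / 2) ^ n ≠ ∞ := ENNReal.pow_ne_top ENNReal.ofReal_ne_top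
  rw [← lintegral_const_mul' _ _ hc]
  have hpair : ∀ {F : (Fin m → Fin n → ℝ) → ℝ≥0∞}, Measurable F → ∀ x,
      (∫⋯∫⁻_{i, j}, F ∂(fun _ => volume)) x =
      ∫⁻ a, ∫⁻ b, F (Function.update (Function.update x i a) j b) := fun {F} hF x => by
    rw [lmarginal_insert F hF (by simpa using hij)]
    simp only [lmarginal_singleton]
  have hsplit : ∀ {F : (Fin m → Fin n → ℝ) → ℝ≥0∞}, Measurable F →
      ∫⁻ y, F y ∂(Measure.pi fun _ => volume) =
      (∫⋯∫⁻_({i, j} : Finset (Fin m))ᶜ, ∫⋯∫⁻_{i, j}, F ∂(fun _ => volume) ∂(fun _ => volume))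
        0 := fun {F} hF => by
    rw [lintegral_eq_lmarginal_univ (0 : Fin m → Fin n → ℝ), ← lmarginal_union _ _ hF
      disjoint_compl_left, Finset.union_comm, Finset.union_compl]
  rw [hsplit hWm, hsplit (hQm.const_mul _)]
  refine lmarginal_mono (fun x => ?_) 0
  rw [hpair hWm, hpair (hQm.const_mul _)]
  let P : ℝ≥0∞ := ∏ l ∈ ({i, j} : Finset (Fin m))ᶜ, I (x l)
  let z : Fin n → ℝ := ∑ l ∈ ({i, j} : Finset (Fin m))ᶜ, ε l • x l
  have hupd : ∀ a b : Fin n → ℝ, ∀ l ∈ ({i, j} : Finset (Fin m))ᶜ,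
      Function.update (Function.update x i a) j b l = x l := fun a b l hl => by
    simp only [Finset.mem_compl, Finset.mem_insert, Finset.mem_singleton, not_or] at hl
    rw [Function.update_of_ne hl.2, Function.update_of_ne hl.1]
  have hui : ∀ a b : Fin n → ℝ, Function.update (Function.update x i a) j b i = a := fun a b => by
    rw [Function.update_of_ne hij, Function.update_self]
  have huj : ∀ a b : Fin n → ℝ, Function.update (Function.update x i a) j b j = b := fun a b => by
    rw [Function.update_self]
  have hQu : ∀ a b, Q (Function.update (Function.update x i a) j b) = I a * I b * P :=
    fun a b => by
      simp only [Q]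
      rw [← Finset.prod_mul_prod_compl ({i, j} : Finset (Fin m)), Finset.prod_pair hij, hui, huj]
      congr 1
      exact Finset.prod_congr rfl fun l hl => by rw [hupd a b l hl]
  have hsu : ∀ a b, ∑ l, ε l • Function.update (Function.update x i a) j b l =
      ε i • a + ε j • b + z := fun a b => by
    rw [← Finset.sum_add_sum_compl ({i, j} : Finset (Fin m)), Finset.sum_pair hij, hui, huj]
    congr 1
    exact Finset.sum_congr rfl fun l hl => by rw [hupd a b l hl]
  have hP : P ≠ ∞ := ENNReal.prod_ne_top fun l _ => by
    by_cases h : x l ∈ A <;> simp [I, h]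
  calc ∫⁻ a, ∫⁻ b, W (Function.update (Function.update x i a) j b)
      = (∫⁻ a, ∫⁻ b, I a * I b * I (ε i • a + ε j • b + z)) * P := by
        rw [← lintegral_mul_const' _ _ hP]
        refine lintegral_congr fun a => ?_
        rw [← lintegral_mul_const' _ _ hP]
        refine lintegral_congr fun b => ?_
        simp only [W, hQu, hsu]
        ring
    _ ≤ ENNReal.ofReal (√3 / 2) ^ n * (volume A * volume A) * P := by
        gcongr
        exact lintegral_indicator_signed_le hA hi hj z
    _ = ∫⁻ a, ∫⁻ b, ENNReal.ofReal (√3 / 2) ^ n *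
          Q (Function.update (Function.update x i a) j b) := by
        simp only [hQu]
        have : ∀ a b, ENNReal.ofReal (√3 / 2) ^ n * (I a * I b * P) =
            I b * (ENNReal.ofReal (√3 / 2) ^ n * I a * P) := fun a b => by ring
        simp only [this]
        simp_rw [lintegral_mul_const _ hI, hIA]
        have : ∀ a, volume A * (ENNReal.ofReal (√3 / 2) ^ n * I a * P) =
            I a * (volume A * ENNReal.ofReal (√3 / 2) ^ n * P) := fun a => by ring
        simp only [this]
        rw [lintegral_mul_const _ hI, hIA]
        ring

/-- `D` is the basis matrix of a rational subspace, normalised to be the identity on a set of rows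
on which a maximal minor is attained. -/
structure IsReducedBasis {h m : ℕ} (D : Matrix (Fin h) (Fin m) ℝ) : Prop where
  exists_submatrix_eq_one : ∃ I : Fin m → Fin h, D.submatrix I id = 1
  abs_minor_le_one : ∀ J : Fin m → Fin h, |(D.submatrix J id).det| ≤ 1
  exists_smul_eq_map : ∃ (k : ℤ) (M : Matrix (Fin h) (Fin m) ℤ), k ≠ 0 ∧
    (k : ℝ) • D = M.map (Int.cast : ℤ → ℝ)

lemma submatrix_update_eq_updateRow {R : Type*} {h m : ℕ} {D : Matrix (Fin h) (Fin m) R}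
    (I : Fin m → Fin h) (i : Fin h) (j : Fin m) :
    D.submatrix (Function.update I j i) id = (D.submatrix I id).updateRow j (D i) := by
  ext a b
  by_cases hab : a = j
  · subst hab; simp
  · simp [hab]

lemma det_one_updateRow {R : Type*} [CommRing R] {m : ℕ} (j : Fin m) (v : Fin m → R) :
    ((1 : Matrix (Fin m) (Fin m) R).updateRow j v).det = v j := by
  rw [← Matrix.cramer_transpose_apply]
  simp

lemma IsReducedBasis.abs_apply_le_one {h m : ℕ} {D : Matrix (Fin h) (Fin m) ℝ}
    (hD : IsReducedBasis D) (i : Fin h) (j : Fin m) : |D i j| ≤ 1 := by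
  obtain ⟨I, hI⟩ := hD.exists_submatrix_eq_one
  have := hD.abs_minor_le_one (Function.update I j i)
  rwa [submatrix_update_eq_updateRow, hI, det_one_updateRow] at this

lemma injective_of_submatrix_eq_one {R : Type*} [CommRing R] [Nontrivial R] {h m : ℕ}
    {D : Matrix (Fin h) (Fin m) R}
    {I : Fin m → Fin h} (hI : D.submatrix I id = 1) : Function.Injective I := fun a b hab => by
  by_contra hne
  have h1 : D (I a) a = 1 := by simpa using congrFun (congrFun hI a) a
  have h2 : D (I b) a = 0 := by
    simpa [Matrix.one_apply_ne (Ne.symm hne)] using congrFun (congrFun hI b) a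
  rw [hab, h2] at h1
  exact zero_ne_one h1

lemma det_intCast_map {m : ℕ} (M : Matrix (Fin m) (Fin m) ℤ) :
    (M.map (Int.cast : ℤ → ℝ)).det = (M.det : ℝ) :=
  ((Int.castRingHom ℝ).map_det M).symm

/-- The column space of an integral matrix has a reduced basis. -/
lemma exists_isReducedBasis {h n m : ℕ} (X : Matrix (Fin h) (Fin n) ℤ)
    (hm : (X.map (Int.cast : ℤ → ℝ)).rank = m) :
    ∃ D : Matrix (Fin h) (Fin m) ℝ, IsReducedBasis D ∧
      LinearMap.range D.mulVecLin = LinearMap.range (X.map (Int.cast : ℤ → ℝ)).mulVecLin := by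
  set A := X.map (Int.cast : ℤ → ℝ) with hA
  rw [Matrix.rank_eq_finrank_span_cols] at hm
  have hex := Submodule.exists_fun_fin_finrank_span_eq ℝ (Set.range A.col)
  rw [hm] at hex
  obtain ⟨f, hf, hspan, hli⟩ := hex
  choose K hK using hf
  set Bz : Matrix (Fin h) (Fin m) ℤ := X.submatrix id K
  set B : Matrix (Fin h) (Fin m) ℝ := A.submatrix id K with hB
  have hBz : B = Bz.map (Int.cast : ℤ → ℝ) := rfl
  have hcol : B.col = f := funext fun j => hK j
  have hBr : LinearMap.range B.mulVecLin = LinearMap.range A.mulVecLin := by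
    rw [Matrix.range_mulVecLin, Matrix.range_mulVecLin, hcol, hspan]
  have hrow : LinearIndependent ℝ (Bᵀ).row := by
    change LinearIndependent ℝ B.col
    rwa [hcol]
  obtain ⟨I₀, hI₀⟩ := exists_submatrix_det_ne_zero hrow
  have hI₀' : (B.submatrix I₀ id).det ≠ 0 := by
    rwa [← Matrix.det_transpose]
  have : Nonempty (Fin m → Fin h) := ⟨I₀⟩
  obtain ⟨I, hI⟩ := Finite.exists_max fun J : Fin m → Fin h => |(B.submatrix J id).det|
  have hdet : 0 < |(B.submatrix I id).det| := (abs_pos.mpr hI₀').trans_le (hI I₀)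
  have hdet' : (B.submatrix I id).det ≠ 0 := abs_pos.mp hdet
  have hunit : IsUnit (B.submatrix I id).det := isUnit_iff_ne_zero.mpr hdet'
  have hsub : ∀ J : Fin m → Fin h, (B * (B.submatrix I id)⁻¹).submatrix J id =
      B.submatrix J id * (B.submatrix I id)⁻¹ := fun J => by
    rw [Matrix.submatrix_mul _ _ _ id _ Function.bijective_id, Matrix.submatrix_id_id]
  refine ⟨B * (B.submatrix I id)⁻¹, ⟨⟨I, ?_⟩, fun J => ?_, (Bz.submatrix I id).det,
    Bz * (Bz.submatrix I id).adjugate, ?_, ?_⟩, ?_⟩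
  · rw [hsub, Matrix.mul_nonsing_inv _ hunit]
  · rw [hsub, Matrix.det_mul, Matrix.det_nonsing_inv, Ring.inverse_eq_inv', abs_mul, abs_inv,
      ← div_eq_mul_inv]
    exact div_le_one_of_le₀ (hI J) (abs_nonneg _)
  · intro h0
    apply hdet'
    have := det_intCast_map (Bz.submatrix I id)
    rw [h0, Int.cast_zero] at this
    exact this
  · have h1 : ((Bz.submatrix I id).det : ℝ) = (B.submatrix I id).det :=
      (det_intCast_map _).symm
    have h2 : (Bz * (Bz.submatrix I id).adjugate).map (Int.cast : ℤ → ℝ) =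
        B * (B.submatrix I id).adjugate := by
      have e1 := Matrix.map_mul (L := Bz) (M := (Bz.submatrix I id).adjugate)
        (f := Int.castRingHom ℝ)
      have e2 := (Int.castRingHom ℝ).map_adjugate (Bz.submatrix I id)
      change _ = B * (((Int.castRingHom ℝ).mapMatrix (Bz.submatrix I id)).adjugate)
      rw [← e2]
      exact e1
    rw [h1, h2, Matrix.inv_def, Ring.inverse_eq_inv', Matrix.mul_smul, smul_smul,
      mul_inv_cancel₀ hdet', one_smul]
  · rw [← hBr, Matrix.mulVecLin_mul, LinearMap.range_comp_of_range_eq_top]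
    rw [LinearMap.range_eq_top]
    intro v
    refine ⟨B.submatrix I id *ᵥ v, ?_⟩
    simp [Matrix.nonsing_inv_mul _ hunit]

lemma exists_eq_mul_of_range_le {h m n : ℕ} {D : Matrix (Fin h) (Fin m) ℝ}
    {A : Matrix (Fin h) (Fin n) ℝ}
    (hr : LinearMap.range A.mulVecLin ≤ LinearMap.range D.mulVecLin) :
    ∃ Z : Matrix (Fin m) (Fin n) ℝ, A = D * Z := by
  have : ∀ j, ∃ z, D.mulVecLin z = A.col j := fun j =>
    hr ⟨Pi.single j 1, by simp⟩
  choose z hz using this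
  refine ⟨Matrix.of fun i j => z j i, ?_⟩
  ext i j
  have := congrFun (hz j) i
  simp only [Matrix.mulVecLin_apply, Matrix.col_apply] at this
  rw [← this]
  rfl

/-- A chosen reduced basis of a subspace (junk when there is none). -/
noncomputable def reducedBasis {h m : ℕ} (W : Submodule ℝ (Fin h → ℝ)) :
    Matrix (Fin h) (Fin m) ℝ :=
  Classical.epsilon fun D => IsReducedBasis D ∧ LinearMap.range D.mulVecLin = W

/-- The set of chosen reduced bases: one for each rational subspace of dimension `m`. -/
def ReducedBases (h m : ℕ) : Set (Matrix (Fin h) (Fin m) ℝ) :=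
  {D | IsReducedBasis D ∧ reducedBasis (LinearMap.range D.mulVecLin) = D}

lemma exists_mem_reducedBases {h n m : ℕ} (X : Matrix (Fin h) (Fin n) ℤ)
    (hm : (X.map (Int.cast : ℤ → ℝ)).rank = m) :
    ∃ D ∈ ReducedBases h m, ∃ Z : Matrix (Fin m) (Fin n) ℝ,
      X.map (Int.cast : ℤ → ℝ) = D * Z := by
  have h1 := Classical.epsilon_spec (exists_isReducedBasis X hm)
  change IsReducedBasis (reducedBasis _) ∧ LinearMap.range (reducedBasis _).mulVecLin = _ at h1
  refine ⟨_, ⟨h1.1, by rw [h1.2]⟩, exists_eq_mul_of_range_le h1.2.ge⟩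

lemma eq_of_range_eq_of_mem_reducedBases {h m : ℕ} {D D' : Matrix (Fin h) (Fin m) ℝ}
    (hD : D ∈ ReducedBases h m) (hD' : D' ∈ ReducedBases h m)
    (hr : LinearMap.range D.mulVecLin = LinearMap.range D'.mulVecLin) : D = D' := by
  rw [← hD.2, hr, hD'.2]

lemma countable_reducedBases (h m : ℕ) : (ReducedBases h m).Countable := by
  refine (Set.countable_range fun p : ℤ × (Fin h → Fin m → ℤ) =>
    ((p.1 : ℝ)⁻¹) • (Matrix.of p.2).map (Int.cast : ℤ → ℝ)).mono ?_
  rintro D ⟨hD, -⟩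
  obtain ⟨k, M, hk, hkM⟩ := hD.exists_smul_eq_map
  refine ⟨(k, M), ?_⟩
  change (k : ℝ)⁻¹ • M.map (Int.cast : ℤ → ℝ) = D
  rw [← hkM, smul_smul, inv_mul_cancel₀ (by exact_mod_cast hk), one_smul]

/-- The integral points of the column space of a rational matrix, in coordinates, form a
lattice. -/
lemma exists_integral_basis {h m : ℕ} {D : Matrix (Fin h) (Fin m) ℝ} (hD : IsReducedBasis D) :
    ∃ (P : Matrix (Fin m) (Fin m) ℤ) (C : Matrix (Fin h) (Fin m) ℤ), P.det ≠ 0 ∧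
      D * P.map (Int.cast : ℤ → ℝ) = C.map (Int.cast : ℤ → ℝ) ∧
      ∀ {n : ℕ} (Z : Matrix (Fin m) (Fin n) ℤ) (X : Matrix (Fin h) (Fin n) ℤ),
        D * Z.map (Int.cast : ℤ → ℝ) = X.map (Int.cast : ℤ → ℝ) →
          ∃ Y : Matrix (Fin m) (Fin n) ℤ, Z = P * Y := by
  obtain ⟨k, M, hk, hkM⟩ := hD.exists_smul_eq_map
  let Λ : Submodule ℤ (Fin m → ℤ) :=
    { carrier := {v | ∃ w : Fin h → ℤ, D *ᵥ (fun i => (v i : ℝ)) = fun i => (w i : ℝ)}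
      add_mem' := by
        rintro a b ⟨v, hv⟩ ⟨w, hw⟩
        refine ⟨v + w, ?_⟩
        have : (fun i => ((a + b) i : ℝ)) = (fun i => (a i : ℝ)) + fun i => (b i : ℝ) := by
          ext; simp
        rw [this, Matrix.mulVec_add, hv, hw]
        ext; simp
      zero_mem' := ⟨0, by
        have : (fun i : Fin m => ((0 : Fin m → ℤ) i : ℝ)) = 0 := by ext; simp
        rw [this, Matrix.mulVec_zero]
        ext; simp⟩
      smul_mem' := by
        rintro c a ⟨v, hv⟩
        refine ⟨c • v, ?_⟩
        have : (fun i => ((c • a) i : ℝ)) = (c : ℝ) • (fun i => (a i : ℝ)) := by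
          ext; simp
        rw [this, Matrix.mulVec_smul, hv]
        ext; simp }
  have hmem : ∀ v : Fin m → ℤ, k • v ∈ Λ := fun v => by
    refine ⟨M *ᵥ v, ?_⟩
    have : (fun i => ((k • v) i : ℝ)) = (k : ℝ) • (fun i => (v i : ℝ)) := by
      ext; simp
    rw [this, Matrix.mulVec_smul, ← Matrix.smul_mulVec, hkM]
    ext i
    simp [Matrix.mulVec, dotProduct]
  have hrank : Module.finrank ℤ Λ = m := by
    apply le_antisymm
    · simpa using Submodule.finrank_le Λ
    · let F : (Fin m → ℤ) →ₗ[ℤ] Λ :=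
        { toFun := fun v => ⟨k • v, hmem v⟩
          map_add' := fun a b => Subtype.ext (smul_add k a b)
          map_smul' := fun c a => Subtype.ext (smul_comm k c a) }
      have hF : Function.Injective F := fun a b hab => by
        have : k • a = k • b := congrArg Subtype.val hab
        exact smul_right_injective _ hk this
      simpa using LinearMap.finrank_le_finrank_of_injective hF
  let b := Module.finBasisOfFinrankEq ℤ Λ hrank
  choose w hw using fun j => (b j).2
  have hcomb : ∀ y : Fin m → ℤ, (Matrix.of fun i j => (b j).1 i) *ᵥ y = (∑ j, y j • b j : Λ).1 :=
    fun y => by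
      ext i
      simp [Matrix.mulVec, dotProduct, mul_comm]
  refine ⟨Matrix.of fun i j => (b j).1 i, Matrix.of fun i j => w j i, ?_, ?_, ?_⟩
  · intro h0
    obtain ⟨v, hv, hv0⟩ := Matrix.exists_mulVec_eq_zero_iff.mpr h0
    rw [hcomb] at hv0
    apply hv
    have := Fintype.linearIndependent_iff.mp b.linearIndependent v (Subtype.ext hv0)
    exact funext this
  · ext i j
    exact congrFun (hw j) i
  · intro n Z X hZX
    have hZ : ∀ j, (fun i => Z i j) ∈ Λ := fun j =>
      ⟨fun i => X i j, funext fun i => congrFun (congrFun hZX i) j⟩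
    refine ⟨Matrix.of fun i j => b.repr ⟨_, hZ j⟩ i, ?_⟩
    ext i j
    have h1 := hcomb fun i => b.repr ⟨_, hZ j⟩ i
    rw [b.sum_repr] at h1
    exact (congrFun h1 i).symm

/-- The tuple of linear combinations of the vectors `y` with coefficients the rows of `C`. -/
def combine {h m n : ℕ} {R : Type*} [CommRing R] (C : Matrix (Fin h) (Fin m) R)
    (y : Fin m → Fin n → R) : Fin h → Fin n → R := fun i => ∑ j, C i j • y j

lemma combine_eq_mul {h m n : ℕ} {R : Type*} [CommRing R] (C : Matrix (Fin h) (Fin m) R)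
    (y : Fin m → Fin n → R) : combine C y = C * (Matrix.of y) := by
  ext i j
  simp [combine, Matrix.mul_apply]

lemma combine_mul {h l m n : ℕ} {R : Type*} [CommRing R] (C : Matrix (Fin h) (Fin l) R)
    (P : Matrix (Fin l) (Fin m) R) (y : Fin m → Fin n → R) :
    combine (C * P) y = combine C (combine P y) := by
  rw [combine_eq_mul, combine_eq_mul, combine_eq_mul P, Matrix.mul_assoc]
  rfl

lemma combine_rowMul {h m n : ℕ} {R : Type*} [CommRing R] (C : Matrix (Fin h) (Fin m) R)
    (y : Fin m → Fin n → R) (g : Matrix (Fin n) (Fin n) R) :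
    combine C (rowMul y g) = rowMul (combine C y) g := by
  have h1 : combine C (rowMul y g) = C * (Matrix.of y * g) := combine_eq_mul C _
  have h2 : rowMul (combine C y) g = (C * Matrix.of y : Matrix (Fin h) (Fin n) R) * g := by
    rw [combine_eq_mul]
    rfl
  rw [h1, h2, Matrix.mul_assoc]

lemma intTuple_mul {h m n : ℕ} (C : Matrix (Fin h) (Fin m) ℤ) (Y : Matrix (Fin m) (Fin n) ℤ) :
    intTuple (C * Y) = combine (C.map (Int.cast : ℤ → ℝ)) (intTuple Y) := by
  ext i j
  simp [intTuple, combine, Matrix.mul_apply]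

lemma measurable_combine {h m n : ℕ} (C : Matrix (Fin h) (Fin m) ℝ) :
    Measurable (combine C : (Fin m → Fin n → ℝ) → _) := by
  unfold combine
  fun_prop

lemma volume_preimage_combine {m n : ℕ} {P : Matrix (Fin m) (Fin m) ℝ} (hP : P.det ≠ 0)
    (s : Set (Fin m → Fin n → ℝ)) :
    volume (combine P ⁻¹' s) = ENNReal.ofReal (|P.det|⁻¹ ^ n) * volume s := by
  let L : (Fin m → Fin n → ℝ) →ₗ[ℝ] (Fin m → Fin n → ℝ) :=
    { toFun := combine P
      map_add' := fun x y => by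
        funext i
        simp [combine, smul_add, Finset.sum_add_distrib]
      map_smul' := fun c x => by
        funext i
        simp [combine, Finset.smul_sum, smul_comm c] }
  let e : (Fin m → Fin n → ℝ) ≃ₗ[ℝ] (Fin n → Fin m → ℝ) :=
    { toFun := fun y j i => y i j
      invFun := fun y i j => y j i
      map_add' := fun _ _ => rfl
      map_smul' := fun _ _ => rfl }
  have hdet : LinearMap.det L = P.det ^ n := by
    rw [← LinearMap.det_conj L e]
    have : (e : (Fin m → Fin n → ℝ) →ₗ[ℝ] _) ∘ₗ L ∘ₗ (e.symm : (Fin n → Fin m → ℝ) →ₗ[ℝ] _) =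
        LinearMap.pi fun j => (Matrix.toLin' P).comp (LinearMap.proj j) := by
      refine LinearMap.ext fun y => funext fun j => funext fun i => ?_
      simp [e, L, combine, Matrix.mulVec, dotProduct]
    rw [this, LinearMap.det_pi]
    simp
  have hL : LinearMap.det L ≠ 0 := by rw [hdet]; exact pow_ne_zero _ hP
  have := Measure.addHaar_preimage_linearMap (volume : Measure (Fin m → Fin n → ℝ)) hL s
  rw [hdet, abs_inv, abs_pow, ← inv_pow] at this
  exact this

/-- A basis `P` of the lattice of integral points in the coordinates given by a reduced basis `D`,
together with the integral matrix `D * P`. -/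
noncomputable def integralBasis {h m : ℕ} (D : Matrix (Fin h) (Fin m) ℝ) :
    Matrix (Fin m) (Fin m) ℤ × Matrix (Fin h) (Fin m) ℤ :=
  Classical.epsilon fun B => B.1.det ≠ 0 ∧
    D * B.1.map (Int.cast : ℤ → ℝ) = B.2.map (Int.cast : ℤ → ℝ) ∧
    ∀ {n : ℕ} (Z : Matrix (Fin m) (Fin n) ℤ) (X : Matrix (Fin h) (Fin n) ℤ),
      D * Z.map (Int.cast : ℤ → ℝ) = X.map (Int.cast : ℤ → ℝ) →
        ∃ Y : Matrix (Fin m) (Fin n) ℤ, Z = B.1 * Y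

lemma integralBasis_spec {h m : ℕ} {D : Matrix (Fin h) (Fin m) ℝ} (hD : IsReducedBasis D) :
    (integralBasis D).1.det ≠ 0 ∧
    D * (integralBasis D).1.map (Int.cast : ℤ → ℝ) = (integralBasis D).2.map (Int.cast : ℤ → ℝ) ∧
    ∀ {n : ℕ} (Z : Matrix (Fin m) (Fin n) ℤ) (X : Matrix (Fin h) (Fin n) ℤ),
      D * Z.map (Int.cast : ℤ → ℝ) = X.map (Int.cast : ℤ → ℝ) →
        ∃ Y : Matrix (Fin m) (Fin n) ℤ, Z = (integralBasis D).1 * Y := by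
  obtain ⟨P, C, hPC⟩ := exists_integral_basis hD
  exact Classical.epsilon_spec (p := fun B : Matrix (Fin m) (Fin m) ℤ × Matrix (Fin h) (Fin m) ℤ =>
    B.1.det ≠ 0 ∧ D * B.1.map (Int.cast : ℤ → ℝ) = B.2.map (Int.cast : ℤ → ℝ) ∧
    ∀ {n : ℕ} (Z : Matrix (Fin m) (Fin n) ℤ) (X : Matrix (Fin h) (Fin n) ℤ),
      D * Z.map (Int.cast : ℤ → ℝ) = X.map (Int.cast : ℤ → ℝ) →
        ∃ Y : Matrix (Fin m) (Fin n) ℤ, Z = B.1 * Y) ⟨(P, C), hPC⟩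

/-- A linearly dependent integral tuple factors through an independent one. -/
lemma exists_eq_integralBasis_mul {h n : ℕ} (X : Fin h → Fin n → ℤ)
    (hX : ¬ LinearIndependent ℝ (intTuple X)) :
    ∃ (m : Fin h) (D : ReducedBases h m) (Y : IndepTuple m n),
      X = (integralBasis D.1).2 * (Matrix.of Y.1 : Matrix (Fin m) (Fin n) ℤ) := by
  set A : Matrix (Fin h) (Fin n) ℝ := (Matrix.of X).map (Int.cast : ℤ → ℝ) with hA
  have hrank : A.rank < h := by
    refine lt_of_le_of_ne (by simpa using A.rank_le_height) fun heq => hX ?_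
    have : LinearIndependent ℝ A.row := by
      rw [linearIndependent_iff_card_eq_finrank_span, Set.finrank, ← A.rank_eq_finrank_span_row,
        heq, Fintype.card_fin]
    exact this
  obtain ⟨D, hD, Z, hZ⟩ := exists_mem_reducedBases (Matrix.of X) (m := A.rank) rfl
  obtain ⟨I, hI⟩ := hD.1.exists_submatrix_eq_one
  have hZI : Z = ((Matrix.of X).submatrix I id).map (Int.cast : ℤ → ℝ) := by
    have h1 := congrArg (fun M : Matrix (Fin h) (Fin n) ℝ => M.submatrix I id) hZ
    rw [Matrix.submatrix_mul _ _ _ id _ Function.bijective_id, hI, Matrix.submatrix_id_id,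
      Matrix.one_mul] at h1
    rw [← h1]
    rfl
  obtain ⟨-, h2, h3⟩ := integralBasis_spec hD.1
  obtain ⟨Y, hY⟩ := h3 _ (Matrix.of X) (by rw [← hZI, ← hZ])
  have hmap : ∀ {a b c : ℕ} (M : Matrix (Fin a) (Fin b) ℤ) (N : Matrix (Fin b) (Fin c) ℤ),
      (M * N).map (Int.cast : ℤ → ℝ) = M.map (Int.cast : ℤ → ℝ) * N.map (Int.cast : ℤ → ℝ) :=
    fun M N => Matrix.map_mul (f := Int.castRingHom ℝ)
  have hXC : (Matrix.of X).map (Int.cast : ℤ → ℝ) =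
      ((integralBasis D).2 * Y).map (Int.cast : ℤ → ℝ) := by
    rw [hZ, hZI, hY, hmap, hmap, ← h2, Matrix.mul_assoc]
  have hYr : LinearIndependent ℝ (Y.map (Int.cast : ℤ → ℝ)).row := by
    rw [linearIndependent_iff_card_eq_finrank_span, Set.finrank, ← Matrix.rank_eq_finrank_span_row,
      Fintype.card_fin]
    refine le_antisymm ?_ (by simpa using Matrix.rank_le_height (Y.map (Int.cast : ℤ → ℝ)))
    calc A.rank = ((integralBasis D).2.map (Int.cast : ℤ → ℝ) * Y.map (Int.cast : ℤ → ℝ)).rank :=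
          congrArg Matrix.rank (hXC.trans (hmap _ _))
      _ ≤ _ := Matrix.rank_mul_le_right _ _
  refine ⟨⟨A.rank, hrank⟩, ⟨D, hD⟩, ⟨Y, hYr⟩, ?_⟩
  ext i j
  have := congrFun (congrFun hXC i) j
  simp only [Matrix.map_apply] at this
  exact_mod_cast this

lemma tsum_dependent_le {h n : ℕ} (u : (Fin h → Fin n → ℝ) → ℝ≥0∞)
    (g : Matrix (Fin n) (Fin n) ℝ) :
    ∑' X : {X : Fin h → Fin n → ℤ // ¬ LinearIndependent ℝ (intTuple X)},
      u (rowMul (intTuple X.1) g) ≤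
    ∑ m : Fin h, ∑' D : ReducedBases h m, ∑' Y : IndepTuple m n,
      u (combine ((integralBasis D.1).2.map (Int.cast : ℤ → ℝ)) (rowMul (intTuple Y.1) g)) := by
  choose m D Y hXY using fun X : {X : Fin h → Fin n → ℤ // ¬ LinearIndependent ℝ (intTuple X)} =>
    exists_eq_integralBasis_mul X.1 X.2
  let F : (Σ m : Fin h, ReducedBases h m × IndepTuple m n) → ℝ≥0∞ := fun p =>
    u (combine ((integralBasis p.2.1.1).2.map (Int.cast : ℤ → ℝ)) (rowMul (intTuple p.2.2.1) g))
  let E : {X : Fin h → Fin n → ℤ // ¬ LinearIndependent ℝ (intTuple X)} →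
      Σ m : Fin h, ReducedBases h m × IndepTuple m n := fun X => ⟨m X, D X, Y X⟩
  let X' : (Σ m : Fin h, ReducedBases h m × IndepTuple m n) → Fin h → Fin n → ℤ := fun p =>
    (integralBasis p.2.1.1).2 * (Matrix.of p.2.2.1 : Matrix (Fin p.1) (Fin n) ℤ)
  have hX' : ∀ X, X' (E X) = X.1 := fun X => (hXY X).symm
  have hE : Function.Injective E := fun a b hab => Subtype.ext (by rw [← hX', ← hX', hab])
  calc _ = ∑' X, F (E X) := tsum_congr fun X => by
        simp only [F, E]
        rw [combine_rowMul]
        congr 2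
        conv_lhs => rw [hXY X]
        exact intTuple_mul _ _
    _ ≤ ∑' p, F p := ENNReal.tsum_comp_le_tsum_of_injective hE F
    _ = _ := by
        rw [ENNReal.tsum_sigma', tsum_fintype]
        refine Finset.sum_congr rfl fun m _ => ?_
        rw [ENNReal.tsum_prod']

lemma abs_apply_le_one_of_minors {h m : ℕ} {C : Matrix (Fin h) (Fin m) ℤ} {I : Fin m → Fin h}
    (hI : C.submatrix I id = 1) (hC : ∀ J : Fin m → Fin h, |(C.submatrix J id).det| ≤ 1)
    (i : Fin h) (j : Fin m) : |C i j| ≤ 1 := by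
  have := hC (Function.update I j i)
  rwa [submatrix_update_eq_updateRow, hI, det_one_updateRow] at this

/-- Integral matrices with all maximal minors in `{0, 1, -1}` have the same column space as soon as
their reductions modulo `3` do. -/
lemma exists_eq_mul_of_modThree {h m : ℕ} {C C' : Matrix (Fin h) (Fin m) ℤ}
    {I' : Fin m → Fin h} (hI' : C'.submatrix I' id = 1)
    (hC : ∀ J : Fin m → Fin h, |(C.submatrix J id).det| ≤ 1)
    (hC' : ∀ J : Fin m → Fin h, |(C'.submatrix J id).det| ≤ 1)
    {R R' : Matrix (Fin m) (Fin m) (ZMod 3)} (hR' : IsUnit R'.det)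
    (heq : C.map (Int.castRingHom (ZMod 3)) * R = C'.map (Int.castRingHom (ZMod 3)) * R') :
    ∃ S : Matrix (Fin m) (Fin m) ℤ, IsUnit S.det ∧ C' = C * S := by
  set r := Int.castRingHom (ZMod 3)
  set T := C.submatrix I' id with hT
  have hTR : T.map r * R = R' := by
    have h1 := congrArg (fun M : Matrix (Fin h) (Fin m) (ZMod 3) => M.submatrix I' id) heq
    rw [Matrix.submatrix_mul _ _ _ id _ Function.bijective_id,
      Matrix.submatrix_mul _ _ _ id _ Function.bijective_id, Matrix.submatrix_id_id,
      Matrix.submatrix_id_id, Matrix.submatrix_map, Matrix.submatrix_map, hI',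
      Matrix.map_one _ (map_zero r) (map_one r), Matrix.one_mul] at h1
    exact h1
  have hT0 : T.det ≠ 0 := fun h0 => by
    have h1 : (T.map r).det = 0 := by
      have := r.map_det T
      rw [h0, map_zero] at this
      exact this.symm
    rw [← hTR, Matrix.det_mul, h1, zero_mul] at hR'
    exact not_isUnit_zero hR'
  have hTu : IsUnit T.det := by
    rw [Int.isUnit_iff]
    have h1 := abs_le.mp (hC I')
    change -1 ≤ T.det ∧ T.det ≤ 1 at h1
    omega
  have hSu : IsUnit (T⁻¹).det := Matrix.isUnit_nonsing_inv_det _ hTu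
  refine ⟨T⁻¹, hSu, ?_⟩
  set E := C * T⁻¹ with hE
  have hsub : ∀ J : Fin m → Fin h, E.submatrix J id = C.submatrix J id * T⁻¹ := fun J => by
    rw [hE, Matrix.submatrix_mul _ _ _ id _ Function.bijective_id, Matrix.submatrix_id_id]
  have hEI : E.submatrix I' id = 1 := by rw [hsub, ← hT, Matrix.mul_nonsing_inv _ hTu]
  have hEm : ∀ J : Fin m → Fin h, |(E.submatrix J id).det| ≤ 1 := fun J => by
    rw [hsub, Matrix.det_mul, abs_mul]
    have : |(T⁻¹).det| = 1 := Int.isUnit_iff_abs_eq.mp hSu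
    rw [this, mul_one]
    exact hC J
  have hCE : C = E * T := by
    rw [hE, Matrix.mul_assoc, Matrix.nonsing_inv_mul _ hTu, Matrix.mul_one]
  have hmod : E.map r = C'.map r := by
    have h1 : E.map r * R' = C'.map r * R' := by
      rw [← heq, ← hTR, ← Matrix.mul_assoc, ← Matrix.map_mul, ← hCE]
    have h2 := congrArg (· * R'⁻¹) h1
    simpa [Matrix.mul_assoc, Matrix.mul_nonsing_inv _ hR'] using h2
  ext i j
  have h1 := abs_le.mp (abs_apply_le_one_of_minors hEI hEm i j)
  have h2 := abs_le.mp (abs_apply_le_one_of_minors hI' hC' i j)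
  have h3 : ((C' i j : ℤ) : ZMod 3) = (E i j : ℤ) := (congrFun (congrFun hmod i) j).symm
  have h4 := (ZMod.intCast_eq_intCast_iff _ _ 3).mp h3
  have h5 : (C' i j) % 3 = (E i j) % 3 := h4
  omega

lemma two_mul_prod_ge (m : ℕ) :
    3 ^ (m * m) ≤ 2 * ∏ i : Fin m, (3 ^ m - 3 ^ (i : ℕ)) := by
  have key : ∀ k : ℕ, k ≤ m → (3 : ℤ) ^ (m * k) * (2 * 3 ^ m - 3 ^ k) ≤
      2 * 3 ^ m * ∏ i ∈ Finset.range k, ((3 : ℤ) ^ m - 3 ^ i) := by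
    intro k hk
    induction k with
    | zero => simp
    | succ k ih =>
      have ih := ih (by omega)
      have hlt : (3 : ℤ) ^ k ≤ 3 ^ m := pow_le_pow_right₀ (by norm_num) (by omega)
      rw [Finset.prod_range_succ]
      have h1 : (0 : ℤ) ≤ 3 ^ m - 3 ^ k := by linarith
      have h2 := mul_le_mul_of_nonneg_right ih h1
      have hp : (0 : ℤ) < 3 ^ (m * k) := by positivity
      have hk0 : (0 : ℤ) < 3 ^ k := by positivity
      calc (3 : ℤ) ^ (m * (k + 1)) * (2 * 3 ^ m - 3 ^ (k + 1))
          = 3 ^ (m * k) * (3 ^ m * (2 * 3 ^ m - 3 * 3 ^ k)) := by ring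
        _ ≤ 3 ^ (m * k) * ((2 * 3 ^ m - 3 ^ k) * (3 ^ m - 3 ^ k)) := by
            refine mul_le_mul_of_nonneg_left ?_ hp.le
            nlinarith [sq_nonneg ((3 : ℤ) ^ k)]
        _ ≤ _ := by linarith
  have h1 := key m le_rfl
  have h2 : (3 : ℤ) ^ (m * m) ≤ 2 * ∏ i ∈ Finset.range m, ((3 : ℤ) ^ m - 3 ^ i) := by
    have hp : (0 : ℤ) < 3 ^ m := by positivity
    have : (3 : ℤ) ^ m * 3 ^ (m * m) ≤
        3 ^ m * (2 * ∏ i ∈ Finset.range m, ((3 : ℤ) ^ m - 3 ^ i)) := by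
      linarith
    exact le_of_mul_le_mul_left this hp
  rw [← Finset.prod_range fun i => 3 ^ m - 3 ^ i]
  zify
  rw [Finset.prod_congr rfl fun i hi => Nat.cast_sub
    (pow_le_pow_right₀ (by norm_num) (Finset.mem_range.mp hi).le)]
  push_cast
  exact h2

/-- The index of the lattice of integral points in the coordinates given by `D`. -/
noncomputable def integralIndex {h m : ℕ} (D : Matrix (Fin h) (Fin m) ℝ) : ℕ :=
  (integralBasis D).1.det.natAbs

lemma integralIndex_pos {h m : ℕ} {D : Matrix (Fin h) (Fin m) ℝ} (hD : IsReducedBasis D) :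
    0 < integralIndex D :=
  Int.natAbs_pos.mpr (integralBasis_spec hD).1

lemma exists_integralIndex_smul_eq_map {h m : ℕ} {D : Matrix (Fin h) (Fin m) ℝ}
    (hD : IsReducedBasis D) : ∃ M : Matrix (Fin h) (Fin m) ℤ,
      ∀ i j, (integralIndex D : ℝ) * D i j = M i j := by
  obtain ⟨h1, h2, -⟩ := integralBasis_spec hD
  set P := (integralBasis D).1
  set C := (integralBasis D).2
  have hdet : (P.det : ℝ) • D = (C * P.adjugate).map (Int.cast : ℤ → ℝ) := by
    have e1 := Matrix.map_mul (L := C) (M := P.adjugate) (f := Int.castRingHom ℝ)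
    have e2 := (Int.castRingHom ℝ).map_adjugate P
    have e3 : (P.det : ℝ) = (P.map (Int.cast : ℤ → ℝ)).det := (det_intCast_map P).symm
    have e4 : P.adjugate.map (Int.cast : ℤ → ℝ) = (P.map (Int.cast : ℤ → ℝ)).adjugate := e2
    have e5 : (C * P.adjugate).map (Int.cast : ℤ → ℝ) =
        C.map (Int.cast : ℤ → ℝ) * P.adjugate.map (Int.cast : ℤ → ℝ) := e1
    rw [e5, e4, ← h2, Matrix.mul_assoc, Matrix.mul_adjugate, e3, Matrix.mul_smul, Matrix.mul_one]
  have hnat : (integralIndex D : ℝ) = |(P.det : ℝ)| := by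
    rw [integralIndex, Nat.cast_natAbs, Int.cast_abs]
  rcases abs_choice (P.det : ℝ) with h | h
  · refine ⟨C * P.adjugate, fun i j => ?_⟩
    rw [hnat, h]
    exact congrFun (congrFun hdet i) j
  · refine ⟨-(C * P.adjugate), fun i j => ?_⟩
    rw [hnat, h, neg_mul, Matrix.neg_apply, Int.cast_neg]
    exact congrArg Neg.neg (congrFun (congrFun hdet i) j)

lemma tsum_integralIndex_eq_one_le {h m : ℕ} (hm : m ≤ h) (c : ℝ≥0∞) :
    ∑' _ : {D : ReducedBases h m | integralIndex D.1 = 1}, c ≤ 2 * 3 ^ (m * (h - m)) * c := by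
  have : Fact (Nat.Prime 3) := ⟨Nat.prime_three⟩
  set s := {D : ReducedBases h m | integralIndex D.1 = 1}
  have hex : ∀ D : s, ∃ M : Matrix (Fin h) (Fin m) ℤ, D.1.1 = M.map (Int.cast : ℤ → ℝ) :=
    fun D => by
      obtain ⟨M, hM⟩ := exists_integralIndex_smul_eq_map D.1.2.1
      refine ⟨M, ?_⟩
      ext i j
      have h1 := hM i j
      rwa [show integralIndex D.1.1 = 1 from D.2, Nat.cast_one, one_mul] at h1
  choose M hM using hex
  have hone : ∀ D : s, ∃ I : Fin m → Fin h, (M D).submatrix I id = 1 := fun D => by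
    obtain ⟨I, hI⟩ := D.1.2.1.exists_submatrix_eq_one
    refine ⟨I, ?_⟩
    ext i j
    have h1 := congrFun (congrFun hI i) j
    rw [hM D] at h1
    simp only [Matrix.submatrix_apply, Matrix.map_apply, Matrix.one_apply] at h1 ⊢
    split_ifs at h1 ⊢ <;> exact_mod_cast h1
  have hminor : ∀ (D : s) (J : Fin m → Fin h), |((M D).submatrix J id).det| ≤ 1 := fun D J => by
    have h1 := D.1.2.1.abs_minor_le_one J
    rw [hM D, Matrix.submatrix_map, det_intCast_map] at h1
    exact_mod_cast h1
  let F : s × GL (Fin m) (ZMod 3) → Matrix (Fin h) (Fin m) (ZMod 3) := fun p =>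
    (M p.1).map (Int.castRingHom (ZMod 3)) * p.2.1
  have hF : Function.Injective F := by
    rintro ⟨D, R⟩ ⟨D', R'⟩ hDR
    change (M D).map _ * R.1 = (M D').map _ * R'.1 at hDR
    have hRu : IsUnit R'.1.det := (Matrix.isUnit_iff_isUnit_det _).mp R'.isUnit
    obtain ⟨I', hI'⟩ := hone D'
    obtain ⟨S, hS, hCS⟩ := exists_eq_mul_of_modThree hI' (hminor D) (hminor D') hRu hDR
    have hDD : D = D' := by
      refine Subtype.ext (Subtype.ext ?_)
      refine eq_of_range_eq_of_mem_reducedBases D.1.2 D'.1.2 ?_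
      have h1 : D'.1.1 = D.1.1 * S.map (Int.cast : ℤ → ℝ) := by
        rw [hM D', hM D, hCS]
        exact Matrix.map_mul (f := Int.castRingHom ℝ)
      have hSu : IsUnit (S.map (Int.cast : ℤ → ℝ)).det := by
        rw [det_intCast_map]
        exact hS.map (Int.castRingHom ℝ)
      rw [h1, Matrix.mulVecLin_mul, LinearMap.range_comp_of_range_eq_top]
      rw [LinearMap.range_eq_top]
      intro v
      refine ⟨(S.map (Int.cast : ℤ → ℝ))⁻¹ *ᵥ v, ?_⟩
      simp [Matrix.mul_nonsing_inv _ hSu]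
    subst hDD
    have hRR : R.1 = R'.1 := by
      have h1 := congrArg (fun N : Matrix (Fin h) (Fin m) (ZMod 3) => N.submatrix I' id) hDR
      rw [Matrix.submatrix_mul _ _ _ id _ Function.bijective_id,
        Matrix.submatrix_mul _ _ _ id _ Function.bijective_id, Matrix.submatrix_id_id,
        Matrix.submatrix_id_id, Matrix.submatrix_map, hI',
        Matrix.map_one _ (map_zero _) (map_one _), Matrix.one_mul, Matrix.one_mul] at h1
      exact h1
    rw [Units.ext hRR]
  have hcard : ∑' _ : s × GL (Fin m) (ZMod 3), c ≤ 3 ^ (h * m) * c := by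
    calc _ ≤ ∑' _ : Fin h → Fin m → ZMod 3, c :=
          ENNReal.tsum_comp_le_tsum_of_injective (f := fun p => (F p : Fin h → Fin m → ZMod 3)) hF
            fun _ => c
      _ = _ := by
          rw [tsum_fintype, Finset.sum_const, Finset.card_univ, nsmul_eq_mul]
          congr 1
          simp [← pow_mul, mul_comm]
  set G : ℕ := Nat.card (GL (Fin m) (ZMod 3)) with hG
  have hGpos : 0 < G := Nat.card_pos
  have hGle : 3 ^ (m * m) ≤ 2 * G := by
    rw [hG, Matrix.card_GL_field, ZMod.card]
    exact two_mul_prod_ge m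
  have hprod : ∑' _ : s × GL (Fin m) (ZMod 3), c = (∑' _ : s, c) * G := by
    rw [ENNReal.tsum_prod', ← ENNReal.tsum_mul_right]
    refine tsum_congr fun _ => ?_
    rw [tsum_fintype, Finset.sum_const, Finset.card_univ, nsmul_eq_mul, hG,
      Nat.card_eq_fintype_card, mul_comm]
  rw [hprod] at hcard
  have hG0 : (G : ℝ≥0∞) ≠ 0 := by exact_mod_cast hGpos.ne'
  rw [← ENNReal.mul_le_mul_iff_left hG0 (ENNReal.natCast_ne_top G)]
  refine hcard.trans ?_
  have h3 : (3 : ℝ≥0∞) ^ (m * m) ≤ 2 * G := by exact_mod_cast hGle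
  calc (3 : ℝ≥0∞) ^ (h * m) * c = 3 ^ (m * (h - m)) * 3 ^ (m * m) * c := by
        rw [← pow_add, ← mul_add, Nat.sub_add_cancel hm, mul_comm h m]
    _ ≤ 3 ^ (m * (h - m)) * (2 * G) * c := by gcongr
    _ = _ := by ring

lemma tsum_integralIndex_ne_one_le {h m : ℕ} (w : ℕ → ℝ≥0∞) :
    ∑' D : ↑({D : ReducedBases h m | integralIndex D.1 = 1}ᶜ), w (integralIndex D.1.1) ≤
      h ^ m * ∑' d : ℕ, (2 * (d + 2 : ℝ≥0∞) + 1) ^ (m * (h - m)) * w (d + 2) := by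
  set s := {D : ReducedBases h m | integralIndex D.1 = 1}ᶜ
  choose M hM using fun D : s => exists_integralIndex_smul_eq_map D.1.2.1
  choose I hI using fun D : s => D.1.2.1.exists_submatrix_eq_one
  have hIinj : ∀ D, Function.Injective (I D) := fun D => injective_of_submatrix_eq_one (hI D)
  have hd : ∀ D : s, integralIndex D.1.1 = integralIndex D.1.1 - 2 + 2 := fun D => by
    have h1 := integralIndex_pos D.1.2.1
    have h2 : integralIndex D.1.1 ≠ 1 := D.2
    omega
  have hbound : ∀ (D : s) i j, M D i j ∈ Finset.Icc (-(integralIndex D.1.1 : ℤ))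
      (integralIndex D.1.1 : ℤ) := fun D i j => by
    have h1 := D.1.2.1.abs_apply_le_one i j
    have h2 : |(M D i j : ℝ)| ≤ integralIndex D.1.1 := by
      rw [← hM D, abs_mul, Nat.abs_cast]
      exact mul_le_of_le_one_right (Nat.cast_nonneg _) h1
    rw [Finset.mem_Icc, ← abs_le]
    exact_mod_cast h2
  let K : Type := Σ d : ℕ, Σ I : Fin m ↪ Fin h, ({i : Fin h // i ∉ Set.range I} → Fin m →
    Finset.Icc (-((d + 2 : ℕ) : ℤ)) ((d + 2 : ℕ) : ℤ))
  let E : s → K := fun D => ⟨integralIndex D.1.1 - 2, ⟨I D, hIinj D⟩, fun i j =>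
    ⟨M D i.1 j, by rw [← hd]; exact hbound D i.1 j⟩⟩
  have hE : Function.Injective E := by
    let D' : K → Matrix (Fin h) (Fin m) ℝ := fun k => Matrix.of fun i j =>
      if hi : i ∉ Set.range k.2.1 then (((k.2.2 ⟨i, hi⟩ j : ℤ) : ℝ)) / ((k.1 + 2 : ℕ) : ℝ) else
        if i = k.2.1 j then 1 else 0
    have hD' : ∀ D, D' (E D) = D.1.1 := fun D => by
      ext i j
      by_cases hi : i ∉ Set.range (I D)
      · have h1 : D' (E D) i j = (M D i j : ℝ) / ((integralIndex D.1.1 - 2 + 2 : ℕ) : ℝ) :=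
          dif_pos hi
        have h2 : (integralIndex D.1.1 : ℝ) ≠ 0 := by
          exact_mod_cast (integralIndex_pos D.1.2.1).ne'
        rw [h1, ← hd, ← hM, mul_div_cancel_left₀ _ h2]
      · have h1 : D' (E D) i j = if i = I D j then 1 else 0 := dif_neg hi
        rw [h1]
        obtain ⟨k, rfl⟩ := not_not.mp hi
        have h2 := congrFun (congrFun (hI D) k) j
        simp only [Matrix.submatrix_apply, id, Matrix.one_apply] at h2
        rw [h2]
        simp [(hIinj D).eq_iff]
    exact fun D₁ D₂ h => Subtype.ext (Subtype.ext (by rw [← hD', ← hD', h]))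
  calc _ = ∑' D : s, (fun k : K => w (k.1 + 2)) (E D) := tsum_congr fun D => by
        simp only [E]
        rw [← hd]
    _ ≤ ∑' k : K, w (k.1 + 2) := ENNReal.tsum_comp_le_tsum_of_injective hE fun k : K => w (k.1 + 2)
    _ ≤ _ := by
      rw [ENNReal.tsum_sigma', ← ENNReal.tsum_mul_left]
      refine ENNReal.tsum_le_tsum fun d => ?_
      simp only []
      rw [ENNReal.tsum_sigma', tsum_fintype]
      have hcard : ∀ I : Fin m ↪ Fin h, Fintype.card ({i : Fin h // i ∉ Set.range I} → Fin m →
          Finset.Icc (-((d + 2 : ℕ) : ℤ)) ((d + 2 : ℕ) : ℤ)) =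
          (2 * (d + 2) + 1) ^ (m * (h - m)) := fun I => by
        have h1 : Fintype.card {i : Fin h // i ∉ Set.range I} = h - m := by
          rw [Fintype.card_subtype_compl, Fintype.card_fin]
          congr 1
          have := Fintype.card_congr (Equiv.ofInjective I I.injective)
          rw [Fintype.card_fin] at this
          exact this.symm
        rw [Fintype.card_fun, Fintype.card_fun, h1, Fintype.card_coe, Int.card_Icc,
          Fintype.card_fin, ← pow_mul]
        congr 1
        omega
      have hemb : Fintype.card (Fin m ↪ Fin h) ≤ h ^ m := by
        rw [Fintype.card_embedding_eq, Fintype.card_fin, Fintype.card_fin]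
        exact Nat.descFactorial_le_pow _ _
      calc _ = ∑ _ : Fin m ↪ Fin h, ((2 * (d + 2 : ℝ≥0∞) + 1) ^ (m * (h - m)) * w (d + 2)) := by
            refine Finset.sum_congr rfl fun I _ => ?_
            rw [tsum_fintype, Finset.sum_const, Finset.card_univ, nsmul_eq_mul, hcard]
            push_cast
            rfl
        _ ≤ _ := by
            rw [Finset.sum_const, Finset.card_univ, nsmul_eq_mul]
            gcongr
            exact_mod_cast hemb

/-- The `h`-tuples of distinct elements of `A`. -/
def injTuples {n : ℕ} (h : ℕ) (A : Set (Fin n → ℝ)) : Set (Fin h → Fin n → ℝ) :=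
  {x | (∀ i, x i ∈ A) ∧ Function.Injective x}

lemma measurableSet_injTuples {n : ℕ} (h : ℕ) {A : Set (Fin n → ℝ)} (hA : MeasurableSet A) :
    MeasurableSet (injTuples h A) := by
  have h1 : injTuples h A = (⋂ i, (fun x : Fin h → Fin n → ℝ => x i) ⁻¹' A) ∩
      ⋂ i, ⋂ j, ⋂ (_ : i ≠ j), {x : Fin h → Fin n → ℝ | x i = x j}ᶜ := by
    ext x
    simp only [injTuples, Set.mem_inter_iff, Set.mem_iInter, Set.mem_preimage, Set.mem_compl_iff]
    refine and_congr Iff.rfl ⟨fun hx i j hij h => hij (hx h), fun hx i j h => ?_⟩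
    by_contra hij
    exact hx i j hij h
  rw [h1]
  refine (MeasurableSet.iInter fun i => measurable_pi_apply i hA).inter
    (MeasurableSet.iInter fun i => MeasurableSet.iInter fun j => MeasurableSet.iInter fun _ =>
      (measurableSet_eq_fun (measurable_pi_apply i) (measurable_pi_apply j)).compl)

lemma combine_apply_of_submatrix_eq_one {h m n : ℕ} {D : Matrix (Fin h) (Fin m) ℝ}
    {I : Fin m → Fin h} (hI : D.submatrix I id = 1) (y : Fin m → Fin n → ℝ) (j : Fin m) :
    combine D y (I j) = y j := by
  have h1 : ∀ k, D (I j) k = (1 : Matrix (Fin m) (Fin m) ℝ) j k := fun k =>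
    congrFun (congrFun hI j) k
  simp [combine, h1, Matrix.one_apply]

lemma volume_combine_injTuples_le {h m n : ℕ} {D : Matrix (Fin h) (Fin m) ℝ}
    (hD : IsReducedBasis D) (A : Set (Fin n → ℝ)) :
    volume (combine D ⁻¹' injTuples h A) ≤ volume A ^ m := by
  obtain ⟨I, hI⟩ := hD.exists_submatrix_eq_one
  calc _ ≤ volume (Set.univ.pi fun _ : Fin m => A) := measure_mono fun y hy => by
        rw [Set.mem_univ_pi]
        intro j
        rw [← combine_apply_of_submatrix_eq_one hI y j]
        exact hy.1 (I j)
    _ = _ := by rw [volume_pi_pi]; simp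

lemma volume_combine_injTuples_le_of_integral {h m n : ℕ} {D : Matrix (Fin h) (Fin m) ℝ}
    (hm : m < h) (hD : IsReducedBasis D) (hint : ∀ i j, D i j = 0 ∨ D i j = 1 ∨ D i j = -1)
    {A : Set (Fin n → ℝ)} (hA : MeasurableSet A) (h0 : 0 ∉ A) (hneg : ∀ x ∈ A, -x ∉ A) :
    volume (combine D ⁻¹' injTuples h A) ≤ ENNReal.ofReal (√3 / 2) ^ n * volume A ^ m := by
  obtain ⟨I, hI⟩ := hD.exists_submatrix_eq_one
  obtain ⟨i, hi⟩ : ∃ i, i ∉ Set.range I := by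
    by_contra hcon
    push Not at hcon
    have := Fintype.card_le_of_surjective I fun i => hcon i
    simp only [Fintype.card_fin] at this
    omega
  by_cases h2 : ∃ j k, j ≠ k ∧ D i j ≠ 0 ∧ D i k ≠ 0
  · obtain ⟨j, k, hjk, hj, hk⟩ := h2
    refine (measure_mono fun y hy => ?_).trans (volume_signed_sum_le hA (ε := D i) hjk
      ((hint i j).resolve_left hj) ((hint i k).resolve_left hk))
    refine ⟨fun l => ?_, hy.1 i⟩
    rw [← combine_apply_of_submatrix_eq_one hI y l]
    exact hy.1 (I l)
  · have hempty : combine D ⁻¹' injTuples h A = (∅ : Set (Fin m → Fin n → ℝ)) := by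
      refine Set.eq_empty_of_forall_notMem fun y hy => ?_
      have hyi := hy.1 i
      by_cases h1 : ∃ j, D i j ≠ 0
      · obtain ⟨j, hj⟩ := h1
        have hsum : combine D y i = D i j • y j := by
          refine Finset.sum_eq_single j (fun k _ hk => ?_) fun hj' => absurd (Finset.mem_univ j) hj'
          have : D i k = 0 := by
            by_contra hk0
            exact h2 ⟨j, k, hk.symm, hj, hk0⟩
          rw [this, zero_smul]
        have hIj := combine_apply_of_submatrix_eq_one hI y j
        rcases (hint i j).resolve_left hj with h | h
        · rw [h, one_smul, ← hIj] at hsum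
          exact hi ⟨j, (hy.2 hsum).symm⟩
        · rw [hsum, h, neg_smul, one_smul] at hyi
          refine hneg _ ?_ hyi
          rw [← hIj]
          exact hy.1 (I j)
      · push Not at h1
        have : combine D y i = 0 := Finset.sum_eq_zero fun j _ => by rw [h1 j, zero_smul]
        rw [this] at hyi
        exact h0 hyi
    rw [hempty, measure_empty]
    exact zero_le

lemma volume_integralBasis_preimage {h m n : ℕ} {D : Matrix (Fin h) (Fin m) ℝ}
    (hD : IsReducedBasis D) (Q : Set (Fin h → Fin n → ℝ)) :
    volume (combine ((integralBasis D).2.map (Int.cast : ℤ → ℝ)) ⁻¹' Q) =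
      ENNReal.ofReal ((integralIndex D : ℝ)⁻¹ ^ n) * volume (combine D ⁻¹' Q) := by
  obtain ⟨h1, h2, -⟩ := integralBasis_spec hD
  have hdet : ((integralBasis D).1.map (Int.cast : ℤ → ℝ)).det ≠ 0 := by
    rw [det_intCast_map]
    exact_mod_cast h1
  have hpre : combine ((integralBasis D).2.map (Int.cast : ℤ → ℝ)) ⁻¹' Q =
      combine ((integralBasis D).1.map (Int.cast : ℤ → ℝ)) ⁻¹' (combine D ⁻¹' Q) := by
    ext y
    simp only [Set.mem_preimage]
    rw [← h2, combine_mul]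
  rw [hpre, volume_preimage_combine hdet, det_intCast_map, integralIndex, Nat.cast_natAbs,
    Int.cast_abs]

lemma IsReducedBasis.apply_of_integralIndex_eq_one {h m : ℕ} {D : Matrix (Fin h) (Fin m) ℝ}
    (hD : IsReducedBasis D) (h1 : integralIndex D = 1) (i : Fin h) (j : Fin m) :
    D i j = 0 ∨ D i j = 1 ∨ D i j = -1 := by
  obtain ⟨M, hM⟩ := exists_integralIndex_smul_eq_map hD
  have h2 := hM i j
  rw [h1, Nat.cast_one, one_mul] at h2
  have h3 := hD.abs_apply_le_one i j
  rw [h2] at h3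
  have h4 : |M i j| ≤ 1 := by exact_mod_cast h3
  have h5 : M i j = 0 ∨ M i j = 1 ∨ M i j = -1 := by
    have := abs_le.mp h4
    omega
  rw [h2]
  rcases h5 with h | h | h <;> rw [h] <;> simp

lemma tsum_volume_integralBasis_le {h m n : ℕ} (hm : m < h) {A : Set (Fin n → ℝ)}
    (hA : MeasurableSet A) (h0 : 0 ∉ A) (hneg : ∀ x ∈ A, -x ∉ A) :
    ∑' D : ReducedBases h m,
      volume (combine ((integralBasis D.1).2.map (Int.cast : ℤ → ℝ)) ⁻¹' injTuples h A) ≤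
    (2 * 3 ^ (m * (h - m)) * ENNReal.ofReal (√3 / 2) ^ n + h ^ m * ∑' d : ℕ,
      (2 * (d + 2 : ℝ≥0∞) + 1) ^ (m * (h - m)) * ENNReal.ofReal (((d + 2 : ℕ) : ℝ)⁻¹ ^ n)) *
      volume A ^ m := by
  rw [← Summable.tsum_add_tsum_compl (s := {D : ReducedBases h m | integralIndex D.1 = 1})
    ENNReal.summable ENNReal.summable, add_mul]
  refine add_le_add ?_ ?_
  · calc _ ≤ ∑' _ : {D : ReducedBases h m | integralIndex D.1 = 1},
          ENNReal.ofReal (√3 / 2) ^ n * volume A ^ m := ENNReal.tsum_le_tsum fun D => by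
          rw [volume_integralBasis_preimage D.1.2.1, show integralIndex D.1.1 = 1 from D.2]
          simp only [Nat.cast_one, inv_one, one_pow, ENNReal.ofReal_one, one_mul]
          exact volume_combine_injTuples_le_of_integral hm D.1.2.1
            (D.1.2.1.apply_of_integralIndex_eq_one D.2) hA h0 hneg
      _ ≤ _ := (tsum_integralIndex_eq_one_le hm.le _).trans (by rw [mul_assoc, mul_assoc, mul_assoc])
  · calc _ ≤ ∑' D : ↑({D : ReducedBases h m | integralIndex D.1 = 1}ᶜ),
          (fun d : ℕ => ENNReal.ofReal ((d : ℝ)⁻¹ ^ n) * volume A ^ m) (integralIndex D.1.1) :=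
          ENNReal.tsum_le_tsum fun D => by
            rw [volume_integralBasis_preimage D.1.2.1]
            exact mul_le_mul_right (volume_combine_injTuples_le D.1.2.1 A) _
      _ ≤ _ := tsum_integralIndex_ne_one_le
          fun d : ℕ => ENNReal.ofReal ((d : ℝ)⁻¹ ^ n) * volume A ^ m
      _ = _ := by
          rw [mul_assoc, ← ENNReal.tsum_mul_right]
          simp only [mul_assoc]

lemma three_pow_mul_le {n k : ℕ} (hk : 8 * k ≤ n) :
    3 ^ k * (√3 / 2) ^ n * (1 + 0.005 * n) ≤ (0.999 : ℝ) ^ n := by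
  have hs : (√3 / 2 : ℝ) ^ 8 = (3 / 4) ^ 4 := by
    rw [show (√3 / 2 : ℝ) ^ 8 = (√3 ^ 2) ^ 4 / 256 by ring, Real.sq_sqrt (by norm_num)]
    norm_num
  have hb : 1 + 0.005 * (n : ℝ) ≤ 1.005 ^ n := by
    have := one_add_mul_le_pow (a := (0.005 : ℝ)) (by norm_num) n
    rw [show (1.005 : ℝ) = 1 + 0.005 by norm_num]
    linarith
  refine le_of_pow_le_pow_left₀ (n := 8) (by norm_num) (by positivity) ?_
  calc ((3 : ℝ) ^ k * (√3 / 2) ^ n * (1 + 0.005 * n)) ^ 8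
      ≤ (3 ^ k * (√3 / 2) ^ n * 1.005 ^ n) ^ 8 := by gcongr
    _ = 3 ^ (8 * k) * ((√3 / 2) ^ 8) ^ n * (1.005 ^ 8) ^ n := by
        simp only [mul_pow, ← pow_mul, mul_comm 8]
    _ ≤ 3 ^ n * ((√3 / 2) ^ 8) ^ n * (1.005 ^ 8) ^ n := by
        gcongr
        norm_num
    _ = (3 * (3 / 4) ^ 4 * 1.005 ^ 8) ^ n := by rw [hs, mul_pow, mul_pow]
    _ ≤ (0.999 ^ 8) ^ n := by
        gcongr
        norm_num
    _ = (0.999 ^ n) ^ 8 := by rw [← pow_mul, ← pow_mul, mul_comm]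

lemma tsum_two_mul_add_one_pow_le {n k : ℕ} (hk : 3 * k + 2 ≤ n) :
    ∑' d : ℕ, (2 * (d + 2 : ℝ≥0∞) + 1) ^ k * ENNReal.ofReal (((d + 2 : ℕ) : ℝ)⁻¹ ^ n) ≤
      ENNReal.ofReal (4 * (1 / 2) ^ (n - 3 * k)) := by
  obtain ⟨s, rfl⟩ := Nat.exists_eq_add_of_le hk
  rw [show 3 * k + 2 + s - 3 * k = s + 2 by omega]
  have hterm : ∀ d : ℕ, (2 * (d + 2 : ℝ≥0∞) + 1) ^ k *
      ENNReal.ofReal (((d + 2 : ℕ) : ℝ)⁻¹ ^ (3 * k + 2 + s)) ≤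
      ENNReal.ofReal (4 * (1 / 2) ^ (s + 2) * (1 / (d + 1 : ℝ) - 1 / ((d + 1 : ℕ) + 1 : ℝ))) :=
    fun d => by
    have h1 : (2 * (d + 2 : ℝ≥0∞) + 1) ^ k = ENNReal.ofReal ((2 * (d + 2) + 1 : ℝ) ^ k) := by
      rw [ENNReal.ofReal_pow (by positivity)]
      congr 1
      rw [show (2 * (d + 2) + 1 : ℝ) = ((2 * (d + 2) + 1 : ℕ) : ℝ) by push_cast; ring,
        ENNReal.ofReal_natCast]
      push_cast
      ring
    rw [h1, ← ENNReal.ofReal_mul (by positivity)]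
    apply ENNReal.ofReal_le_ofReal
    push_cast
    have hd : (0 : ℝ) ≤ d := Nat.cast_nonneg d
    set x : ℝ := (d : ℝ) + 2 with hx
    have hx2 : 2 ≤ x := by linarith
    have hx0 : x ≠ 0 := by positivity
    have h3 : (2 * x + 1) ^ k ≤ x ^ (3 * k) := by
      rw [pow_mul]
      gcongr
      nlinarith [mul_nonneg (sub_nonneg.mpr hx2) (sub_nonneg.mpr hx2)]
    calc (2 * x + 1) ^ k * x⁻¹ ^ (3 * k + 2 + s)
        ≤ x ^ (3 * k) * x⁻¹ ^ (3 * k + 2 + s) := by gcongr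
      _ = (x⁻¹ ^ 2) * x⁻¹ ^ s := by
          rw [pow_add, pow_add, ← mul_assoc, ← mul_assoc, ← mul_pow, mul_inv_cancel₀ hx0, one_pow,
            one_mul]
      _ ≤ (1 / (d + 1) - 1 / x) * (1 / 2) ^ s := by
          have hdiff : 1 / ((d : ℝ) + 1) - 1 / x = 1 / ((d + 1) * x) := by
            field_simp
            linarith
          rw [hdiff, inv_pow, ← one_div, ← one_div]
          gcongr
          nlinarith
      _ = 4 * (1 / 2) ^ (s + 2) * (1 / (d + 1) - 1 / (d + 1 + 1)) := by
          rw [show (d : ℝ) + 1 + 1 = x by rw [hx]; ring]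
          ring
  refine ENNReal.tsum_le_of_sum_range_le fun N => (Finset.sum_le_sum fun d _ => hterm d).trans ?_
  rw [← ENNReal.ofReal_sum_of_nonneg]
  · apply ENNReal.ofReal_le_ofReal
    rw [← Finset.mul_sum]
    refine mul_le_of_le_one_right (by positivity) ?_
    have := Finset.sum_range_sub' (fun d : ℕ => 1 / ((d : ℝ) + 1)) N
    rw [this]
    have : 0 ≤ 1 / ((N : ℝ) + 1) := by positivity
    simp only [Nat.cast_zero, zero_add, div_one]
    linarith
  · intro d _
    refine mul_nonneg (by positivity) (sub_nonneg.mpr ?_)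
    apply one_div_le_one_div_of_le (by positivity)
    push_cast
    linarith

lemma pow_mul_half_pow_le {n h m k : ℕ} (hh : 2 * h ^ 2 ≤ n) (hm : m < h) (hk : 4 * k ≤ h ^ 2) :
    (h : ℝ) * (h ^ m * (1 / 2) ^ (n - 3 * k)) ≤ 0.999 ^ n := by
  have h1 : (h : ℝ) * h ^ m ≤ 2 ^ (h ^ 2) := by
    have h2 : h * h ^ m ≤ 2 ^ (h ^ 2) := by
      calc h * h ^ m = h ^ (m + 1) := by ring
        _ ≤ h ^ h := Nat.pow_le_pow_right (by omega) hm
        _ ≤ (2 ^ h) ^ h := Nat.pow_le_pow_left Nat.lt_two_pow_self.le _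
        _ = _ := by rw [← pow_mul, sq]
    exact_mod_cast h2
  obtain ⟨t, ht⟩ := Nat.exists_eq_add_of_le (show h ^ 2 ≤ n - 3 * k by omega)
  have ht8 : n ≤ 8 * t := by omega
  calc (h : ℝ) * (h ^ m * (1 / 2) ^ (n - 3 * k)) = h * h ^ m * (1 / 2) ^ (h ^ 2 + t) := by
        rw [ht]; ring
    _ ≤ 2 ^ (h ^ 2) * (1 / 2) ^ (h ^ 2 + t) := by gcongr
    _ = (1 / 2) ^ t := by
        rw [pow_add, ← mul_assoc, ← mul_pow]
        norm_num
    _ ≤ (0.999 ^ 8) ^ t := by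
        gcongr
        norm_num
    _ = 0.999 ^ (8 * t) := by rw [← pow_mul]
    _ ≤ 0.999 ^ n := pow_le_pow_of_le_one (by norm_num) (by norm_num) ht8

lemma four_mul_mul_sub_le (h m : ℕ) : 4 * (m * (h - m)) ≤ h ^ 2 := by
  rcases le_total h m with hm | hm
  · simp [Nat.sub_eq_zero_of_le hm]
  · obtain ⟨l, rfl⟩ := Nat.exists_eq_add_of_le hm
    rw [Nat.add_sub_cancel_left]
    zify
    nlinarith [sq_nonneg ((m : ℤ) - l)]

lemma error_coefficient_le {n h m : ℕ} (hn : 2 ≤ n) (hh : 2 * h ^ 2 ≤ n) (hm : m < h) :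
    h * (2 * 3 ^ (m * (h - m)) * ENNReal.ofReal (√3 / 2) ^ n + h ^ m * ∑' d : ℕ,
      (2 * (d + 2 : ℝ≥0∞) + 1) ^ (m * (h - m)) * ENNReal.ofReal (((d + 2 : ℕ) : ℝ)⁻¹ ^ n)) ≤
    ENNReal.ofReal (23 * 0.999 ^ n) := by
  set k := m * (h - m) with hk
  have h4 : 4 * k ≤ h ^ 2 := four_mul_mul_sub_le h m
  have hp : (0 : ℝ) ≤ 0.999 ^ n := by positivity
  have hfirst : (h : ℝ) * (2 * 3 ^ k * (√3 / 2) ^ n) ≤ 10 * 0.999 ^ n := by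
    have h1 := three_pow_mul_le (n := n) (k := k) (by omega)
    have hn' : 2 * (h : ℝ) ^ 2 ≤ n := by exact_mod_cast hh
    have h2 : (2 * h : ℝ) ≤ 10 * (1 + 0.005 * n) := by nlinarith [sq_nonneg ((h : ℝ) - 10)]
    have h0 : (0 : ℝ) ≤ 3 ^ k * (√3 / 2) ^ n := by positivity
    nlinarith [mul_le_mul_of_nonneg_left h2 h0]
  have hsecond := pow_mul_half_pow_le hh hm h4
  calc _ ≤ (h : ℝ≥0∞) * (2 * 3 ^ k * ENNReal.ofReal (√3 / 2) ^ n +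
        h ^ m * ENNReal.ofReal (4 * (1 / 2) ^ (n - 3 * k))) := by
        gcongr
        exact tsum_two_mul_add_one_pow_le (by omega)
    _ = ENNReal.ofReal (h * (2 * 3 ^ k * (√3 / 2) ^ n + h ^ m * (4 * (1 / 2) ^ (n - 3 * k)))) := by
        rw [ENNReal.ofReal_mul (p := (h : ℝ)) (by positivity),
          ENNReal.ofReal_add (by positivity) (by positivity),
          ENNReal.ofReal_mul (p := 2 * 3 ^ k) (by positivity),
          ENNReal.ofReal_mul (p := (2 : ℝ)) (by positivity),
          ENNReal.ofReal_mul (p := (h : ℝ) ^ m) (by positivity), ENNReal.ofReal_pow (by positivity),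
          ENNReal.ofReal_pow (by positivity), ENNReal.ofReal_pow (by positivity),
          ENNReal.ofReal_natCast]
        norm_num
    _ ≤ _ := by
        apply ENNReal.ofReal_le_ofReal
        linarith

lemma zero_notMem_posHalf {n : ℕ} (S : Set (Fin n → ℝ)) : (0 : Fin n → ℝ) ∉ posHalf n S := by
  rintro ⟨-, i, hi, -⟩
  exact lt_irrefl _ hi

lemma neg_notMem_posHalf {n : ℕ} {S : Set (Fin n → ℝ)} {x : Fin n → ℝ} (hx : x ∈ posHalf n S) :
    -x ∉ posHalf n S := by
  obtain ⟨-, i, hi, hi0⟩ := hx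
  rintro ⟨-, j, hj, hj0⟩
  simp only [Pi.neg_apply, neg_eq_zero] at hj hj0
  rcases lt_trichotomy i j with hij | rfl | hij
  · exact hi.ne' (hj0 i hij)
  · linarith
  · rw [hi0 j hij] at hj
    simp at hj

lemma measurableSet_posHalf {n : ℕ} {S : Set (Fin n → ℝ)} (hS : MeasurableSet S) :
    MeasurableSet (posHalf n S) := by
  have h : posHalf n S = S ∩ ⋃ i, ({x | 0 < x i} ∩ ⋂ j, ⋂ (_ : j < i), {x | x j = 0}) := by
    ext x
    simp [posHalf]
  rw [h]
  refine hS.inter (MeasurableSet.iUnion fun i => ?_)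
  refine (measurableSet_lt measurable_const (measurable_pi_apply i)).inter ?_
  exact MeasurableSet.iInter fun j => MeasurableSet.iInter fun _ =>
    measurableSet_eq_fun (measurable_pi_apply j) measurable_const

lemma diff_singleton_zero_eq_posHalf_union {n : ℕ} {S : Set (Fin n → ℝ)}
    (hS : ∀ x, x ∈ S ↔ -x ∈ S) : S \ {0} = posHalf n S ∪ Neg.neg ⁻¹' posHalf n S := by
  ext x
  constructor
  · rintro ⟨hxS, hx0⟩
    have hex : ∃ i, x i ≠ 0 := Function.ne_iff.mp hx0
    obtain ⟨i, hi, hmin⟩ := WellFounded.has_min (wellFounded_lt (α := Fin n)) {i | x i ≠ 0} hex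
    have hlt : ∀ j < i, x j = 0 := fun j hj => by
      by_contra h
      exact hmin j h hj
    rcases lt_or_gt_of_ne hi with h | h
    · exact Or.inr ⟨(hS x).mp hxS, i, by simpa using h, fun j hj => by simp [hlt j hj]⟩
    · exact Or.inl ⟨hxS, i, h, hlt⟩
  · rintro (hx | hx)
    · exact ⟨hx.1, fun h => zero_notMem_posHalf S (h ▸ hx)⟩
    · refine ⟨(hS x).mpr hx.1, ?_⟩
      rintro rfl
      exact zero_notMem_posHalf S (by simpa using hx)

lemma volume_posHalf {n : ℕ} (hn : n ≠ 0) {S : Set (Fin n → ℝ)} (hS : MeasurableSet S)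
    (hsymm : ∀ x, x ∈ S ↔ -x ∈ S) {V : ℝ} (hV : volume S = ENNReal.ofReal V) :
    volume (posHalf n S) = ENNReal.ofReal (V / 2) := by
  have : NeZero n := ⟨hn⟩
  have h1 : volume (S \ {0}) = 2 * volume (posHalf n S) := by
    rw [diff_singleton_zero_eq_posHalf_union hsymm, measure_union, Measure.measure_preimage_neg,
      two_mul]
    · exact Set.disjoint_left.mpr fun x hx => neg_notMem_posHalf hx
    · exact measurable_neg (measurableSet_posHalf hS)
  rw [measure_sdiff_null (measure_singleton 0), hV] at h1
  rw [ENNReal.ofReal_div_of_pos two_pos, h1, mul_comm]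
  simp [ENNReal.mul_div_cancel_right]

lemma volume_injTuples {n h : ℕ} (hhn : h ≤ n) (A : Set (Fin n → ℝ)) :
    volume (injTuples h A) = volume A ^ h := by
  have h1 : injTuples h A =ᵐ[volume] Set.univ.pi fun _ : Fin h => A := by
    filter_upwards [ae_linearIndependent hhn] with x hx
    refine propext ⟨fun h i _ => h.1 i, fun h => ⟨fun i => h i trivial, hx.injective⟩⟩
  rw [measure_congr h1, volume_pi_pi]
  simp

/-- Injective `h`-tuples in `T` are `h`-element subsets of `T` together with an ordering. -/
lemma card_injective_tuples {α : Type*} (T : Set α) (h : ℕ) :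
    Nat.card {x : Fin h → α // (∀ i, x i ∈ T) ∧ Function.Injective x} =
      (h)! * Nat.card {t : Finset α // ↑t ⊆ T ∧ t.card = h} := by
  let e (t : {t : Finset α // ↑t ⊆ T ∧ t.card = h}) : Fin h ≃ t.1 :=
    (t.1.equivFinOfCardEq t.2.2).symm
  let F : {t : Finset α // ↑t ⊆ T ∧ t.card = h} × Equiv.Perm (Fin h) →
      {x : Fin h → α // (∀ i, x i ∈ T) ∧ Function.Injective x} := fun p =>
    ⟨fun i => (e p.1 (p.2 i)).1, fun i => p.1.2.1 (e p.1 (p.2 i)).2,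
      Subtype.val_injective.comp ((e p.1).injective.comp p.2.injective)⟩
  have hmem : ∀ p a, a ∈ p.1.1 ↔ ∃ i, (F p).1 i = a := fun p a => by
    refine ⟨fun ha => ⟨p.2.symm ((e p.1).symm ⟨a, ha⟩), by simp [F]⟩, ?_⟩
    rintro ⟨i, rfl⟩
    exact (e p.1 (p.2 i)).2
  have hF : Function.Bijective F := by
    constructor
    · rintro ⟨t, σ⟩ ⟨t', σ'⟩ hp
      obtain rfl : t = t' := Subtype.ext (Finset.ext fun a => by
        rw [hmem (t, σ), hmem (t', σ'), hp])
      refine Prod.ext rfl (Equiv.ext fun i => (e t).injective (Subtype.ext ?_))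
      exact congrFun (congrArg Subtype.val hp) i
    · rintro ⟨x, hxT, hx⟩
      let t : {t : Finset α // ↑t ⊆ T ∧ t.card = h} :=
        ⟨Finset.univ.image x, by simpa [Set.subset_def] using hxT, by
          rw [Finset.card_image_of_injective _ hx, Finset.card_fin]⟩
      have hxt : ∀ i, x i ∈ t.1 := fun i => Finset.mem_image_of_mem x (Finset.mem_univ i)
      have hσ : Function.Injective fun i => (e t).symm ⟨x i, hxt i⟩ := fun i j hij =>
        hx (congrArg Subtype.val ((e t).symm.injective hij))
      refine ⟨(t, Equiv.ofBijective _ (Finite.injective_iff_bijective.mp hσ)), Subtype.ext ?_⟩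
      funext i
      simp [F]
  rw [← Nat.card_congr (Equiv.ofBijective F hF), Nat.card_prod, mul_comm, Nat.card_perm]
  simp

/-- The number of integral tuples moved by `g` to an injective tuple in `A`. -/
noncomputable def tupleCount {n : ℕ} (h : ℕ) (A : Set (Fin n → ℝ)) (g : SLR n) : ℝ≥0∞ :=
  ∑' X : Fin h → Fin n → ℤ, (injTuples h A).indicator 1 (rowMul (intTuple X) g.1)

lemma measurable_tupleCount {n : ℕ} (h : ℕ) {A : Set (Fin n → ℝ)} (hA : MeasurableSet A) :
    Measurable (tupleCount h A) := by
  refine Measurable.tsum fun X => ?_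
  exact (measurable_one.indicator (measurableSet_injTuples h hA)).comp (measurable_rowMul_SLR _)

lemma rowMul_SLR_injective {m n : ℕ} (g : SLR n) :
    Function.Injective fun x : Fin m → Fin n → ℝ => rowMul x g.1 := fun x y hxy => by
  have hg : g.1 * g.1⁻¹ = 1 := Matrix.mul_nonsing_inv _ (by rw [g.2]; exact isUnit_one)
  have := congrArg (fun z => rowMul z g.1⁻¹) hxy
  simpa only [← rowMul_mul, hg, rowMul_one] using this

lemma toReal_tupleCount {n : ℕ} (h : ℕ) (S : Set (Fin n → ℝ)) (g : SLR n) :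
    (tupleCount h (posHalf n S) g).toReal = (h)! * rhoSub n S h g := by
  let s : Set (Fin h → Fin n → ℤ) := {X | rowMul (intTuple X) g.1 ∈ injTuples h (posHalf n S)}
  have h1 : tupleCount h (posHalf n S) g = s.encard := by
    rw [← ENNReal.tsum_set_one, tsum_subtype s fun _ => (1 : ℝ≥0∞)]
    rfl
  let G : s → {x : Fin h → Fin n → ℝ // (∀ i, x i ∈ latticeOf n g ∩ posHalf n S) ∧
      Function.Injective x} := fun X =>
    ⟨rowMul (intTuple X.1) g.1, fun i => ⟨⟨X.1 i, rfl⟩, X.2.1 i⟩, X.2.2⟩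
  have hG : Function.Bijective G := by
    constructor
    · intro X Y hXY
      exact Subtype.ext (intTuple_injective (rowMul_SLR_injective g (congrArg Subtype.val hXY)))
    · rintro ⟨x, hx, hinj⟩
      choose X hX using fun i => (hx i).1
      have hX' : rowMul (intTuple X) g.1 = x := funext hX
      exact ⟨⟨X, by rw [← hX'] at hx hinj; exact ⟨fun i => (hx i).2, hinj⟩⟩, Subtype.ext hX'⟩
  have h2 : s.ncard = (h)! * rhoSub n S h g := by
    rw [← Nat.card_coe_set_eq, Nat.card_congr (Equiv.ofBijective G hG), card_injective_tuples]
    rfl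
  rw [h1, ← Nat.cast_mul, ← h2, Set.ncard]
  rcases eq_or_ne s.encard ⊤ with h | h
  · simp [h]
  · lift s.encard to ℕ using h with k
    simp

/-- The sum of `u` over linearly independent `m`-tuples of lattice vectors. -/
noncomputable def indepSum {m n : ℕ} (u : (Fin m → Fin n → ℝ) → ℝ≥0∞) : LatSpace n → ℝ≥0∞ :=
  latDescend fun g => ∑' X : IndepTuple m n, u (rowMul (intTuple X.1) g.1)

lemma indepSum_latMk {m n : ℕ} (u : (Fin m → Fin n → ℝ) → ℝ≥0∞) (g : SLR n) :
    indepSum u (latMk n g) = ∑' X : IndepTuple m n, u (rowMul (intTuple X.1) g.1) :=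
  latDescend_latMk (tsum_indepTuple_intSL_mul u) g

lemma measurable_indepSum {m n : ℕ} {u : (Fin m → Fin n → ℝ) → ℝ≥0∞} (hu : Measurable u) :
    Measurable (indepSum u) :=
  measurable_latDescend (tsum_indepTuple_intSL_mul u)
    (Measurable.tsum fun _ => hu.comp (measurable_rowMul_SLR _))

lemma lintegral_indepSum {m n : ℕ} (hmn : m < n) {μ : Measure (LatSpace n)}
    [IsProbabilityMeasure μ] (hμ : ∀ a, μ.map (rTranslate n a) = μ)
    {u : (Fin m → Fin n → ℝ) → ℝ≥0∞} (hu : Measurable u) :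
    ∫⁻ x, indepSum u x ∂μ = ∫⁻ y, u y :=
  lintegral_tsum_indepTuple hmn hμ hu (indepSum_latMk u)

/-- An upper bound for the number of linearly dependent injective tuples in `A`. -/
noncomputable def dependentBound {n : ℕ} (h : ℕ) (A : Set (Fin n → ℝ)) (x : LatSpace n) : ℝ≥0∞ :=
  ∑ m : Fin h, ∑' D : ReducedBases h m, indepSum
    ((combine ((integralBasis D.1).2.map (Int.cast : ℤ → ℝ)) ⁻¹' injTuples h A).indicator 1) x

lemma measurableSet_preimage_combine {n h m : ℕ} (C : Matrix (Fin h) (Fin m) ℝ)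
    {A : Set (Fin n → ℝ)} (hA : MeasurableSet A) :
    MeasurableSet (combine C ⁻¹' injTuples h A) :=
  measurable_combine C (measurableSet_injTuples h hA)

lemma measurable_dependentBound {n : ℕ} (h : ℕ) {A : Set (Fin n → ℝ)} (hA : MeasurableSet A) :
    Measurable (dependentBound h A) := by
  refine Finset.measurable_fun_sum _ fun m _ => ?_
  have : Countable (ReducedBases h m) := (countable_reducedBases h m).to_subtype
  exact Measurable.tsum fun D =>
    measurable_indepSum (measurable_one.indicator (measurableSet_preimage_combine _ hA))

lemma indepSum_le_tupleCount {n : ℕ} (h : ℕ) (A : Set (Fin n → ℝ)) (g : SLR n) :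
    indepSum ((injTuples h A).indicator 1) (latMk n g) ≤ tupleCount h A g := by
  rw [indepSum_latMk]
  exact ENNReal.tsum_comp_le_tsum_of_injective Subtype.val_injective
    fun X => (injTuples h A).indicator 1 (rowMul (intTuple X) g.1)

lemma tupleCount_le {n : ℕ} (h : ℕ) (A : Set (Fin n → ℝ)) (g : SLR n) :
    tupleCount h A g ≤
      indepSum ((injTuples h A).indicator 1) (latMk n g) + dependentBound h A (latMk n g) := by
  rw [tupleCount, ← (ENNReal.summable).tsum_add_tsum_compl (ENNReal.summable)
    (s := {X : Fin h → Fin n → ℤ | LinearIndependent ℝ (intTuple X)})]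
  refine add_le_add (indepSum_latMk _ g).ge
    ((tsum_dependent_le ((injTuples h A).indicator 1) g.1).trans_eq ?_)
  simp only [dependentBound, indepSum_latMk]
  rfl

lemma lintegral_dependentBound_le {n h : ℕ} (hn : 2 ≤ n) (hh : 2 * h ^ 2 ≤ n)
    {μ : Measure (LatSpace n)} [IsProbabilityMeasure μ] (hμ : ∀ a, μ.map (rTranslate n a) = μ)
    {A : Set (Fin n → ℝ)} (hA : MeasurableSet A) (h0 : 0 ∉ A) (hneg : ∀ x ∈ A, -x ∉ A) :
    ∫⁻ x, dependentBound h A x ∂μ ≤ ENNReal.ofReal (23 * 0.999 ^ n) * (volume A + 1) ^ h := by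
  have hu : ∀ (m : Fin h) (D : ReducedBases h m), Measurable
      ((combine ((integralBasis D.1).2.map (Int.cast : ℤ → ℝ)) ⁻¹' injTuples h A).indicator
        (1 : (Fin m → Fin n → ℝ) → ℝ≥0∞)) := fun m D =>
    measurable_one.indicator (measurableSet_preimage_combine _ hA)
  have hterm : ∀ m : Fin h, h * ∫⁻ x, ∑' D : ReducedBases h m, indepSum
      ((combine ((integralBasis D.1).2.map (Int.cast : ℤ → ℝ)) ⁻¹' injTuples h A).indicator 1) x ∂μ
      ≤ ENNReal.ofReal (23 * 0.999 ^ n) * (volume A + 1) ^ h := fun m => by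
    have : Countable (ReducedBases h m) := (countable_reducedBases h m).to_subtype
    have hmn : m.1 < n := by nlinarith [m.2]
    rw [lintegral_tsum fun D => (measurable_indepSum (hu m D)).aemeasurable]
    simp_rw [lintegral_indepSum hmn hμ (hu m _),
      lintegral_indicator_one (measurableSet_preimage_combine _ hA)]
    calc _ ≤ _ := mul_le_mul_right (tsum_volume_integralBasis_le m.2 hA h0 hneg) (h : ℝ≥0∞)
      _ ≤ ENNReal.ofReal (23 * 0.999 ^ n) * volume A ^ m.1 := by
          rw [← mul_assoc]
          gcongr
          exact error_coefficient_le hn hh m.2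
      _ ≤ ENNReal.ofReal (23 * 0.999 ^ n) * (volume A + 1) ^ h := by
          refine mul_le_mul_right (le_trans ?_ (pow_le_pow_right₀ le_add_self m.2.le)) _
          exact pow_le_pow_left₀ zero_le le_self_add _
  unfold dependentBound
  rw [lintegral_finsetSum]
  · refine (Finset.sum_le_sum fun m _ => (ENNReal.le_div_iff_mul_le ?_ ?_).mpr
      ((mul_comm _ _).trans_le (hterm m))).trans ?_
    · exact Or.inl (by exact_mod_cast (Nat.zero_le _).trans_lt m.2 |>.ne')
    · exact Or.inl (ENNReal.natCast_ne_top h)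
    · rw [Finset.sum_const, Finset.card_fin, nsmul_eq_mul]
      exact ENNReal.mul_div_le
  · intro m _
    have : Countable (ReducedBases h m) := (countable_reducedBases h m).to_subtype
    exact Measurable.tsum fun D => measurable_indepSum (hu m D)

/-- **Proposition (moment estimate for `ρ_{S',h}`).** Let `n ≥ 2`, let `S ⊆ ℝ^n` be a
Borel measurable set symmetric about the origin with Lebesgue measure `V`, and let `h`
be a positive integer with `h ≤ √(n/2)`. Then
`0 ≤ ∫_{X_n} ρ_{S',h}(L) dμ_n(L) − (1/h!)(V/2)^h ≤ (23/h!)(0.999)^n (V/2+1)^{√(n/2)}`,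
where `ρ_{S',h}(L)` is the number of `h`-element subsets of `L ∩ S'`. -/
theorem stmt15 (n h : ℕ) (hn : 2 ≤ n) (hh : 0 < h)
    (hhn : (h : ℝ) ≤ Real.sqrt ((n : ℝ) / 2))
    (S : Set (Fin n → ℝ)) (hSmeas : MeasurableSet S)
    (hSsymm : ∀ x, x ∈ S ↔ -x ∈ S)
    (V : ℝ) (hV0 : 0 ≤ V) (hvol : MeasureTheory.volume S = ENNReal.ofReal V)
    (μ : MeasureTheory.Measure (LatSpace n)) [MeasureTheory.IsProbabilityMeasure μ]
    (hinv : ∀ a : SLR n, μ.map (rTranslate n a) = μ)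
    (f : LatSpace n → ℝ)
    (hf : ∀ g : SLR n, f (latMk n g) = (rhoSub n S h g : ℝ)) :
    0 ≤ (∫ x, f x ∂μ) - (1 / (h)!) * (V / 2) ^ h ∧
    (∫ x, f x ∂μ) - (1 / (h)!) * (V / 2) ^ h
      ≤ (23 / (h)!) * (0.999 : ℝ) ^ n * (V / 2 + 1) ^ (Real.sqrt ((n : ℝ) / 2)) := by
  have h2n : 2 * h ^ 2 ≤ n := by
    have h1 : (h : ℝ) ^ 2 ≤ n / 2 := by
      rw [Real.le_sqrt (by positivity) (by positivity)] at hhn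
      exact hhn
    have h3 : (2 : ℝ) * h ^ 2 ≤ n := by linarith
    exact_mod_cast h3
  have hhlt : h < n := by nlinarith
  have hA := measurableSet_posHalf hSmeas
  have hvA := volume_posHalf (by omega) hSmeas hSsymm hvol
  have hdep := lintegral_dependentBound_le hn h2n hinv hA (zero_notMem_posHalf S)
    fun x hx => neg_notMem_posHalf hx
  have hum : Measurable ((injTuples h (posHalf n S)).indicator
      (1 : (Fin h → Fin n → ℝ) → ℝ≥0∞)) := measurable_one.indicator (measurableSet_injTuples h hA)
  have hmain : ∫⁻ x, indepSum ((injTuples h (posHalf n S)).indicator 1) x ∂μ =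
      ENNReal.ofReal ((V / 2) ^ h) := by
    rw [lintegral_indepSum hhlt hinv hum, lintegral_indicator_one (measurableSet_injTuples h hA),
      volume_injTuples hhlt.le, hvA, ENNReal.ofReal_pow (by positivity)]
  have hbound : ENNReal.ofReal (23 * 0.999 ^ n) * (volume (posHalf n S) + 1) ^ h ≤
      ENNReal.ofReal (23 * 0.999 ^ n * (V / 2 + 1) ^ Real.sqrt ((n : ℝ) / 2)) := by
    rw [hvA, ← ENNReal.ofReal_one, ← ENNReal.ofReal_add (by positivity) zero_le_one,
      ← ENNReal.ofReal_pow (by positivity), ← ENNReal.ofReal_mul (by positivity)]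
    apply ENNReal.ofReal_le_ofReal
    rw [← Real.rpow_natCast (V / 2 + 1) h]
    gcongr
    linarith
  have hf0 : ∀ x, 0 ≤ f x := fun x => by
    obtain ⟨g, rfl⟩ := latMk_surjective n x
    rw [hf]
    positivity
  have hfg : ∀ g, (h)! * f (latMk n g) = (tupleCount h (posHalf n S) g).toReal := fun g => by
    rw [hf, toReal_tupleCount]
  have hfac : ((h)! : ℝ) ≠ 0 := by positivity
  have hfm : Measurable fun x => (h)! * f x := measurable_of_comp_latMk (by
    simp only [hfg]
    exact (measurable_tupleCount h hA).ennreal_toReal)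
  set U := indepSum ((injTuples h (posHalf n S)).indicator 1) with hU
  have hUm : Measurable U := measurable_indepSum hum
  have hG : ∫⁻ x, U x + dependentBound h (posHalf n S) x ∂μ ≤ ENNReal.ofReal ((V / 2) ^ h +
      23 * 0.999 ^ n * (V / 2 + 1) ^ Real.sqrt ((n : ℝ) / 2)) := by
    rw [lintegral_add_left hUm, hmain, ENNReal.ofReal_add (by positivity) (by positivity)]
    exact add_le_add_right (hdep.trans hbound) _
  have hupper : ∫⁻ x, ENNReal.ofReal ((h)! * f x) ∂μ ≤ ENNReal.ofReal ((V / 2) ^ h +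
      23 * 0.999 ^ n * (V / 2 + 1) ^ Real.sqrt ((n : ℝ) / 2)) := by
    refine (lintegral_mono fun x => ?_).trans hG
    obtain ⟨g, rfl⟩ := latMk_surjective n x
    rw [hfg]
    exact ENNReal.ofReal_toReal_le.trans (tupleCount_le h _ g)
  have hfin : ∀ᵐ x ∂μ, U x + dependentBound h (posHalf n S) x < ⊤ :=
    ae_lt_top (hUm.add (measurable_dependentBound h hA)) (hG.trans_lt ENNReal.ofReal_lt_top).ne
  have hlower : ENNReal.ofReal ((V / 2) ^ h) ≤ ∫⁻ x, ENNReal.ofReal ((h)! * f x) ∂μ := by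
    rw [← hmain]
    refine lintegral_mono_ae (hfin.mono fun x hx => ?_)
    obtain ⟨g, rfl⟩ := latMk_surjective n x
    rw [hfg, ENNReal.ofReal_toReal ((tupleCount_le h _ g).trans_lt hx).ne]
    exact indepSum_le_tupleCount h _ g
  have hint : (h)! * ∫ x, f x ∂μ = (∫⁻ x, ENNReal.ofReal ((h)! * f x) ∂μ).toReal := by
    rw [← integral_const_mul]
    exact integral_eq_lintegral_of_nonneg_ae
      (Filter.Eventually.of_forall fun x => mul_nonneg (by positivity) (hf0 x))
      hfm.aestronglyMeasurable
  have h1 : (V / 2) ^ h ≤ (h)! * ∫ x, f x ∂μ := by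
    rw [hint]
    exact (ENNReal.ofReal_le_iff_le_toReal (hupper.trans_lt ENNReal.ofReal_lt_top).ne).mp hlower
  have h2 : (h)! * ∫ x, f x ∂μ ≤
      (V / 2) ^ h + 23 * 0.999 ^ n * (V / 2 + 1) ^ Real.sqrt ((n : ℝ) / 2) := by
    rw [hint]
    exact ENNReal.toReal_le_of_le_ofReal (by positivity) hupper
  have hpos : (0 : ℝ) < (h)! := by positivity
  constructor
  · rw [sub_nonneg, one_div_mul_eq_div, div_le_iff₀' hpos]
    exact h1
  · rw [sub_le_iff_le_add, ← mul_le_mul_iff_right₀ hpos]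
    refine h2.trans_eq ?_
    field_simp
    ring
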